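/- Let δ₂ = 0.044560, δ₃ = 0.074267, δ₄ = 0.103974, and δ_ℓ = 0.124821 for ℓ ≥ 5, and set θ_ℓ = ℓ − δ_ℓ. Let ℓ ≥ 2 be an integer and let α ≥ 1/2 and β ≥ 0 be real numbers with α, β ≤ 1. If α/2 + β > 1 and β/(α/2 + β − 1) ≤ θ_ℓ, then the quadruple (3, ℓ; α, β) is admissible: for every ε > 0 there exists M such that for every integer m ≥ M and every integer a with gcd(a,m) = 1, there exist primes p₁, p₂, p₃ ≤ m^{α+ε} and a positive integer s ≤ m^{β+ε} which is a product of at most ℓ primes (counted with multiplicity), such that p₁·p₂·p₃·s ≡ a (mod m). -/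

import Mathlib

/-- The Greaves sieve constants δ_ℓ. -/
noncomputable def greavesDelta (l : ℕ) : ℝ :=
  if l ≤ 2 then 0.044560
  else if l = 3 then 0.074267
  else if l = 4 then 0.103974
  else 0.124821

/-- θ_ℓ = ℓ - δ_ℓ. -/
noncomputable def greavesTheta (l : ℕ) : ℝ := l - greavesDelta l



/-- number of pairs with a given product modulo `m`. -/
theorem cb_pairs (m N T W : ℕ) [NeZero m] (X : Finset ℕ) (hX : ∀ x ∈ X, 1 ≤ x ∧ x ≤ N)
    (hW : ∀ u : ℕ, 1 ≤ u → u ≤ T * N → u.divisors.card ≤ W) (c : ZMod m) :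
    (((X ×ˢ ((Finset.Icc (-(T:ℤ)) T).filter (fun t => t ≠ 0))).filter
      (fun q => ((q.2 * q.1 : ℤ) : ZMod m) = c)).card : ℝ) ≤ W * (2 * T * N / m + 2) := by
  classical
  set U : Finset ℤ := (Finset.Ico (-((T * N : ℕ):ℤ)) ((T*N:ℕ)+1)).filter
    (fun u => u ≡ c.valMinAbs [ZMOD m]) with hU
  have hmpos : 0 < m := Nat.pos_of_ne_zero (NeZero.ne m)
  have h1 : (((X ×ˢ ((Finset.Icc (-(T:ℤ)) T).filter (fun t => t ≠ 0))).filter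
      (fun q => ((q.2 * q.1 : ℤ) : ZMod m) = c)).card) ≤ W * U.card := by
    apply Finset.card_le_mul_card_image_of_maps_to (f := fun q : ℕ × ℤ => q.2 * (q.1:ℤ))
    · rintro ⟨x, t⟩ h
      simp only [Finset.mem_filter, Finset.mem_product, Finset.mem_Icc] at h
      obtain ⟨⟨hx, ht, ht0⟩, hc⟩ := h
      have hxN := hX x hx
      simp only [hU, Finset.mem_filter, Finset.mem_Ico]
      refine ⟨⟨?_, ?_⟩, ?_⟩
      · push_cast
        have : (x:ℤ) ≤ N := by exact_mod_cast hxN.2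
        nlinarith [ht.1, ht.2]
      · push_cast
        have : (x:ℤ) ≤ N := by exact_mod_cast hxN.2
        nlinarith [ht.1, ht.2]
      · rw [← ZMod.intCast_eq_intCast_iff, ZMod.coe_valMinAbs]; exact hc
    · intro u _
      by_cases hu0 : u = 0
      · subst hu0
        rw [Finset.card_eq_zero.2]
        · exact Nat.zero_le _
        rw [Finset.filter_eq_empty_iff]
        rintro ⟨x, t⟩ h
        simp only [Finset.mem_filter, Finset.mem_product, Finset.mem_Icc] at h
        have hxN := hX x h.1.1
        have h3 := h.1.2.2
        simp only [mul_eq_zero, not_or]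
        exact ⟨h3, by exact_mod_cast (by omega : x ≠ 0)⟩
      · by_cases huT : u.natAbs ≤ T * N
        · refine le_trans ?_ (hW u.natAbs (by omega) huT)
          apply Finset.card_le_card_of_injOn (fun q : ℕ × ℤ => q.1)
          · rintro ⟨x, t⟩ h
            simp only [Finset.coe_filter, Finset.mem_filter, Finset.mem_product, Set.mem_ofPred_eq] at h
            simp only [Finset.mem_coe, Nat.mem_divisors]
            refine ⟨?_, by omega⟩
            rw [← h.2, Int.natAbs_mul]
            simp
          · rintro ⟨x, t⟩ h ⟨x', t'⟩ h' hxx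
            simp only [Finset.coe_filter, Finset.mem_filter, Finset.mem_product, Set.mem_ofPred_eq] at h h' hxx
            subst hxx
            have hxN := hX x h.1.1.1
            have : (x:ℤ) ≠ 0 := by exact_mod_cast (by omega : x ≠ 0)
            have := mul_right_cancel₀ this (h.2.trans h'.2.symm)
            rw [this]
        · rw [Finset.card_eq_zero.2]
          · exact Nat.zero_le _
          rw [Finset.filter_eq_empty_iff]
          rintro ⟨x, t⟩ h
          simp only [Finset.mem_filter, Finset.mem_product, Finset.mem_Icc] at h
          intro h3
          apply huT
          simp only at h3
          rw [← h3, Int.natAbs_mul]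
          simp only [Int.natAbs_natCast]
          exact Nat.mul_le_mul (by omega) (hX x h.1.1).2
  have h2 : (U.card : ℝ) ≤ 2 * T * N / m + 2 := by
    have := Int.Ico_filter_modEq_card (-((T * N : ℕ):ℤ)) ((T*N:ℕ)+1) (by exact_mod_cast hmpos : (0:ℤ) < m) c.valMinAbs
    rw [← hU] at this
    have hA := Int.ceil_lt_add_one ((((((T*N:ℕ):ℤ)+1 : ℤ) - c.valMinAbs : ℚ)) / ((m:ℤ):ℚ))
    have hB := Int.le_ceil ((((-((T * N : ℕ):ℤ) : ℤ) - c.valMinAbs : ℚ)) / ((m:ℤ):ℚ))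
    have hq : (U.card : ℚ) ≤ 2 * T * N / m + 2 := by
      have h4 : ((U.card : ℤ) : ℚ) = ((max (⌈(((((T*N:ℕ):ℤ)+1 : ℤ) - c.valMinAbs : ℚ)) / ((m:ℤ):ℚ)⌉ - ⌈((((-((T * N : ℕ):ℤ) : ℤ) - c.valMinAbs : ℚ)) / ((m:ℤ):ℚ))⌉) 0 : ℤ) : ℚ) := by
        rw [this]
      rw [Int.cast_natCast] at h4
      rw [h4, Int.cast_max]
      have hm1 : (1:ℚ) / m ≤ 1 := by
        rw [div_le_one (by exact_mod_cast hmpos)]; exact_mod_cast hmpos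
      apply max_le
      · push_cast at hA hB ⊢
        have e : (((T:ℚ) * N + 1 - (c.valMinAbs:ℚ)) / m) - ((-((T:ℚ) * N) - (c.valMinAbs:ℚ)) / m) = 2 * T * N / m + 1 / m := by ring
        linarith
      · push_cast; positivity
    have h5 : ((U.card : ℚ) : ℝ) ≤ ((2 * T * N / m + 2 : ℚ) : ℝ) := by exact_mod_cast hq
    push_cast at h5
    exact h5
  calc _ ≤ ((W * U.card : ℕ) : ℝ) := by exact_mod_cast h1
    _ = W * (U.card : ℝ) := by push_cast; ring
    _ ≤ _ := by gcongr

/-- the second moment of r. -/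
theorem cb_second (m N T W : ℕ) [NeZero m] (X : Finset ℕ)
    (hX : ∀ x ∈ X, 1 ≤ x ∧ x ≤ N ∧ Nat.Coprime x m)
    (hW : ∀ u : ℕ, 1 ≤ u → u ≤ T * N → u.divisors.card ≤ W) :
    (∑ ξ : ZMod m, ((X.filter (fun x : ℕ => (x:ZMod m) * ξ ≠ 0 ∧ ((x:ZMod m) * ξ).valMinAbs.natAbs ≤ T)).card : ℝ)^2)
     ≤ (2 * T * N) * (W * (2 * T * N / m + 2)) := by
  classical
  obtain ⟨R, hR⟩ : ∃ R : Finset ℤ, R = (Finset.Icc (-(T:ℤ)) T).filter (fun t => t ≠ 0) := ⟨_, rfl⟩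
  set A : ZMod m → Finset ℕ := fun ξ => X.filter (fun x : ℕ => (x:ZMod m) * ξ ≠ 0 ∧ ((x:ZMod m) * ξ).valMinAbs.natAbs ≤ T) with hA
  have hRc : (R.card : ℝ) = 2 * T := by
    have : R = (Finset.Icc (-(T:ℤ)) T).erase 0 := by
      ext t; simp [hR, and_comm]
    rw [this, Finset.card_erase_of_mem (by simp)]
    simp only [Int.card_Icc]
    have : ((T:ℤ) + 1 - -(T:ℤ)).toNat - 1 = 2 * T := by omega
    rw [this]; push_cast; ring
  have hXc : (X.card : ℝ) ≤ N := by
    have : X ⊆ Finset.Icc 1 N := by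
      intro x hx; rw [Finset.mem_Icc]; exact ⟨(hX x hx).1, (hX x hx).2.1⟩
    have := Finset.card_le_card this
    rw [Nat.card_Icc] at this
    exact_mod_cast (by omega : X.card ≤ N)
  -- set of triples
  let S : Finset (Σ _ : ZMod m, ℕ × ℕ) := Finset.univ.sigma (fun ξ => A ξ ×ˢ A ξ)
  have hS : (∑ ξ : ZMod m, ((A ξ).card : ℝ)^2) = (S.card : ℝ) := by
    simp only [S, Finset.card_sigma, Finset.card_product]
    push_cast
    exact Finset.sum_congr rfl (fun _ _ => by ring)
  let Q : Finset (Σ _ : ℕ × ℤ, ℕ × ℤ) := (X ×ˢ R).sigma (fun q => (X ×ˢ R).filter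
      (fun q' => ((q'.2 * q'.1 : ℤ) : ZMod m) = ((q.2 * q.1 : ℤ) : ZMod m)))
  have hSQ : S.card ≤ Q.card := by
    apply Finset.card_le_card_of_injOn (fun s : (Σ _ : ZMod m, ℕ × ℕ) =>
      (⟨(s.2.1, ((s.2.2 : ZMod m) * s.1).valMinAbs), (s.2.2, ((s.2.1 : ZMod m) * s.1).valMinAbs)⟩ : (Σ _ : ℕ × ℤ, ℕ × ℤ)))
    · rintro ⟨ξ, x, x'⟩ h
      simp only [S, Finset.mem_coe, Finset.mem_sigma, Finset.mem_product, hA, Finset.mem_filter, Finset.mem_univ, true_and] at h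
      simp only [Q, hR, Finset.mem_coe, Finset.mem_sigma, Finset.mem_product, Finset.mem_filter, Finset.mem_Icc]
      have key : ∀ y : ZMod m, y.valMinAbs ≠ 0 ↔ y ≠ 0 := fun y => by rw [Ne, ZMod.valMinAbs_eq_zero]
      refine ⟨⟨h.1.1, ⟨by omega, by omega⟩, (key _).2 h.2.2.1⟩, ⟨h.2.1, ⟨by omega, by omega⟩, (key _).2 h.1.2.1⟩, ?_⟩
      push_cast
      ring
    · rintro ⟨ξ, x, x'⟩ h ⟨ξ', y, y'⟩ h' he
      simp only [S, Finset.mem_coe, Finset.mem_sigma, Finset.mem_product, hA, Finset.mem_filter, Finset.mem_univ, true_and] at h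
      simp only [Sigma.mk.injEq, Prod.mk.injEq, heq_eq_eq] at he
      obtain ⟨⟨rfl, h2⟩, rfl, h4⟩ := he
      have hx := (hX x h.1.1).2.2
      have h5 := ZMod.valMinAbs_inj.1 h4
      have hu : IsUnit (x : ZMod m) := (ZMod.isUnit_iff_coprime x m).2 hx
      have := hu.mul_left_cancel h5
      rw [this]
  have hQ : (Q.card : ℝ) ≤ (2 * T * N) * (W * (2 * T * N / m + 2)) := by
    have hQ1 : (Q.card : ℝ) = ∑ q ∈ X ×ˢ R, (((X ×ˢ R).filter
      (fun q' => ((q'.2 * q'.1 : ℤ) : ZMod m) = ((q.2 * q.1 : ℤ) : ZMod m))).card : ℝ) := by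
      rw [Finset.card_sigma, Nat.cast_sum]
    rw [hQ1]
    calc _ ≤ ∑ q ∈ X ×ˢ R, (W * (2 * T * N / m + 2) : ℝ) := by
          apply Finset.sum_le_sum
          intro q _
          have h9 := cb_pairs m N T W X (fun x hx => ⟨(hX x hx).1, (hX x hx).2.1⟩) hW ((q.2 * q.1 : ℤ) : ZMod m)
          rw [← hR] at h9
          exact h9
      _ = (X.card * R.card : ℝ) * (W * (2 * T * N / m + 2)) := by
          rw [Finset.sum_const, Finset.card_product]; push_cast [nsmul_eq_mul]; ring
      _ ≤ _ := by
          rw [hRc]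
          have : (X.card : ℝ) * (2 * T) ≤ 2 * T * N := by nlinarith [hXc, (Nat.cast_nonneg T : (0:ℝ) ≤ T)]
          gcongr
  rw [hS]
  exact le_trans (by exact_mod_cast hSQ) hQ


theorem cb_parseval (m : ℕ) [NeZero m] (f : ZMod m → ℝ) :
    ∑ ξ : ZMod m, ‖∑ b : ZMod m, (f b : ℂ) * ZMod.stdAddChar (b * ξ)‖^2 = m * ∑ b, (f b)^2 := by
  classical
  have h1 : ∀ ξ : ZMod m, ((‖∑ b : ZMod m, (f b : ℂ) * ZMod.stdAddChar (b * ξ)‖^2 : ℝ) : ℂ)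
      = ∑ b : ZMod m, ∑ b' : ZMod m, (f b * f b' : ℂ) * ZMod.stdAddChar (ξ * (b - b')) := by
    intro ξ
    rw [Complex.ofReal_pow, ← Complex.mul_conj', map_sum, Finset.sum_mul_sum]
    refine Finset.sum_congr rfl (fun b _ => Finset.sum_congr rfl (fun b' _ => ?_))
    rw [map_mul (starRingEnd ℂ), Complex.conj_ofReal]
    have : (starRingEnd ℂ) (ZMod.stdAddChar (b' * ξ)) = ZMod.stdAddChar (-(b' * ξ)) := by
      rw [AddChar.map_neg_eq_conj]
    rw [this]
    have e : ξ * (b - b') = b * ξ + -(b' * ξ) := by ring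
    rw [e, AddChar.map_add_eq_mul]
    ring
  have h2 : (((∑ ξ : ZMod m, ‖∑ b : ZMod m, (f b : ℂ) * ZMod.stdAddChar (b * ξ)‖^2 : ℝ)) : ℂ)
      = ((m * ∑ b, (f b)^2 : ℝ) : ℂ) := by
    rw [Complex.ofReal_sum, Finset.sum_congr rfl (fun ξ _ => h1 ξ), Finset.sum_comm]
    rw [Complex.ofReal_mul, Complex.ofReal_sum, Finset.mul_sum]
    refine Finset.sum_congr rfl (fun b _ => ?_)
    rw [Finset.sum_comm]
    have : ∀ b' : ZMod m, ∑ ξ : ZMod m, (f b * f b' : ℂ) * ZMod.stdAddChar (ξ * (b - b'))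
        = if b' = b then (f b * f b' : ℂ) * m else 0 := by
      intro b'
      rw [← Finset.mul_sum, AddChar.sum_mulShift _ (ZMod.isPrimitive_stdAddChar m)]
      by_cases h : b' = b
      · subst h; simp [ZMod.card]
      · rw [if_neg (fun h' => h (sub_eq_zero.1 h').symm), if_neg h]; simp
    rw [Finset.sum_congr rfl (fun b' _ => this b')]
    simp; ring
  exact_mod_cast h2

theorem cb_norm_sub_one (m : ℕ) [NeZero m] (ξ : ZMod m) :
    4 * (ξ.valMinAbs.natAbs : ℝ) / m ≤ ‖ZMod.stdAddChar ξ - 1‖ := by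
  have hm : (0:ℝ) < m := by exact_mod_cast Nat.pos_of_ne_zero (NeZero.ne m)
  have h0 : (ZMod.stdAddChar ξ : ℂ) = Complex.exp (Complex.I * ((2 * Real.pi * ξ.valMinAbs / m : ℝ) : ℂ)) := by
    conv_lhs => rw [← ZMod.coe_valMinAbs ξ]
    rw [ZMod.stdAddChar_coe]
    congr 1; push_cast; ring
  rw [h0, Complex.norm_exp_I_mul_ofReal_sub_one]
  have e : 2 * Real.pi * (ξ.valMinAbs : ℝ) / m / 2 = Real.pi * ξ.valMinAbs / m := by ring
  rw [e]
  have hb := ZMod.valMinAbs_mem_Ioc ξ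
  have hab : (ξ.valMinAbs.natAbs : ℝ) * 2 ≤ m := by
    have : ξ.valMinAbs.natAbs * 2 ≤ m := by
      obtain ⟨h1, h2⟩ := hb; omega
    exact_mod_cast this
  have habs : ‖2 * Real.sin (Real.pi * (ξ.valMinAbs:ℝ) / m)‖ = 2 * |Real.sin (Real.pi * (ξ.valMinAbs.natAbs:ℝ) / m)| := by
    rw [Real.norm_eq_abs, abs_mul, abs_two]
    have : (ξ.valMinAbs.natAbs : ℝ) = |(ξ.valMinAbs : ℝ)| := by
      rw [Nat.cast_natAbs]; push_cast; rfl
    rw [this]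
    rcases abs_choice (ξ.valMinAbs : ℝ) with h | h
    · rw [h]
    · rw [h]
      have : Real.pi * -(ξ.valMinAbs:ℝ) / m = -(Real.pi * (ξ.valMinAbs:ℝ) / m) := by ring
      rw [this, Real.sin_neg, abs_neg]
  rw [habs]
  have hs := Real.mul_le_sin (x := Real.pi * (ξ.valMinAbs.natAbs:ℝ) / m) (by positivity) (by
    rw [div_le_div_iff₀ hm (by norm_num)]; nlinarith [Real.pi_pos])
  have e2 : 2 / Real.pi * (Real.pi * (ξ.valMinAbs.natAbs:ℝ) / m) = 2 * (ξ.valMinAbs.natAbs:ℝ) / m := by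
    field_simp
  rw [e2] at hs
  have := le_abs_self (Real.sin (Real.pi * (ξ.valMinAbs.natAbs:ℝ) / m))
  calc _ = 2 * (2 * (ξ.valMinAbs.natAbs:ℝ) / m) := by ring
    _ ≤ _ := by linarith

/-- balanced interval indicator -/
noncomputable def cbg (m K : ℕ) (b : ZMod m) : ℝ :=
  (((Finset.Icc 1 K).filter (fun k : ℕ => (k : ZMod m) = b)).card : ℝ) - K / m

noncomputable def cbghat (m K : ℕ) [NeZero m] (ξ : ZMod m) : ℂ :=
  ∑ b : ZMod m, (cbg m K b : ℂ) * ZMod.stdAddChar (b * ξ)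

theorem cb_ghat_eq (m K : ℕ) [NeZero m] (ξ : ZMod m) :
    cbghat m K ξ = (∑ k ∈ Finset.Icc 1 K, ZMod.stdAddChar ((k:ZMod m) * ξ)) - if ξ = 0 then (K:ℂ) else 0 := by
  classical
  have hm : (m:ℂ) ≠ 0 := by exact_mod_cast NeZero.ne m
  unfold cbghat cbg
  have h1 : ∀ b : ZMod m, (((((Finset.Icc 1 K).filter (fun k : ℕ => (k : ZMod m) = b)).card : ℝ) - K / m : ℝ) : ℂ) * ZMod.stdAddChar (b * ξ)
      = (∑ k ∈ Finset.Icc 1 K, if (k:ZMod m) = b then (ZMod.stdAddChar ((k:ZMod m) * ξ) : ℂ) else 0) - (K / m : ℂ) * ZMod.stdAddChar (b * ξ) := by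
    intro b
    push_cast
    rw [sub_mul, Finset.card_filter]
    push_cast
    rw [Finset.sum_mul]
    congr 1
    refine Finset.sum_congr rfl (fun k _ => ?_)
    split_ifs with h
    · rw [h]; simp
    · simp
  rw [Finset.sum_congr rfl (fun b _ => h1 b), Finset.sum_sub_distrib, Finset.sum_comm, ← Finset.mul_sum,
    AddChar.sum_mulShift _ (ZMod.isPrimitive_stdAddChar m)]
  congr 1
  · refine Finset.sum_congr rfl (fun k _ => ?_)
    simp
  · split_ifs
    · rw [ZMod.card]; field_simp
    · simp

theorem cb_ghat_zero (m K : ℕ) [NeZero m] : cbghat m K 0 = 0 := by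
  rw [cb_ghat_eq]; simp

theorem cb_ghat_le (m K : ℕ) [NeZero m] (ξ : ZMod m) : ‖cbghat m K ξ‖ ≤ K := by
  by_cases h : ξ = 0
  · subst h; rw [cb_ghat_zero]; simp
  rw [cb_ghat_eq, if_neg h, sub_zero]
  refine (norm_sum_le _ _).trans ?_
  have : ∀ k ∈ Finset.Icc 1 K, ‖(ZMod.stdAddChar ((k:ZMod m) * ξ) : ℂ)‖ = 1 := fun k _ => AddChar.norm_apply _ _
  rw [Finset.sum_congr rfl this]; simp

theorem cb_ghat_le2 (m K : ℕ) [NeZero m] (ξ : ZMod m) (h : ξ ≠ 0) :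
    ‖cbghat m K ξ‖ * (2 * ξ.valMinAbs.natAbs) ≤ m := by
  have hm : (0:ℝ) < m := by exact_mod_cast Nat.pos_of_ne_zero (NeZero.ne m)
  rw [cb_ghat_eq, if_neg h, sub_zero]
  have h1 : (∑ k ∈ Finset.Icc 1 K, (ZMod.stdAddChar ((k:ZMod m) * ξ) : ℂ)) * (ZMod.stdAddChar ξ - 1)
     = ZMod.stdAddChar ξ * (ZMod.stdAddChar ((K:ZMod m) * ξ) - 1) := by
    induction K with
    | zero => simp
    | succ n ih =>
      rw [Finset.sum_Icc_succ_top (by omega), add_mul, ih]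
      push_cast
      rw [add_mul, one_mul, AddChar.map_add_eq_mul]; ring
  have h2 : ‖∑ k ∈ Finset.Icc 1 K, (ZMod.stdAddChar ((k:ZMod m) * ξ) : ℂ)‖ * ‖(ZMod.stdAddChar ξ - 1 : ℂ)‖ ≤ 2 := by
    rw [← norm_mul, h1, norm_mul, AddChar.norm_apply, one_mul]
    refine (norm_sub_le _ _).trans ?_
    rw [AddChar.norm_apply]; norm_num
  have h3 := cb_norm_sub_one m ξ
  set S := ‖∑ k ∈ Finset.Icc 1 K, (ZMod.stdAddChar ((k:ZMod m) * ξ) : ℂ)‖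
  have h4 : S * (4 * (ξ.valMinAbs.natAbs : ℝ) / m) ≤ 2 := le_trans (by gcongr) h2
  have e : S * (4 * (ξ.valMinAbs.natAbs : ℝ) / m) = (S * (2 * ξ.valMinAbs.natAbs)) * 2 / m := by ring
  rw [e, div_le_iff₀ hm] at h4
  linarith

theorem cb_ghat_dyadic (m K J H : ℕ) [NeZero m] (hK : 1 ≤ K) (hJ : m ≤ 2^J)
    (hH : (m:ℝ) ≤ K * H) (hH1 : 1 ≤ H) (ξ : ZMod m) :
    ‖cbghat m K ξ‖ ≤ ∑ j ∈ Finset.range (J+1), (1/2:ℝ)^j * K *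
      (if ξ ≠ 0 ∧ ξ.valMinAbs.natAbs ≤ 2^j * H then 1 else 0) := by
  classical
  by_cases h : ξ = 0
  · subst h; rw [cb_ghat_zero]; simp
  have hpos : 0 < ξ.valMinAbs.natAbs := by
    rw [Int.natAbs_pos, Ne, ZMod.valMinAbs_eq_zero]; exact h
  have hex : ∃ j, ξ.valMinAbs.natAbs ≤ 2^j * H := ⟨J, by
    have hb := ZMod.valMinAbs_mem_Ioc ξ
    have : ξ.valMinAbs.natAbs ≤ m := by
      obtain ⟨h1, h2⟩ := hb; omega
    nlinarith⟩
  have hjJ : Nat.find hex ≤ J := Nat.find_min' hex (by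
    have hb := ZMod.valMinAbs_mem_Ioc ξ
    have : ξ.valMinAbs.natAbs ≤ m := by
      obtain ⟨h1, h2⟩ := hb; omega
    nlinarith)
  set j := Nat.find hex with hj
  have hjs : ξ.valMinAbs.natAbs ≤ 2^j * H := Nat.find_spec hex
  have hterm : ‖cbghat m K ξ‖ ≤ (1/2:ℝ)^j * K * (if ξ ≠ 0 ∧ ξ.valMinAbs.natAbs ≤ 2^j * H then 1 else 0) := by
    rw [if_pos ⟨h, hjs⟩, mul_one]
    rcases Nat.eq_zero_or_pos j with h0 | h0
    · rw [h0]; simpa using cb_ghat_le m K ξ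
    · have hlt : ¬ (ξ.valMinAbs.natAbs ≤ 2^(j-1) * H) := Nat.find_min hex (by omega)
      push Not at hlt
      obtain ⟨i, hi⟩ : ∃ i, j = i + 1 := ⟨j-1, by omega⟩
      rw [hi] at hlt ⊢
      simp only [Nat.add_sub_cancel] at hlt
      have h2 := cb_ghat_le2 m K ξ h
      have h3 : ((2:ℝ)^i * H) ≤ ξ.valMinAbs.natAbs := by exact_mod_cast hlt.le
      have hHp : (0:ℝ) < H := by exact_mod_cast hH1
      set G := ‖cbghat m K ξ‖
      have hG : 0 ≤ G := norm_nonneg _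
      have h4 : G * (2 * (2^i * H)) ≤ K * H := by
        refine le_trans ?_ (h2.trans hH)
        gcongr
      have h5 : G * (2 * 2^i) ≤ K := by
        have : (G * (2 * 2^i)) * H ≤ K * H := by linarith
        exact le_of_mul_le_mul_right this hHp
      rw [one_div, inv_pow, inv_mul_eq_div, le_div_iff₀ (by positivity), pow_succ]
      linarith
  refine hterm.trans ?_
  refine Finset.single_le_sum (f := fun j => (1/2:ℝ)^j * K *
      (if ξ ≠ 0 ∧ ξ.valMinAbs.natAbs ≤ 2^j * H then 1 else 0)) (fun i _ => ?_) (Finset.mem_range.2 (by omega))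
  positivity



set_option maxHeartbeats 400000 in
theorem cb_meansq (m N K W J : ℕ) [NeZero m] (X : Finset ℕ)
    (hX : ∀ x ∈ X, 1 ≤ x ∧ x ≤ N ∧ Nat.Coprime x m) (a : ZMod m) (ha : IsUnit a)
    (hK : 1 ≤ K) (hKm : K ≤ m) (hJ : m ≤ 2^J) (hJ' : 2^J ≤ 2 * m)
    (hW : ∀ u : ℕ, 1 ≤ u → u ≤ 4 * m * m * N → u.divisors.card ≤ W) :
    ∑ w : ZMod m, (∑ x ∈ X, cbg m K (a * (x:ZMod m)⁻¹ * w))^2 ≤ 16 * (J+1)^2 * W * N * (N + K) := by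
  classical
  have hm : (0:ℝ) < m := by exact_mod_cast Nat.pos_of_ne_zero (NeZero.ne m)
  have hKp : (0:ℝ) < K := by exact_mod_cast hK
  set H : ℕ := m / K + 1 with hHdef
  have hH1 : 1 ≤ H := Nat.le_add_left 1 _
  have hH : (m:ℝ) ≤ K * H := by
    have : m ≤ K * H := by
      have := Nat.div_add_mod m K
      have h2 := Nat.mod_lt m hK
      rw [hHdef]; nlinarith
    exact_mod_cast this
  have hHm : H ≤ 2 * m := by
    have : m / K ≤ m := Nat.div_le_self _ _
    have : 0 < m := by omega
    omega
  have hHK : (H:ℝ) * K ≤ 2 * m := by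
    have : H * K ≤ 2 * m := by
      have := Nat.div_mul_le_self m K
      rw [hHdef]; nlinarith
    exact_mod_cast this
  set r : ℕ → ZMod m → ℝ := fun j ξ => ((X.filter (fun x : ℕ => (x:ZMod m) * ξ ≠ 0 ∧ ((x:ZMod m) * ξ).valMinAbs.natAbs ≤ 2^j * H)).card : ℝ) with hr
  -- transform of G
  have hT : ∀ ξ : ZMod m, ∑ w : ZMod m, ((∑ x ∈ X, cbg m K (a * (x:ZMod m)⁻¹ * w) : ℝ) : ℂ) * ZMod.stdAddChar (w * (a * ξ))
      = ∑ x ∈ X, cbghat m K ((x:ZMod m) * ξ) := by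
    intro ξ
    have h1 : ∀ w : ZMod m, ((∑ x ∈ X, cbg m K (a * (x:ZMod m)⁻¹ * w) : ℝ) : ℂ) * ZMod.stdAddChar (w * (a * ξ))
       = ∑ x ∈ X, (cbg m K (a * (x:ZMod m)⁻¹ * w) : ℂ) * ZMod.stdAddChar (w * (a * ξ)) := by
      intro w; push_cast; rw [Finset.sum_mul]
    rw [Finset.sum_congr rfl (fun w _ => h1 w), Finset.sum_comm]
    refine Finset.sum_congr rfl (fun x hx => ?_)
    unfold cbghat
    have hxu : IsUnit (x : ZMod m) := (ZMod.isUnit_iff_coprime x m).2 (hX x hx).2.2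
    have hxx : (x:ZMod m) * (x:ZMod m)⁻¹ = 1 := ZMod.coe_mul_inv_eq_one x (hX x hx).2.2
    have hxiu : IsUnit ((x:ZMod m)⁻¹) := IsUnit.of_mul_eq_one (x:ZMod m) (by rw [mul_comm]; exact hxx)
    have hu : IsUnit (a * (x:ZMod m)⁻¹) := ha.mul hxiu
    obtain ⟨u, hu⟩ := hu
    refine Fintype.sum_equiv (Units.mulLeft u) _ _ (fun w => ?_)
    simp only [Units.mulLeft_apply, hu]
    congr 2
    calc w * (a * ξ) = a * w * ξ * 1 := by ring
      _ = _ := by rw [← hxx]; ring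
  have hP := cb_parseval m (fun w => ∑ x ∈ X, cbg m K (a * (x:ZMod m)⁻¹ * w))
  obtain ⟨ua, hua⟩ := ha
  have hP2 : ∑ ξ : ZMod m, ‖∑ x ∈ X, cbghat m K ((x:ZMod m) * ξ)‖^2 =
      m * ∑ w : ZMod m, (∑ x ∈ X, cbg m K (a * (x:ZMod m)⁻¹ * w))^2 := by
    rw [← hP]
    refine Fintype.sum_equiv (Units.mulLeft ua) _ _ (fun ξ => ?_)
    simp only [Units.mulLeft_apply, hua]
    rw [hT ξ]
  -- pointwise bound
  have hpt : ∀ ξ : ZMod m, ‖∑ x ∈ X, cbghat m K ((x:ZMod m) * ξ)‖^2 ≤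
      (J+1) * ∑ j ∈ Finset.range (J+1), ((1/2:ℝ)^j * K)^2 * (r j ξ)^2 := by
    intro ξ
    have h1 : ‖∑ x ∈ X, cbghat m K ((x:ZMod m) * ξ)‖ ≤ ∑ j ∈ Finset.range (J+1), ((1/2:ℝ)^j * K) * r j ξ := by
      calc _ ≤ ∑ x ∈ X, ‖cbghat m K ((x:ZMod m) * ξ)‖ := norm_sum_le _ _
        _ ≤ ∑ x ∈ X, ∑ j ∈ Finset.range (J+1), (1/2:ℝ)^j * K *
            (if (x:ZMod m) * ξ ≠ 0 ∧ ((x:ZMod m) * ξ).valMinAbs.natAbs ≤ 2^j * H then 1 else 0) :=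
            Finset.sum_le_sum (fun x _ => cb_ghat_dyadic m K J H hK hJ hH hH1 _)
        _ = _ := by
            rw [Finset.sum_comm]
            refine Finset.sum_congr rfl (fun j _ => ?_)
            rw [← Finset.mul_sum, hr]
            simp only [Finset.card_filter]
            push_cast
            rfl
    calc _ ≤ (∑ j ∈ Finset.range (J+1), ((1/2:ℝ)^j * K) * r j ξ)^2 := by gcongr
      _ ≤ _ := by
        have := sq_sum_le_card_mul_sum_sq (s := Finset.range (J+1)) (f := fun j => ((1/2:ℝ)^j * K) * r j ξ)
        rw [Finset.card_range] at this
        push_cast at this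
        refine this.trans (le_of_eq ?_)
        congr 1
        exact Finset.sum_congr rfl (fun j _ => by ring)
  have hsec : ∀ j ∈ Finset.range (J+1), ((1/2:ℝ)^j * K)^2 * ∑ ξ : ZMod m, (r j ξ)^2 ≤ 16 * m * W * N * (N + K) := by
    intro j hj
    have hj' : j ≤ J := by simpa [Nat.lt_succ_iff] using hj
    have h2j : 2^j ≤ 2 * m := (Nat.pow_le_pow_right (by norm_num) hj').trans hJ'
    have := cb_second m N (2^j * H) W X hX (fun u h1 h2 => hW u h1 (h2.trans (by
      calc 2^j * H * N ≤ (2*m) * (2*m) * N := by gcongr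
        _ = _ := by ring)))
    have hp : (0:ℝ) < 2^j := by positivity
    push_cast at this
    have hinv : ((1/2:ℝ)^j) * 2^j = 1 := by rw [← mul_pow]; norm_num
    set p := (1/2:ℝ)^j with hpdef
    have hp0 : 0 < p := by positivity
    have hp1 : p ≤ 1 := pow_le_one₀ (by norm_num) (by norm_num)
    calc _ ≤ (p * K)^2 * ((2 * (2^j * H) * N) * (W * (2 * (2^j * H) * N / m + 2))) := by gcongr
      _ = (p * 2^j) * (2 * W * N * (H * K)) * ((p * 2^j) * ( 2 * N * (H * K) / m) + p * K * 2) := by ring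
      _ = (2 * W * N * (H * K)) * ( 2 * N * (H * K) / m + p * K * 2) := by rw [hinv]; ring
      _ ≤ (2 * W * N * (2 * m)) * ( 2 * N * (2 * m) / m + 1 * K * 2) := by gcongr
      _ = 4 * m * W * N * (4 * N + 2 * K) := by field_simp; ring
      _ ≤ 4 * m * W * N * (4 * N + 4 * K) := by gcongr; linarith
      _ = _ := by ring
  have hfin : m * ∑ w : ZMod m, (∑ x ∈ X, cbg m K (a * (x:ZMod m)⁻¹ * w))^2 ≤ m * (16 * (J+1)^2 * W * N * (N + K)) := by
    rw [← hP2]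
    calc _ ≤ ∑ ξ : ZMod m, (J+1) * ∑ j ∈ Finset.range (J+1), ((1/2:ℝ)^j * K)^2 * (r j ξ)^2 :=
          Finset.sum_le_sum (fun ξ _ => hpt ξ)
      _ = (J+1) * ∑ j ∈ Finset.range (J+1), ((1/2:ℝ)^j * K)^2 * ∑ ξ : ZMod m, (r j ξ)^2 := by
          rw [← Finset.mul_sum, Finset.sum_comm]
          congr 1
          exact Finset.sum_congr rfl (fun j _ => by rw [Finset.mul_sum])
      _ ≤ (J+1) * ∑ j ∈ Finset.range (J+1), (16 * m * W * N * (N + K) : ℝ) := by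
          exact mul_le_mul_of_nonneg_left (Finset.sum_le_sum hsec) (by positivity)
      _ = _ := by
          rw [Finset.sum_const, Finset.card_range, nsmul_eq_mul]; push_cast; ring
  exact le_of_mul_le_mul_left hfin hm

/-- Lemma G. -/
theorem lemG (m N K W J : ℕ) [NeZero m] (X : Finset ℕ)
    (hX : ∀ x ∈ X, 1 ≤ x ∧ x ≤ N ∧ Nat.Coprime x m) (a : ZMod m) (ha : IsUnit a)
    (hK : 1 ≤ K) (hKm : K ≤ m) (hJ : m ≤ 2^J) (hJ' : 2^J ≤ 2 * m)
    (hW : ∀ u : ℕ, 1 ≤ u → u ≤ 4 * m * m * N → u.divisors.card ≤ W)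
    {ι : Type*} (I : Finset ι) (v : ι → ℕ) (hv : ∀ i ∈ I, Nat.Coprime (v i) m)
    (c : ι → ℝ) (C : ℝ) (hc : ∀ i ∈ I, |c i| ≤ C) (B : ℝ)
    (hB : ∀ w : ZMod m, ((I.filter (fun i => (v i : ZMod m) = w)).card : ℝ) ≤ B) :
    (∑ x ∈ X, ∑ i ∈ I, c i * ((((Finset.Icc 1 K).filter
      (fun k : ℕ => (k:ZMod m) * x * v i = a)).card : ℝ) - K / m))^2
      ≤ C^2 * I.card * B * (16 * (J+1)^2 * W * N * (N + K)) := by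
  classical
  set G : ZMod m → ℝ := fun w => ∑ x ∈ X, cbg m K (a * (x:ZMod m)⁻¹ * w) with hG
  have hB0 : 0 ≤ B := le_trans (by positivity) (hB 0)
  have h1 : (∑ x ∈ X, ∑ i ∈ I, c i * ((((Finset.Icc 1 K).filter
      (fun k : ℕ => (k:ZMod m) * x * v i = a)).card : ℝ) - K / m)) = ∑ i ∈ I, c i * G ((v i : ZMod m)⁻¹) := by
    rw [Finset.sum_comm]
    refine Finset.sum_congr rfl (fun i hi => ?_)
    rw [hG, Finset.mul_sum]
    refine Finset.sum_congr rfl (fun x hx => ?_)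
    unfold cbg
    have hxx : (x:ZMod m) * (x:ZMod m)⁻¹ = 1 := ZMod.coe_mul_inv_eq_one x (hX x hx).2.2
    have hvv : (v i:ZMod m) * (v i:ZMod m)⁻¹ = 1 := ZMod.coe_mul_inv_eq_one _ (hv i hi)
    congr 4
    ext k
    simp only [Finset.mem_filter, and_congr_right_iff]
    intro _
    constructor
    · intro h
      rw [← h]
      calc (k:ZMod m) = k * (x * (x:ZMod m)⁻¹) * ((v i:ZMod m) * (v i:ZMod m)⁻¹) := by rw [hxx, hvv]; ring
        _ = _ := by ring
    · intro h
      rw [h]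
      calc _ = a * ((x:ZMod m) * (x:ZMod m)⁻¹) * ((v i:ZMod m) * (v i:ZMod m)⁻¹) := by ring
        _ = _ := by rw [hxx, hvv]; ring
  rw [h1]
  have h2 : (∑ i ∈ I, c i * G ((v i : ZMod m)⁻¹))^2 ≤ (∑ i ∈ I, (c i)^2) * ∑ i ∈ I, (G ((v i : ZMod m)⁻¹))^2 :=
    Finset.sum_mul_sq_le_sq_mul_sq _ _ _
  have h3 : ∑ i ∈ I, (c i)^2 ≤ C^2 * I.card := by
    calc _ ≤ ∑ i ∈ I, C^2 := Finset.sum_le_sum (fun i hi => by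
          rw [← sq_abs]; have := hc i hi; gcongr)
      _ = _ := by rw [Finset.sum_const, nsmul_eq_mul]; ring
  have h4 : ∑ i ∈ I, (G ((v i : ZMod m)⁻¹))^2 ≤ B * ∑ w : ZMod m, (G w)^2 := by
    rw [← Finset.sum_fiberwise_of_maps_to (s := I) (t := Finset.univ) (g := fun i => ((v i : ZMod m)⁻¹)) (fun _ _ => Finset.mem_univ _),
      Finset.mul_sum]
    refine Finset.sum_le_sum (fun w _ => ?_)
    have : ∑ i ∈ I with (v i : ZMod m)⁻¹ = w, (G ((v i : ZMod m)⁻¹))^2 = ∑ i ∈ I with (v i : ZMod m)⁻¹ = w, (G w)^2 :=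
      Finset.sum_congr rfl (fun i hi => by rw [(Finset.mem_filter.1 hi).2])
    rw [this, Finset.sum_const, nsmul_eq_mul]
    have hsub : (I.filter (fun i => (v i : ZMod m)⁻¹ = w)) ⊆ I.filter (fun i => (v i : ZMod m) = w⁻¹) := by
      intro i hi
      rw [Finset.mem_filter] at hi ⊢
      refine ⟨hi.1, ?_⟩
      rw [← hi.2]
      have hvv : (v i:ZMod m) * (v i:ZMod m)⁻¹ = 1 := ZMod.coe_mul_inv_eq_one _ (hv i hi.1)
      exact (ZMod.inv_eq_of_mul_eq_one m _ _ (by rw [mul_comm]; exact hvv)).symm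
    have h5 := (Nat.cast_le (α := ℝ)).2 (Finset.card_le_card hsub)
    have := h5.trans (hB w⁻¹)
    gcongr
  have h6 := cb_meansq m N K W J X hX a ha hK hKm hJ hJ' hW
  calc _ ≤ _ := h2
    _ ≤ (C^2 * I.card) * (B * ∑ w : ZMod m, (G w)^2) := by
        gcongr
        
    _ ≤ (C^2 * I.card) * (B * (16 * (J+1)^2 * W * N * (N + K))) := by gcongr
    _ = _ := by ring


theorem ca_tau (ε : ℝ) (hε : 0 < ε) : ∃ C : ℝ, 1 ≤ C ∧ ∀ n : ℕ, 1 ≤ n → (n.divisors.card : ℝ) ≤ C * (n:ℝ)^ε := by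
  obtain ⟨B, hB⟩ := exists_nat_ge ((2:ℝ)^(1/ε))
  set D : ℝ := 1 + 2/ε with hD
  have hD1 : 1 ≤ D := by rw [hD]; have : 0 < 2/ε := by positivity
                         linarith
  refine ⟨D^B, one_le_pow₀ hD1, fun n hn => ?_⟩
  have hn0 : n ≠ 0 := by omega
  rw [Nat.card_divisors hn0]
  have hfac : (n:ℝ)^ε = ∏ p ∈ n.primeFactors, ((p:ℝ)^ε)^(n.factorization p) := by
    conv_lhs => rw [← Nat.prod_factorization_pow_eq_self hn0]
    rw [Finsupp.prod, Nat.support_factorization]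
    push_cast
    rw [← Real.finsetProd_rpow _ _ (fun p _ => by positivity)]
    refine Finset.prod_congr rfl (fun p _ => ?_)
    rw [← Real.rpow_natCast, ← Real.rpow_mul (by positivity), mul_comm, Real.rpow_mul (by positivity), Real.rpow_natCast]
  have hc : ∀ p ∈ n.primeFactors, ((n.factorization p + 1 : ℕ) : ℝ) ≤ (if p < B then D else 1) * ((p:ℝ)^ε)^(n.factorization p) := by
    intro p hp
    have hpp := (Nat.prime_of_mem_primeFactors hp).two_le
    have hp2 : (2:ℝ) ≤ p := by exact_mod_cast hpp
    generalize n.factorization p = k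
    split_ifs with h
    · have h1 : 1 + ε/2 ≤ (p:ℝ)^ε := by
        calc 1 + ε/2 ≤ 1 + ε * Real.log 2 := by have := Real.log_two_gt_d9; nlinarith
          _ ≤ Real.exp (ε * Real.log 2) := by have := Real.add_one_le_exp (ε * Real.log 2); linarith
          _ = (2:ℝ)^ε := by rw [Real.rpow_def_of_pos (by norm_num), mul_comm]
          _ ≤ _ := by gcongr
      have h2 : 1 + k * (ε/2) ≤ (1 + ε/2)^k := one_add_mul_le_pow (by linarith) k
      have h3 : (1 + ε/2)^k ≤ ((p:ℝ)^ε)^k := by gcongr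
      calc ((k+1:ℕ):ℝ) = k + 1 := by push_cast; ring
        _ ≤ D * (1 + k * (ε/2)) := by
            rw [hD]
            have : (1 + 2/ε) * (1 + k * (ε/2)) = 1 + k + 2/ε + k * (ε/2) := by field_simp; ring
            rw [this]
            have : 0 < 2/ε := by positivity
            have : 0 ≤ k * (ε/2) := by positivity
            linarith
        _ ≤ _ := by gcongr; linarith
    · rw [one_mul]
      have h1 : (2:ℝ) ≤ (p:ℝ)^ε := by
        have : (2:ℝ)^(1/ε) ≤ p := hB.trans (by exact_mod_cast (by omega : B ≤ p))
        calc (2:ℝ) = ((2:ℝ)^(1/ε))^ε := by rw [← Real.rpow_mul (by norm_num)]; field_simp; simp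
          _ ≤ _ := by gcongr
      calc ((k+1:ℕ):ℝ) ≤ ((2^k:ℕ):ℝ) := by exact_mod_cast Nat.lt_two_pow_self
        _ = (2:ℝ)^k := by push_cast; rfl
        _ ≤ _ := by gcongr
  push_cast at hc ⊢
  calc _ ≤ ∏ p ∈ n.primeFactors, ((if p < B then D else 1) * ((p:ℝ)^ε)^(n.factorization p)) :=
        Finset.prod_le_prod (fun p _ => by positivity) hc
    _ = (∏ p ∈ n.primeFactors, (if p < B then D else 1)) * (n:ℝ)^ε := by rw [Finset.prod_mul_distrib, hfac]
    _ ≤ _ := by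
      gcongr
      rw [Finset.prod_ite, Finset.prod_const, Finset.prod_const_one, mul_one]
      apply pow_le_pow_right₀ hD1
      have : (n.primeFactors.filter (fun p => p < B)) ⊆ Finset.range B := by
        intro p hp; rw [Finset.mem_range]; exact (Finset.mem_filter.1 hp).2
      simpa using Finset.card_le_card this


theorem cc_fiber {ι : Type*} (m V W' : ℕ) [NeZero m] (I : Finset ι) (v : ι → ℕ)
    (hv : ∀ i ∈ I, 1 ≤ v i ∧ v i ≤ V)
    (hrep : ∀ u : ℕ, 1 ≤ u → u ≤ V → (I.filter (fun i => v i = u)).card ≤ W') (w : ZMod m) :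
    ((I.filter (fun i => (v i : ZMod m) = w)).card : ℝ) ≤ W' * ((V:ℝ) / m + 1) := by
  classical
  have hmpos : 0 < m := Nat.pos_of_ne_zero (NeZero.ne m)
  set U : Finset ℕ := (Finset.Ioc 0 V).filter (fun u => u ≡ w.val [MOD m]) with hU
  have h1 : (I.filter (fun i => (v i : ZMod m) = w)).card ≤ W' * U.card := by
    apply Finset.card_le_mul_card_image_of_maps_to (f := v)
    · intro i hi
      rw [Finset.mem_filter] at hi
      have := hv i hi.1
      rw [hU, Finset.mem_filter, Finset.mem_Ioc]
      refine ⟨⟨by omega, this.2⟩, ?_⟩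
      rw [← ZMod.natCast_eq_natCast_iff, hi.2, ZMod.natCast_zmod_val]
    · intro u hu
      rw [hU, Finset.mem_filter, Finset.mem_Ioc] at hu
      refine le_trans (Finset.card_le_card ?_) (hrep u hu.1.1 hu.1.2)
      intro i hi
      rw [Finset.mem_filter, Finset.mem_filter] at hi
      rw [Finset.mem_filter]; exact ⟨hi.1.1, hi.2⟩
  have h2 : (U.card : ℝ) ≤ (V:ℝ) / m + 1 := by
    have h := Nat.Ioc_filter_modEq_card 0 V hmpos w.val
    rw [← hU] at h
    have hA := Int.floor_le (((V:ℚ) - w.val) / m)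
    have hB := Int.lt_floor_add_one ((((0:ℕ):ℚ) - w.val) / m)
    have hq : (U.card : ℚ) ≤ V / m + 1 := by
      have h4 : ((U.card : ℤ) : ℚ) = ((max (⌊((V:ℚ) - w.val) / m⌋ - ⌊(((0:ℕ):ℚ) - w.val) / m⌋) 0 : ℤ) : ℚ) := by
        rw [h]
      rw [Int.cast_natCast] at h4
      rw [h4, Int.cast_max]
      apply max_le
      · push_cast at hA hB ⊢
        have e : ((V:ℚ) - w.val) / m - ((0 - (w.val:ℚ)) / m) = V / m := by ring
        linarith
      · push_cast; positivity
    have h5 : ((U.card : ℚ) : ℝ) ≤ ((V / m + 1 : ℚ) : ℝ) := by exact_mod_cast hq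
    push_cast at h5
    exact h5
  calc _ ≤ ((W' * U.card : ℕ) : ℝ) := by exact_mod_cast h1
    _ = W' * (U.card : ℝ) := by push_cast; ring
    _ ≤ _ := by gcongr

/-- number of representations -/
noncomputable def cr (m : ℕ) (a : ZMod m) (P Q : Finset ℕ) (n : ℕ) : ℝ :=
  ∑ x ∈ P, ∑ y ∈ P ×ˢ Q, if (n : ZMod m) * x * (y.1 * y.2 : ℕ) = a then 1 else 0

theorem cr_nonneg (m : ℕ) (a : ZMod m) (P Q : Finset ℕ) (n : ℕ) : 0 ≤ cr m a P Q n := by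
  unfold cr; positivity

theorem cr_zero (m : ℕ) (a : ZMod m) (ha : IsUnit a) (P Q : Finset ℕ) (n : ℕ) (hn : ¬ Nat.Coprime n m) :
    cr m a P Q n = 0 := by
  unfold cr
  refine Finset.sum_eq_zero (fun x _ => Finset.sum_eq_zero (fun y _ => if_neg (fun h => hn ?_)))
  rw [← ZMod.isUnit_iff_coprime]
  rw [← h, mul_assoc] at ha
  exact isUnit_of_mul_isUnit_left ha

theorem cc_junk (m N Q₀ M W J : ℕ) [NeZero m] (a : ZMod m) (ha : IsUnit a) (P Q S : Finset ℕ)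
    (hP : ∀ x ∈ P, 1 ≤ x ∧ x ≤ N ∧ Nat.Coprime x m) (hQ : ∀ x ∈ Q, 1 ≤ x ∧ x ≤ Q₀ ∧ Nat.Coprime x m)
    (hS : ∀ n ∈ S, 1 ≤ n ∧ n ≤ M) (hN1 : 1 ≤ N) (hN : N ≤ m) (hQm : Q₀ ≤ m) (hM : M ≤ m)
    (hJ : m ≤ 2^J) (hJ' : 2^J ≤ 2 * m)
    (hW : ∀ u : ℕ, 1 ≤ u → u ≤ 4 * m^3 → u.divisors.card ≤ W) (T : ℝ) (hT : (S.card : ℝ) ≤ T) :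
    ∑ n ∈ S, cr m a P Q n ≤ (N:ℝ) * P.card * Q.card * T / m +
      Real.sqrt (32 * (J+1)^2 * W^2 * N^2 * Q₀ * T * ((Q₀:ℝ) * M / m + 1)) := by
  classical
  have hm : (0:ℝ) < m := by exact_mod_cast Nat.pos_of_ne_zero (NeZero.ne m)
  have hm1 : 1 ≤ m := Nat.pos_of_ne_zero (NeZero.ne m)
  set S' := S.filter (fun n => Nat.Coprime n m) with hS'
  have hT' : (S'.card : ℝ) ≤ T := le_trans (by exact_mod_cast Finset.card_filter_le _ _) hT
  have hT0 : 0 ≤ T := le_trans (by positivity) hT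
  have h0 : ∑ n ∈ S, cr m a P Q n = ∑ n ∈ S', cr m a P Q n := by
    rw [hS', Finset.sum_filter]
    refine Finset.sum_congr rfl (fun n _ => ?_)
    split_ifs with h
    · rfl
    · exact cr_zero m a ha P Q n h
  set v : ℕ × ℕ → ℕ := fun i => i.1 * i.2 with hv
  set I := Q ×ˢ S' with hI
  have hvI : ∀ i ∈ I, Nat.Coprime (v i) m := by
    intro i hi
    rw [hI, Finset.mem_product] at hi
    exact Nat.Coprime.mul_left (hQ _ hi.1).2.2 (Finset.mem_filter.1 hi.2).2
  have hB : ∀ w : ZMod m, ((I.filter (fun i => (v i : ZMod m) = w)).card : ℝ) ≤ W * ((Q₀:ℝ) * M / m + 1) := by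
    intro w
    have := cc_fiber m (Q₀ * M) W I v (fun i hi => by
      rw [hI, Finset.mem_product] at hi
      have h1 := hQ _ hi.1
      have h2 := hS _ (Finset.mem_filter.1 hi.2).1
      exact ⟨Nat.mul_pos h1.1 h2.1, Nat.mul_le_mul h1.2.1 h2.2⟩) (fun u hu1 hu2 => by
      refine le_trans ?_ (hW u hu1 (hu2.trans ?_))
      · apply Finset.card_le_card_of_injOn (fun i : ℕ × ℕ => i.1)
        · rintro ⟨q, n⟩ h
          simp only [Finset.coe_filter, Set.mem_ofPred_eq, hv] at h
          simp only [Finset.mem_coe, Nat.mem_divisors]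
          exact ⟨⟨n, h.2.symm⟩, by omega⟩
        · rintro ⟨q, n⟩ h ⟨q', n'⟩ h' hq
          simp only [Finset.coe_filter, Set.mem_ofPred_eq, hv] at h h' hq
          subst hq
          have hq0 : 0 < q := by
            rcases Nat.eq_zero_or_pos q with h3 | h3
            · rw [h3] at h; omega
            · exact h3
          have := Nat.eq_of_mul_eq_mul_left hq0 (h.2.trans h'.2.symm)
          rw [this]
      · calc Q₀ * M ≤ m * m := by gcongr
          _ ≤ 4 * m^3 := by nlinarith [Nat.mul_le_mul hm1 (Nat.le_refl (m*m))]) w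
    push_cast at this
    exact this
  have hG := lemG m N N W J P hP a ha hN1 hN hJ hJ' (fun u h1 h2 => hW u h1 (h2.trans (by
      calc 4 * m * m * N ≤ 4 * m * m * m := by gcongr
        _ = _ := by ring))) I v hvI (fun _ => 1) 1 (fun _ _ => by simp) _ hB
  set L := ∑ x ∈ P, ∑ i ∈ I, (1:ℝ) * ((((Finset.Icc 1 N).filter
      (fun k : ℕ => (k:ZMod m) * x * v i = a)).card : ℝ) - N / m) with hL
  have hLe : L = (∑ x ∈ P, ∑ i ∈ I, (((Finset.Icc 1 N).filter
      (fun k : ℕ => (k:ZMod m) * x * v i = a)).card : ℝ)) - P.card * (Q.card * S'.card) * (N / m) := by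
    rw [hL]
    simp only [one_mul, Finset.sum_sub_distrib, Finset.sum_const, nsmul_eq_mul]
    rw [hI, Finset.card_product]; push_cast; ring
  have hle : ∑ n ∈ S', cr m a P Q n ≤ ∑ x ∈ P, ∑ i ∈ I, (((Finset.Icc 1 N).filter
      (fun k : ℕ => (k:ZMod m) * x * v i = a)).card : ℝ) := by
    have hcr : ∀ n, cr m a P Q n = ∑ x ∈ P, ∑ q ∈ Q, ∑ p ∈ P, if ((p:ZMod m) * x * (q * n : ℕ) = a) then (1:ℝ) else 0 := by
      intro n
      unfold cr
      rw [Finset.sum_congr rfl (fun x _ => Finset.sum_product P Q _), Finset.sum_comm]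
      refine Finset.sum_congr rfl (fun x _ => ?_)
      rw [Finset.sum_comm]
      refine Finset.sum_congr rfl (fun q _ => Finset.sum_congr rfl (fun p _ => ?_))
      have : (n:ZMod m) * p * ((x * q : ℕ) : ZMod m) = p * x * ((q * n : ℕ):ZMod m) := by push_cast; ring
      rw [this]
    rw [Finset.sum_congr rfl (fun n _ => hcr n), Finset.sum_comm]
    refine Finset.sum_le_sum (fun x _ => ?_)
    rw [hI, Finset.sum_product, Finset.sum_comm]
    refine Finset.sum_le_sum (fun q _ => Finset.sum_le_sum (fun n _ => ?_))
    rw [Finset.card_filter]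
    push_cast
    have : P ⊆ Finset.Icc 1 N := fun p hp => Finset.mem_Icc.2 ⟨(hP p hp).1, (hP p hp).2.1⟩
    refine (Finset.sum_le_sum_of_subset_of_nonneg this (fun _ _ _ => by positivity)).trans (le_of_eq ?_)
    refine Finset.sum_congr rfl (fun k _ => ?_)
    simp only [hv]; push_cast; rfl
  have hQc : (Q.card : ℝ) ≤ Q₀ := by
    have : Q ⊆ Finset.Icc 1 Q₀ := fun p hp => Finset.mem_Icc.2 ⟨(hQ p hp).1, (hQ p hp).2.1⟩
    have := Finset.card_le_card this
    rw [Nat.card_Icc] at this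
    exact_mod_cast (by omega : Q.card ≤ Q₀)
  have hLs : L ≤ Real.sqrt (32 * (J+1)^2 * W^2 * N^2 * Q₀ * T * ((Q₀:ℝ) * M / m + 1)) := by
    apply Real.le_sqrt_of_sq_le
    refine hG.trans ?_
    have hIc : (I.card : ℝ) ≤ Q₀ * T := by
      rw [hI, Finset.card_product]; push_cast; gcongr
    calc _ ≤ (1:ℝ)^2 * (Q₀ * T) * (W * ((Q₀:ℝ) * M / m + 1)) * (16 * (J+1)^2 * W * N * (N + N)) := by gcongr
      _ = _ := by ring
  rw [h0]
  have hmain : P.card * (Q.card * S'.card) * ((N:ℝ) / m) ≤ (N:ℝ) * P.card * Q.card * T / m := by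
    calc _ ≤ P.card * (Q.card * T) * ((N:ℝ) / m) := by gcongr
      _ = _ := by ring
  linarith


theorem cc_group (m N Q₀ M D W J K : ℕ) [NeZero m] (a : ZMod m) (ha : IsUnit a) (P Q E : Finset ℕ)
    (hP : ∀ x ∈ P, 1 ≤ x ∧ x ≤ N ∧ Nat.Coprime x m) (hQ : ∀ x ∈ Q, 1 ≤ x ∧ x ≤ Q₀ ∧ Nat.Coprime x m)
    (hE : ∀ e ∈ E, 1 ≤ e ∧ e ≤ D ∧ Nat.Coprime e m) (hKE : ∀ e ∈ E, K * e ≤ M)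
    (hK1 : 1 ≤ K) (hKm : K ≤ m) (hN : N ≤ m) (hQm : Q₀ ≤ m) (hD : D ≤ m)
    (hJ : m ≤ 2^J) (hJ' : 2^J ≤ 2 * m)
    (hW : ∀ u : ℕ, 1 ≤ u → u ≤ 4 * m^3 → u.divisors.card ≤ W) (Λ : ℕ → ℝ) (C : ℝ) (hΛ : ∀ e ∈ E, |Λ e| ≤ C) :
    |∑ e ∈ E, Λ e * (∑ k ∈ Finset.Icc 1 K, cr m a P Q (e * k) - P.card^2 * Q.card * K / m)| ≤
      Real.sqrt (16 * (J+1)^2 * C^2 * W^3 * N^2 * Q₀ * (D * N + M) * ((N:ℝ) * Q₀ * D / m + 1)) := by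
  classical
  have hm : (0:ℝ) < m := by exact_mod_cast Nat.pos_of_ne_zero (NeZero.ne m)
  have hm1 : 1 ≤ m := Nat.pos_of_ne_zero (NeZero.ne m)
  set v : (ℕ × ℕ) × ℕ → ℕ := fun i => i.1.1 * i.1.2 * i.2 with hv
  set I := (P ×ˢ Q) ×ˢ E with hI
  set b := min D (M / K) with hb
  have hEb : ∀ e ∈ E, e ≤ b := by
    intro e he
    rw [hb, le_min_iff, Nat.le_div_iff_mul_le hK1]
    exact ⟨(hE e he).2.1, by rw [mul_comm]; exact hKE e he⟩
  have hbD : b ≤ D := min_le_left _ _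
  have hbK : b * K ≤ M := (Nat.mul_le_mul_right K (min_le_right _ _)).trans (Nat.div_mul_le_self M K)
  have hvI : ∀ i ∈ I, Nat.Coprime (v i) m := by
    intro i hi
    rw [hI, Finset.mem_product, Finset.mem_product] at hi
    exact Nat.Coprime.mul_left (Nat.Coprime.mul_left (hP _ hi.1.1).2.2 (hQ _ hi.1.2).2.2) (hE _ hi.2).2.2
  have hB : ∀ w : ZMod m, ((I.filter (fun i => (v i : ZMod m) = w)).card : ℝ) ≤ W^2 * ((N:ℝ) * Q₀ * b / m + 1) := by
    intro w
    have := cc_fiber m (N * Q₀ * b) (W * W) I v (fun i hi => by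
      rw [hI, Finset.mem_product, Finset.mem_product] at hi
      have h1 := hP _ hi.1.1
      have h2 := hQ _ hi.1.2
      have h3 := hE _ hi.2
      exact ⟨Nat.mul_pos (Nat.mul_pos h1.1 h2.1) h3.1, Nat.mul_le_mul (Nat.mul_le_mul h1.2.1 h2.2.1) (hEb _ hi.2)⟩) (fun u hu1 hu2 => by
      have hu3 : u ≤ 4 * m^3 := hu2.trans (by
        calc N * Q₀ * b ≤ m * m * m := by gcongr; exact hbD.trans hD
          _ ≤ 4 * m^3 := by nlinarith [Nat.zero_le (m*m*m)])
      have h4 := hW u hu1 hu3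
      refine le_trans ?_ (Nat.mul_le_mul h4 h4)
      rw [← Finset.card_product]
      apply Finset.card_le_card_of_injOn (fun i : (ℕ × ℕ) × ℕ => i.1)
      · rintro ⟨⟨p, q⟩, e⟩ h
        simp only [Finset.coe_filter, Set.mem_ofPred_eq, hv] at h
        simp only [Finset.mem_coe, Finset.mem_product, Nat.mem_divisors]
        exact ⟨⟨⟨q * e, by rw [← h.2]; ring⟩, by omega⟩, ⟨⟨p * e, by rw [← h.2]; ring⟩, by omega⟩⟩
      · rintro ⟨⟨p, q⟩, e⟩ h ⟨⟨p', q'⟩, e'⟩ h' hq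
        simp only [Finset.coe_filter, Set.mem_ofPred_eq, hv, Prod.mk.injEq] at h h' hq
        obtain ⟨rfl, rfl⟩ := hq
        have hq0 : 0 < p * q := by
          rcases Nat.eq_zero_or_pos (p * q) with h3 | h3
          · rw [h3] at h; omega
          · exact h3
        have := Nat.eq_of_mul_eq_mul_left hq0 (h.2.trans h'.2.symm)
        rw [this]) w
    push_cast at this
    rw [pow_two]
    exact this
  have hG := lemG m N K W J P hP a ha hK1 hKm hJ hJ' (fun u h1 h2 => hW u h1 (h2.trans (by
      calc 4 * m * m * N ≤ 4 * m * m * m := by gcongr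
        _ = _ := by ring))) I v hvI (fun i => Λ i.2) C (fun i hi => by
        rw [hI, Finset.mem_product] at hi; exact hΛ _ hi.2) _ hB
  have hEq : ∑ e ∈ E, Λ e * (∑ k ∈ Finset.Icc 1 K, cr m a P Q (e * k) - P.card^2 * Q.card * K / m) =
     ∑ x ∈ P, ∑ i ∈ I, Λ i.2 * ((((Finset.Icc 1 K).filter
      (fun k : ℕ => (k:ZMod m) * x * v i = a)).card : ℝ) - K / m) := by
    rw [Finset.sum_congr rfl (fun x _ => Finset.sum_product (P ×ˢ Q) E _)]
    have : ∀ x ∈ P, ∑ y ∈ P ×ˢ Q, ∑ e ∈ E, Λ (y, e).2 * ((((Finset.Icc 1 K).filter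
      (fun k : ℕ => (k:ZMod m) * x * v (y, e) = a)).card : ℝ) - K / m) = ∑ e ∈ E, ∑ y ∈ P ×ˢ Q, Λ e * ((((Finset.Icc 1 K).filter
      (fun k : ℕ => (k:ZMod m) * x * v (y, e) = a)).card : ℝ) - K / m) := fun x _ => Finset.sum_comm
    rw [Finset.sum_congr rfl this, Finset.sum_comm]
    refine Finset.sum_congr rfl (fun e _ => ?_)
    simp only [← Finset.mul_sum]
    congr 1
    simp only [Finset.sum_sub_distrib, Finset.sum_const, nsmul_eq_mul]
    congr 1
    · unfold cr
      rw [Finset.sum_comm]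
      refine Finset.sum_congr rfl (fun x _ => ?_)
      rw [Finset.sum_comm]
      refine Finset.sum_congr rfl (fun y _ => ?_)
      rw [Finset.card_filter]
      push_cast
      refine Finset.sum_congr rfl (fun k _ => ?_)
      have : (e * k : ZMod m) * x * (y.1 * y.2) = k * x * (v (y, e) : ZMod m) := by
        simp only [hv]; push_cast; ring
      rw [this]
    · rw [Finset.card_product]; push_cast; ring
  rw [hEq]
  apply Real.abs_le_sqrt
  refine hG.trans ?_
  have hc1 : ∀ (Z : Finset ℕ) (z : ℕ), (∀ x ∈ Z, 1 ≤ x ∧ x ≤ z) → (Z.card : ℝ) ≤ z := by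
    intro Z z hZ
    have : Z ⊆ Finset.Icc 1 z := fun p hp => Finset.mem_Icc.2 (hZ p hp)
    have := Finset.card_le_card this
    rw [Nat.card_Icc] at this
    exact_mod_cast (by omega : Z.card ≤ z)
  have hPc := hc1 P N (fun x hx => ⟨(hP x hx).1, (hP x hx).2.1⟩)
  have hQc := hc1 Q Q₀ (fun x hx => ⟨(hQ x hx).1, (hQ x hx).2.1⟩)
  have hEc := hc1 E b (fun x hx => ⟨(hE x hx).1, hEb x hx⟩)
  have hIc : (I.card : ℝ) ≤ N * Q₀ * b := by
    rw [hI, Finset.card_product, Finset.card_product]; push_cast; gcongr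
  have hbD' : (b:ℝ) ≤ D := by exact_mod_cast hbD
  have hbK' : (b:ℝ) * K ≤ M := by exact_mod_cast hbK
  calc _ ≤ C^2 * (N * Q₀ * b) * (W^2 * ((N:ℝ) * Q₀ * b / m + 1)) * (16 * (J+1)^2 * W * N * (N + K)) := by gcongr
    _ = 16 * (J+1)^2 * C^2 * W^3 * N^2 * Q₀ * (b * N + b * K) * ((N:ℝ) * Q₀ * b / m + 1) := by ring
    _ ≤ _ := by gcongr

theorem cc_dist (m N Q₀ M D W J : ℕ) [NeZero m] (a : ZMod m) (ha : IsUnit a) (P Q E : Finset ℕ)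
    (hP : ∀ x ∈ P, 1 ≤ x ∧ x ≤ N ∧ Nat.Coprime x m) (hQ : ∀ x ∈ Q, 1 ≤ x ∧ x ≤ Q₀ ∧ Nat.Coprime x m)
    (hE : ∀ e ∈ E, 1 ≤ e ∧ e ≤ D ∧ Nat.Coprime e m)
    (hN1 : 1 ≤ N) (hN : N ≤ m) (hQm : Q₀ ≤ m) (hD : D ≤ m) (hM : M ≤ m)
    (hJ : m ≤ 2^J) (hJ' : 2^J ≤ 2 * m)
    (hW : ∀ u : ℕ, 1 ≤ u → u ≤ 4 * m^3 → u.divisors.card ≤ W) (Λ : ℕ → ℝ) (C : ℝ) (hΛ : ∀ e ∈ E, |Λ e| ≤ C)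
    (hC : 0 ≤ C)
    (η : ℝ) (hη : 0 ≤ η) (K : ℕ → ℕ) (hK1 : ∀ e ∈ E, 1 ≤ K e) (hKM : ∀ e ∈ E, K e * e ≤ M)
    (hKη : ∀ e ∈ E, (M:ℝ) < (1 + η) * (e * (K e + 1)))
    (G : ℝ) (hG : ((E.image K).card : ℝ) ≤ G) (T : ℝ)
    (hT : (((Finset.Icc 1 M).filter (fun n : ℕ => (M:ℝ) < (1 + η) * n)).card : ℝ) ≤ T) :
    |∑ n ∈ Finset.Icc 1 M, cr m a P Q n * (∑ e ∈ E.filter (fun e => e ∣ n), Λ e)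
       - P.card^2 * Q.card * ((M:ℝ) / m) * ∑ e ∈ E, Λ e / e| ≤
      G * Real.sqrt (16 * (J+1)^2 * C^2 * W^3 * N^2 * Q₀ * (D * N + M) * ((N:ℝ) * Q₀ * D / m + 1))
      + C * W * ((N:ℝ) * P.card * Q.card * T / m +
      Real.sqrt (32 * (J+1)^2 * W^2 * N^2 * Q₀ * T * ((Q₀:ℝ) * M / m + 1)))
      + C * P.card^2 * Q.card / m * (η * M * (∑ e ∈ Finset.Icc 1 D, 1/(e:ℝ)) + D) := by
  classical
  have hm : (0:ℝ) < m := by exact_mod_cast Nat.pos_of_ne_zero (NeZero.ne m)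
  have hm1 : 1 ≤ m := Nat.pos_of_ne_zero (NeZero.ne m)
  set R := cr m a P Q with hR
  have hR0 : ∀ n, 0 ≤ R n := fun n => cr_nonneg m a P Q n
  set S := (Finset.Icc 1 M).filter (fun n : ℕ => (M:ℝ) < (1 + η) * n) with hS
  set Z := Real.sqrt (16 * (J+1)^2 * C^2 * W^3 * N^2 * Q₀ * (D * N + M) * ((N:ℝ) * Q₀ * D / m + 1)) with hZ
  -- swap
  have h1 : ∑ n ∈ Finset.Icc 1 M, R n * (∑ e ∈ E.filter (fun e => e ∣ n), Λ e) =
      ∑ e ∈ E, Λ e * ∑ n ∈ (Finset.Icc 1 M).filter (fun n => e ∣ n), R n := by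
    simp only [Finset.sum_filter, Finset.mul_sum]
    rw [Finset.sum_comm]
    refine Finset.sum_congr rfl (fun e _ => Finset.sum_congr rfl (fun n _ => ?_))
    split_ifs <;> ring
  -- split
  have h2 : ∀ e ∈ E, ∑ n ∈ (Finset.Icc 1 M).filter (fun n => e ∣ n), R n =
      ∑ k ∈ Finset.Icc 1 (K e), R (e * k) +
      ∑ n ∈ (Finset.Icc 1 M).filter (fun n => e ∣ n ∧ e * K e < n), R n := by
    intro e he
    have he1 := (hE e he).1
    have : ∑ k ∈ Finset.Icc 1 (K e), R (e * k) = ∑ n ∈ (Finset.Icc 1 M).filter (fun n => e ∣ n ∧ ¬ e * K e < n), R n := by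
      refine Finset.sum_bij (fun k _ => e * k) ?_ ?_ ?_ ?_
      · intro k hk
        rw [Finset.mem_Icc] at hk
        rw [Finset.mem_filter, Finset.mem_Icc]
        have h5 : e * k ≤ e * K e := Nat.mul_le_mul_left e hk.2
        have h6 := hKM e he
        rw [mul_comm] at h6
        exact ⟨⟨Nat.mul_pos he1 hk.1, h5.trans h6⟩, ⟨k, rfl⟩, by omega⟩
      · intro k _ k' _ h
        exact Nat.eq_of_mul_eq_mul_left he1 h
      · intro n hn
        rw [Finset.mem_filter, Finset.mem_Icc] at hn
        obtain ⟨⟨h5, h6⟩, ⟨k, rfl⟩, h7⟩ := hn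
        refine ⟨k, ?_, rfl⟩
        rw [Finset.mem_Icc]
        constructor
        · rcases Nat.eq_zero_or_pos k with h | h
          · rw [h] at h5; omega
          · exact h
        · push Not at h7
          exact Nat.le_of_mul_le_mul_left h7 he1
      · intro k _; rfl
    rw [this, ← Finset.sum_filter_add_sum_filter_not ((Finset.Icc 1 M).filter (fun n => e ∣ n)) (fun n => ¬ e * K e < n),
      Finset.filter_filter, Finset.filter_filter]
    simp only [not_not]
  have h3 : ∑ e ∈ E, Λ e * ∑ n ∈ (Finset.Icc 1 M).filter (fun n => e ∣ n), R n
     = ∑ e ∈ E, Λ e * (∑ k ∈ Finset.Icc 1 (K e), R (e * k) - P.card^2 * Q.card * K e / m)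
      + ∑ e ∈ E, Λ e * (∑ n ∈ (Finset.Icc 1 M).filter (fun n => e ∣ n ∧ e * K e < n), R n)
      + ∑ e ∈ E, Λ e * (P.card^2 * Q.card * K e / m) := by
    rw [← Finset.sum_add_distrib, ← Finset.sum_add_distrib]
    refine Finset.sum_congr rfl (fun e he => ?_)
    rw [h2 e he]; ring
  -- group part
  have h4 : |∑ e ∈ E, Λ e * (∑ k ∈ Finset.Icc 1 (K e), R (e * k) - P.card^2 * Q.card * K e / m)| ≤ G * Z := by
    rw [← Finset.sum_fiberwise_of_maps_to (s := E) (t := E.image K) (g := K) (fun e he => Finset.mem_image_of_mem K he)]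
    refine (Finset.abs_sum_le_sum_abs _ _).trans ?_
    calc _ ≤ ∑ κ ∈ E.image K, Z := by
          refine Finset.sum_le_sum (fun κ hκ => ?_)
          obtain ⟨e0, he0, hek⟩ := Finset.mem_image.1 hκ
          have hκ1 : 1 ≤ κ := hek ▸ hK1 e0 he0
          have hκm : κ ≤ m := by
            have h5 := hKM e0 he0
            rw [hek] at h5
            have h6 := (hE e0 he0).1
            nlinarith
          have := cc_group m N Q₀ M D W J κ a ha P Q (E.filter (fun e => K e = κ)) hP hQ
            (fun e he => hE e (Finset.mem_filter.1 he).1)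
            (fun e he => by rw [← (Finset.mem_filter.1 he).2]; exact hKM e (Finset.mem_filter.1 he).1)
            hκ1 hκm hN hQm hD hJ hJ' hW Λ C (fun e he => hΛ e (Finset.mem_filter.1 he).1)
          rw [← hZ] at this
          refine le_trans (le_of_eq ?_) this
          congr 1
          refine Finset.sum_congr rfl (fun e he => ?_)
          rw [(Finset.mem_filter.1 he).2]
      _ = (E.image K).card * Z := by rw [Finset.sum_const, nsmul_eq_mul]
      _ ≤ _ := by have : 0 ≤ Z := Real.sqrt_nonneg _
                  gcongr
  -- boundary
  have h5 : |∑ e ∈ E, Λ e * (∑ n ∈ (Finset.Icc 1 M).filter (fun n => e ∣ n ∧ e * K e < n), R n)|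
      ≤ C * W * ∑ n ∈ S, R n := by
    calc _ ≤ ∑ e ∈ E, |Λ e * (∑ n ∈ (Finset.Icc 1 M).filter (fun n => e ∣ n ∧ e * K e < n), R n)| := Finset.abs_sum_le_sum_abs _ _
      _ ≤ ∑ e ∈ E, C * ∑ n ∈ S.filter (fun n => e ∣ n), R n := by
          refine Finset.sum_le_sum (fun e he => ?_)
          rw [abs_mul, abs_of_nonneg (Finset.sum_nonneg (fun n _ => hR0 n))]
          refine mul_le_mul (hΛ e he) ?_ (Finset.sum_nonneg (fun n _ => hR0 n)) hC
          refine Finset.sum_le_sum_of_subset_of_nonneg ?_ (fun n _ _ => hR0 n)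
          intro n hn
          rw [Finset.mem_filter] at hn
          rw [hS, Finset.mem_filter, Finset.mem_filter]
          refine ⟨⟨hn.1, ?_⟩, hn.2.1⟩
          refine (hKη e he).trans_le ?_
          obtain ⟨k, hk⟩ := hn.2.1
          have hk2 : K e + 1 ≤ k := by
            have := hn.2.2
            rw [hk] at this
            exact Nat.lt_of_mul_lt_mul_left this
          have : ((e:ℝ) * (K e + 1)) ≤ n := by
            rw [hk]; push_cast
            have : ((K e:ℝ) + 1) ≤ k := by exact_mod_cast hk2
            gcongr
          gcongr
      _ = C * ∑ n ∈ S, (E.filter (fun e => e ∣ n)).card * R n := by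
          rw [← Finset.mul_sum]
          congr 1
          simp only [Finset.sum_filter]
          rw [Finset.sum_comm]
          refine Finset.sum_congr rfl (fun n _ => ?_)
          rw [← Finset.sum_filter, Finset.sum_const, nsmul_eq_mul]
      _ ≤ C * ∑ n ∈ S, W * R n := by
          refine mul_le_mul_of_nonneg_left (Finset.sum_le_sum (fun n hn => ?_)) hC
          refine mul_le_mul_of_nonneg_right ?_ (hR0 n)
          rw [hS, Finset.mem_filter, Finset.mem_Icc] at hn
          have h6 := hW n hn.1.1 (by
            calc n ≤ m * 1 := by omega
              _ ≤ m * m^2 := by gcongr; exact Nat.one_le_pow _ _ hm1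
              _ ≤ _ := by nlinarith [Nat.zero_le (m^3)])
          have : (E.filter (fun e => e ∣ n)).card ≤ n.divisors.card := by
            apply Finset.card_le_card
            intro e he
            rw [Nat.mem_divisors]; exact ⟨(Finset.mem_filter.1 he).2, by omega⟩
          exact_mod_cast this.trans h6
      _ = _ := by rw [← Finset.mul_sum]; ring
  have h6 := cc_junk m N Q₀ M W J a ha P Q S hP hQ (fun n hn => Finset.mem_Icc.1 (Finset.mem_filter.1 hn).1) hN1 hN hQm hM hJ hJ' hW T hT
  have h7 : |∑ e ∈ E, Λ e * (P.card^2 * Q.card * K e / m) - P.card^2 * Q.card * ((M:ℝ) / m) * ∑ e ∈ E, Λ e / e|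
     ≤ C * P.card^2 * Q.card / m * (η * M * (∑ e ∈ Finset.Icc 1 D, 1/(e:ℝ)) + D) := by
    have e1 : ∑ e ∈ E, Λ e * (P.card^2 * Q.card * K e / m) - P.card^2 * Q.card * ((M:ℝ) / m) * ∑ e ∈ E, Λ e / e
       = (P.card^2 * Q.card / m : ℝ) * ∑ e ∈ E, Λ e * (K e - M / e) := by
      rw [Finset.mul_sum, Finset.mul_sum, ← Finset.sum_sub_distrib]
      exact Finset.sum_congr rfl (fun e _ => by ring)
    rw [e1, abs_mul, abs_of_nonneg (by positivity)]
    have h8 : |∑ e ∈ E, Λ e * (K e - (M:ℝ) / e)| ≤ C * (η * M * (∑ e ∈ Finset.Icc 1 D, 1/(e:ℝ)) + D) := by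
      calc _ ≤ ∑ e ∈ E, |Λ e * (K e - (M:ℝ) / e)| := Finset.abs_sum_le_sum_abs _ _
        _ ≤ ∑ e ∈ E, C * (η * M * (1 / (e:ℝ)) + 1) := by
            refine Finset.sum_le_sum (fun e he => ?_)
            rw [abs_mul]
            refine mul_le_mul (hΛ e he) ?_ (abs_nonneg _) hC
            have he1 : (0:ℝ) < e := by exact_mod_cast (hE e he).1
            have hk1 : (K e : ℝ) ≤ M / e := by
              rw [le_div_iff₀ he1]; exact_mod_cast hKM e he
            have hk2 : (M:ℝ) / e ≤ (1+η) * (K e + 1) := by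
              rw [div_le_iff₀ he1]
              have := hKη e he
              linarith
            rw [abs_sub_comm, abs_of_nonneg (by linarith)]
            have h9 : η * M * (1 / (e:ℝ)) = η * (M / e) := by ring
            rw [h9]
            -- M/e - K ≤ η M/e + 1
            by_contra hcon
            push Not at hcon
            have h10 : (K e:ℝ) + 1 < (1 - η) * (M/e) := by linarith
            have h11 : 0 ≤ (M:ℝ)/e := by positivity
            have h12 : (1+η) * (K e + 1) < (1+η) * ((1 - η) * (M/e)) := by
              apply mul_lt_mul_of_pos_left h10; linarith
            nlinarith [mul_nonneg (mul_nonneg hη hη) h11]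
        _ = C * (η * M * (∑ e ∈ E, 1/(e:ℝ)) + E.card) := by
            rw [← Finset.mul_sum, Finset.sum_add_distrib, ← Finset.mul_sum]; simp
        _ ≤ _ := by
            have hsub : E ⊆ Finset.Icc 1 D := fun e he => Finset.mem_Icc.2 ⟨(hE e he).1, (hE e he).2.1⟩
            have hc := Finset.card_le_card hsub
            rw [Nat.card_Icc] at hc
            have hc' : (E.card : ℝ) ≤ D := by exact_mod_cast (by omega : E.card ≤ D)
            have := Finset.sum_le_sum_of_subset_of_nonneg (f := fun e : ℕ => 1/(e:ℝ)) hsub (fun _ _ _ => by positivity)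
            gcongr
    calc _ ≤ (P.card^2 * Q.card / m : ℝ) * (C * (η * M * (∑ e ∈ Finset.Icc 1 D, 1/(e:ℝ)) + D)) := by gcongr
      _ = _ := by ring
  rw [h1, h3]
  have h8 : C * W * ∑ n ∈ S, R n ≤ C * W * ((N:ℝ) * P.card * Q.card * T / m +
      Real.sqrt (32 * (J+1)^2 * W^2 * N^2 * Q₀ * T * ((Q₀:ℝ) * M / m + 1))) := by gcongr
  set A1 := ∑ e ∈ E, Λ e * (∑ k ∈ Finset.Icc 1 (K e), R (e * k) - P.card^2 * Q.card * K e / m)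
  set A2 := ∑ e ∈ E, Λ e * (∑ n ∈ (Finset.Icc 1 M).filter (fun n => e ∣ n ∧ e * K e < n), R n)
  set A3 := ∑ e ∈ E, Λ e * (P.card^2 * Q.card * K e / m)
  set A4 := P.card^2 * Q.card * ((M:ℝ) / m) * ∑ e ∈ E, Λ e / e
  have : A1 + A2 + A3 - A4 = A1 + A2 + (A3 - A4) := by ring
  rw [this]
  refine (abs_add_three _ _ _).trans ?_
  linarith


theorem cd_A (n : ℕ) (hn : 1 ≤ n) :
    Real.log n - 1 ≤ ∑ d ∈ Finset.Ioc 0 n, ArithmeticFunction.vonMangoldt d / d ∧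
    ∑ d ∈ Finset.Ioc 0 n, ArithmeticFunction.vonMangoldt d / d ≤ Real.log n + (Real.log 4 + 4) := by
  have hn0 : (0:ℝ) < n := by exact_mod_cast hn
  have h1 := ArithmeticFunction.sum_Ioc_mul_zeta_eq_sum (R := ℝ) ArithmeticFunction.vonMangoldt n
  rw [ArithmeticFunction.vonMangoldt_mul_zeta] at h1
  have h2 : ∑ k ∈ Finset.Ioc 0 n, ArithmeticFunction.log k = Real.log (n.factorial) := by
    clear h1 hn0 hn
    induction n with
    | zero => simp
    | succ k ih =>
      rw [Finset.sum_Ioc_succ_top (Nat.zero_le k), ih, Nat.factorial_succ, Nat.cast_mul,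
        Real.log_mul (by positivity) (by positivity), ArithmeticFunction.log_apply]
      ring
  rw [h2] at h1
  have hup : Real.log (n.factorial) ≤ n * Real.log n := by
    rw [← Real.log_pow]
    apply Real.log_le_log (by positivity)
    exact_mod_cast Nat.factorial_le_pow n
  have hlow : n * Real.log n - n ≤ Real.log (n.factorial) := by
    have := Stirling.le_log_factorial_stirling (n := n) (by omega)
    have h3 : 0 ≤ Real.log n := Real.log_nonneg (by exact_mod_cast hn)
    have h4 : 0 ≤ Real.log (2 * Real.pi) := Real.log_nonneg (by have := Real.pi_gt_three; linarith)
    linarith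
  have hpsi : ∑ d ∈ Finset.Ioc 0 n, ArithmeticFunction.vonMangoldt d ≤ (Real.log 4 + 4) * n := by
    have := Chebyshev.psi_le_const_mul_self (x := (n:ℝ)) (by positivity)
    unfold Chebyshev.psi at this
    rw [Nat.floor_natCast] at this
    exact this
  have hA1 : Real.log (n.factorial) ≤ n * ∑ d ∈ Finset.Ioc 0 n, ArithmeticFunction.vonMangoldt d / d := by
    rw [h1, Finset.mul_sum]
    refine Finset.sum_le_sum (fun d hd => ?_)
    have := Nat.cast_div_le (α := ℝ) (m := n) (n := d)
    calc _ ≤ ArithmeticFunction.vonMangoldt d * ((n:ℝ)/d) := by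
          gcongr
      _ = _ := by ring
  have hA2 : n * ∑ d ∈ Finset.Ioc 0 n, ArithmeticFunction.vonMangoldt d / d ≤ Real.log (n.factorial) + (Real.log 4 + 4) * n := by
    refine le_trans ?_ (add_le_add_right hpsi _)
    rw [h1, Finset.mul_sum, ← Finset.sum_add_distrib]
    refine Finset.sum_le_sum (fun d hd => ?_)
    have hd1 := (Finset.mem_Ioc.1 hd).1
    have hd0 : (0:ℝ) < d := by exact_mod_cast hd1
    have h5 : (n:ℝ)/d ≤ ((n/d:ℕ):ℝ) + 1 := by
      rw [div_le_iff₀ hd0]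
      have := Nat.div_add_mod n d
      have h6 := Nat.mod_lt n hd1
      have : n ≤ (n/d+1)*d := by nlinarith
      exact_mod_cast this
    have hL := ArithmeticFunction.vonMangoldt_nonneg (n := d)
    calc _ = ArithmeticFunction.vonMangoldt d * ((n:ℝ)/d) := by ring
      _ ≤ ArithmeticFunction.vonMangoldt d * (((n/d:ℕ):ℝ) + 1) := by gcongr
      _ = _ := by ring
  constructor
  · have : n * (Real.log n - 1) ≤ n * ∑ d ∈ Finset.Ioc 0 n, ArithmeticFunction.vonMangoldt d / d := by linarith
    exact le_of_mul_le_mul_left this hn0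
  · have : n * ∑ d ∈ Finset.Ioc 0 n, ArithmeticFunction.vonMangoldt d / d ≤ n * (Real.log n + (Real.log 4 + 4)) := by linarith
    exact le_of_mul_le_mul_left this hn0

/-- primes in a half-open interval. -/
noncomputable def PR (u u' : ℝ) : Finset ℕ := (Finset.range ⌈u'⌉₊).filter (fun p => p.Prime ∧ u ≤ (p:ℝ))

theorem mem_PR {u u' : ℝ} {p : ℕ} : p ∈ PR u u' ↔ p.Prime ∧ u ≤ (p:ℝ) ∧ (p:ℝ) < u' := by
  unfold PR
  rw [Finset.mem_filter, Finset.mem_range, Nat.lt_ceil]; tauto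

theorem cd_logp : ∃ C : ℝ, 0 < C ∧ ∀ u u' : ℝ, 2 ≤ u → u ≤ u' →
    ∑ p ∈ PR u u', Real.log p / p ≤ Real.log u' - Real.log u + C := by
  refine ⟨Real.log 4 + 4 + 1 + Real.log 2, by have := Real.log_nonneg (by norm_num : (1:ℝ) ≤ 4); have := Real.log_nonneg (by norm_num : (1:ℝ) ≤ 2); linarith, fun u u' hu huu => ?_⟩
  set a := ⌈u⌉₊ - 1 with ha
  set b := ⌈u'⌉₊ - 1 with hb
  have hc1 : 2 ≤ ⌈u⌉₊ := by
    have : (1:ℝ) < u := by linarith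
    exact Nat.lt_ceil.2 (by exact_mod_cast this)
  have hc2 : ⌈u⌉₊ ≤ ⌈u'⌉₊ := Nat.ceil_mono huu
  have hsub : ∑ p ∈ PR u u', Real.log p / p ≤ ∑ d ∈ Finset.Ioc a b, ArithmeticFunction.vonMangoldt d / d := by
    have : ∑ p ∈ PR u u', Real.log p / p = ∑ p ∈ PR u u', ArithmeticFunction.vonMangoldt p / p := by
      refine Finset.sum_congr rfl (fun p hp => ?_)
      rw [ArithmeticFunction.vonMangoldt_apply_prime (mem_PR.1 hp).1]
    rw [this]
    refine Finset.sum_le_sum_of_subset_of_nonneg ?_ (fun d _ _ => div_nonneg ArithmeticFunction.vonMangoldt_nonneg (by positivity))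
    intro p hp
    obtain ⟨h1, h2, h3⟩ := mem_PR.1 hp
    rw [Finset.mem_Ioc]
    have h4 : p < ⌈u'⌉₊ := Nat.lt_ceil.2 h3
    have h5 : ⌈u⌉₊ ≤ p := Nat.ceil_le.2 h2
    omega
  have hsplit : ∑ d ∈ Finset.Ioc 0 b, ArithmeticFunction.vonMangoldt d / d = ∑ d ∈ Finset.Ioc 0 a, ArithmeticFunction.vonMangoldt d / (d:ℝ)
      + ∑ d ∈ Finset.Ioc a b, ArithmeticFunction.vonMangoldt d / d := by
    rw [Finset.sum_Ioc_consecutive _ (Nat.zero_le a) (by omega)]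
  have h1 := (cd_A a (by omega)).1
  have h2 := (cd_A b (by omega)).2
  have h3 : Real.log b ≤ Real.log u' := by
    apply Real.log_le_log (by exact_mod_cast (by omega : 0 < b))
    have := Nat.ceil_lt_add_one (by linarith : 0 ≤ u')
    have h5 : (b:ℝ) + 1 = ⌈u'⌉₊ := by exact_mod_cast (by omega : b + 1 = ⌈u'⌉₊)
    linarith
  have h4 : Real.log u - Real.log 2 ≤ Real.log a := by
    rw [← Real.log_div (by linarith) (by norm_num)]
    apply Real.log_le_log (by linarith)
    have := Nat.le_ceil u
    have h5 : (a:ℝ) + 1 = ⌈u⌉₊ := by exact_mod_cast (by omega : a + 1 = ⌈u⌉₊)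
    linarith
  linarith

theorem cd_sum (ρ δ : ℝ) (hρ : 1 ≤ ρ) (hδ : 0 < δ) : ∃ Y₀ : ℝ, 2 ≤ Y₀ ∧ ∀ y, Y₀ ≤ y →
    ∑ p ∈ PR y (y^ρ), 1 / (p:ℝ) ≤ Real.log ρ + δ := by
  obtain ⟨C, hC, hA⟩ := cd_logp
  set L := Real.log ρ with hL
  have hL0 : 0 ≤ L := Real.log_nonneg hρ
  obtain ⟨n, hn⟩ := exists_nat_ge (L + 2 * L^2 / δ + 1)
  have hn1 : (1:ℝ) ≤ n := by have : 0 ≤ 2 * L^2/δ := by positivity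
                             linarith
  have hnp : (0:ℝ) < n := by linarith
  set h := Real.exp (L/n) - 1 with hh
  have hx0 : 0 ≤ L / n := by positivity
  have hx1 : L / n ≤ 1 := by
    rw [div_le_one hnp]; have : 0 ≤ 2 * L^2/δ := by positivity
    linarith
  have hh1 : n * h ≤ L + δ/2 := by
    have h1 := Real.abs_exp_sub_one_sub_id_le (x := L/n) (by rw [abs_of_nonneg hx0]; exact hx1)
    have h2 := (abs_le.1 h1).2
    have h3 : n * h ≤ n * (L/n + (L/n)^2) := by
      apply mul_le_mul_of_nonneg_left _ hnp.le; linarith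
    have h4 : n * (L/n + (L/n)^2) = L + L^2/n := by field_simp
    have h5 : L^2/n ≤ δ/2 := by
      rw [div_le_iff₀ hnp]
      have h6 : 2*L^2/δ ≤ n := by linarith
      rw [div_le_iff₀ hδ] at h6
      linarith
    linarith
  have hh0 : 0 ≤ h := by
    have := Real.add_one_le_exp (L/n); linarith
  set Y₀ := max 2 (Real.exp (2 * n * C / δ)) with hY
  refine ⟨Y₀, le_max_left _ _, fun y hy => ?_⟩
  have hy2 : 2 ≤ y := (le_max_left _ _).trans hy
  have hly : 0 < Real.log y := Real.log_pos (by linarith)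
  have hly2 : 2 * n * C / δ ≤ Real.log y := by
    rw [Real.le_log_iff_exp_le (by linarith)]; exact (le_max_right _ _).trans hy
  have key : ∀ j : ℕ, ∑ p ∈ PR y (y^(Real.exp (j * (L/n)))), 1/(p:ℝ) ≤ j * (h + C / Real.log y) := by
    intro j
    induction j with
    | zero =>
      have : PR y (y^(Real.exp ((0:ℕ) * (L/n)))) = ∅ := by
        ext p
        simp only [mem_PR, Finset.notMem_empty, iff_false]
        rintro ⟨_, h1, h2⟩
        simp at h2
        linarith
      rw [this]; simp
    | succ j ih =>
      set u := y^(Real.exp (j * (L/n))) with hu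
      set u' := y^(Real.exp ((j+1:ℕ) * (L/n))) with hu'
      have he1 : 1 ≤ Real.exp (j * (L/n)) := Real.one_le_exp (by positivity)
      have huy : y ≤ u := by
        calc y = y^(1:ℝ) := (Real.rpow_one y).symm
          _ ≤ _ := Real.rpow_le_rpow_of_exponent_le (by linarith) he1
      have huu : u ≤ u' := by
        apply Real.rpow_le_rpow_of_exponent_le (by linarith)
        apply Real.exp_le_exp.2
        push_cast
        nlinarith
      have hlu : Real.log u = Real.exp (j * (L/n)) * Real.log y := Real.log_rpow (by linarith) _
      have hlu' : Real.log u' = (h+1) * Real.log u := by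
        rw [hu', Real.log_rpow (by linarith), hlu, hh]
        push_cast
        rw [add_mul, Real.exp_add, one_mul]; ring
      have hluy : Real.log y ≤ Real.log u := Real.log_le_log (by linarith) huy
      have hpos : 0 < Real.log u := by linarith
      have hpiece : ∑ p ∈ PR u u', 1/(p:ℝ) ≤ h + C / Real.log y := by
        have h1 := hA u u' (by linarith) huu
        rw [hlu'] at h1
        have h2 : Real.log u * ∑ p ∈ PR u u', 1/(p:ℝ) ≤ ∑ p ∈ PR u u', Real.log p / p := by
          rw [Finset.mul_sum]
          refine Finset.sum_le_sum (fun p hp => ?_)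
          obtain ⟨_, h3, _⟩ := mem_PR.1 hp
          have : Real.log u ≤ Real.log p := Real.log_le_log (by linarith) h3
          rw [mul_one_div]
          gcongr
        have h3 : Real.log u * ∑ p ∈ PR u u', 1/(p:ℝ) ≤ Real.log u * (h + C / Real.log u) := by
          have : Real.log u * (h + C / Real.log u) = Real.log u * h + C := by field_simp
          linarith
        have h4 := le_of_mul_le_mul_left h3 hpos
        have h5 : C / Real.log u ≤ C / Real.log y := by gcongr
        linarith
      have hsub : PR y u' ⊆ PR y u ∪ PR u u' := by
        intro p hp
        rw [Finset.mem_union, mem_PR, mem_PR]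
        obtain ⟨h1, h2, h3⟩ := mem_PR.1 hp
        rcases lt_or_ge (p:ℝ) u with h4 | h4
        · left; exact ⟨h1, h2, h4⟩
        · right; exact ⟨h1, h4, h3⟩
      calc _ ≤ ∑ p ∈ PR y u ∪ PR u u', 1/(p:ℝ) :=
            Finset.sum_le_sum_of_subset_of_nonneg hsub (fun _ _ _ => by positivity)
        _ ≤ ∑ p ∈ PR y u, 1/(p:ℝ) + ∑ p ∈ PR u u', 1/(p:ℝ) := by
            rw [← Finset.sum_union_inter]
            have : 0 ≤ ∑ p ∈ PR y u ∩ PR u u', 1/(p:ℝ) := Finset.sum_nonneg (fun _ _ => by positivity)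
            linarith
        _ ≤ j * (h + C / Real.log y) + (h + C / Real.log y) := by linarith
        _ = _ := by push_cast; ring
  have hk := key n
  have e1 : Real.exp (n * (L/n)) = ρ := by
    rw [mul_div_cancel₀ _ hnp.ne', hL, Real.exp_log (by linarith)]
  rw [e1] at hk
  refine hk.trans ?_
  have : n * (C / Real.log y) ≤ δ/2 := by
    rw [← mul_div_assoc, div_le_iff₀ hly]
    rw [div_le_iff₀ hδ] at hly2
    linarith
  linarith

theorem cd_main (ρ δ : ℝ) (hρ : 1 ≤ ρ) (hδ : 0 < δ) : ∃ Y₀ : ℝ, 2 ≤ Y₀ ∧ ∀ y, Y₀ ≤ y →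
    ∀ B ⊆ PR y (y^ρ), ∑ p ∈ B, 1 / (p:ℝ) ≤ Real.log ρ + δ ∧
      (∏ p ∈ B, (1 - 1/(p:ℝ)))⁻¹ ≤ ρ * Real.exp δ := by
  obtain ⟨Y₁, hY1, h1⟩ := cd_sum ρ (δ/2) hρ (by linarith)
  have hL0 : 0 ≤ Real.log ρ := Real.log_nonneg hρ
  set Y₀ := max Y₁ (4 * (Real.log ρ + δ/2) / δ) with hY
  refine ⟨Y₀, hY1.trans (le_max_left _ _), fun y hy B hB => ?_⟩
  have hy1 : Y₁ ≤ y := (le_max_left _ _).trans hy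
  have hy2 : 4 * (Real.log ρ + δ/2) / δ ≤ y := (le_max_right _ _).trans hy
  have hyp : 0 < y := by linarith
  have hs : ∑ p ∈ B, 1 / (p:ℝ) ≤ Real.log ρ + δ/2 :=
    (Finset.sum_le_sum_of_subset_of_nonneg hB (fun _ _ _ => by positivity)).trans (h1 y hy1)
  refine ⟨by linarith, ?_⟩
  have hb : ∀ p ∈ B, (1 - 1/(p:ℝ))⁻¹ ≤ Real.exp ((1 + 2/y) * (1/(p:ℝ))) := by
    intro p hp
    obtain ⟨hpp, hyp', _⟩ := mem_PR.1 (hB hp)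
    have hp2 : (2:ℝ) ≤ p := by exact_mod_cast hpp.two_le
    have e1 : (1 - 1/(p:ℝ))⁻¹ = 1/(p-1:ℝ) + 1 := by
      have : (p:ℝ) - 1 ≠ 0 := by linarith
      field_simp
      ring
    rw [e1]
    refine (Real.add_one_le_exp _).trans (Real.exp_le_exp.2 ?_)
    have hp1 : (0:ℝ) < p - 1 := by linarith
    have h3 : 2/y ≥ 2/(p:ℝ) := by gcongr
    calc 1/((p:ℝ)-1) ≤ (1 + 2/(p:ℝ)) * (1/(p:ℝ)) := by
          have e2 : (1 + 2/(p:ℝ)) * (1/(p:ℝ)) = (p+2)/(p*p:ℝ) := by field_simp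
          rw [e2, div_le_div_iff₀ hp1 (by positivity)]
          nlinarith
      _ ≤ _ := by gcongr
  rw [← Finset.prod_inv_distrib]
  calc _ ≤ ∏ p ∈ B, Real.exp ((1 + 2/y) * (1/(p:ℝ))) := by
        refine Finset.prod_le_prod (fun p hp => ?_) hb
        have hpp := (mem_PR.1 (hB hp)).1
        have hp2 : (2:ℝ) ≤ p := by exact_mod_cast hpp.two_le
        have : 1/(p:ℝ) ≤ 1 := by rw [div_le_one (by linarith)]; linarith
        rw [inv_nonneg]; linarith
    _ = Real.exp ((1 + 2/y) * ∑ p ∈ B, 1/(p:ℝ)) := by rw [← Real.exp_sum, Finset.mul_sum]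
    _ ≤ Real.exp (Real.log ρ + δ) := by
        apply Real.exp_le_exp.2
        calc _ ≤ (1 + 2/y) * (Real.log ρ + δ/2) := by gcongr
          _ = (Real.log ρ + δ/2) + (2 * (Real.log ρ + δ/2)) / y := by ring
          _ ≤ (Real.log ρ + δ/2) + δ/2 := by
              have : (2 * (Real.log ρ + δ/2)) / y ≤ δ/2 := by
                rw [div_le_iff₀ hyp]
                rw [div_le_iff₀ hδ] at hy2
                linarith
              linarith
          _ = _ := by ring
    _ = _ := by rw [Real.exp_add, Real.exp_log (by linarith)]


open Finset in
theorem ce_split {A B : Finset ℕ} (hAB : Disjoint A B) (g h : Finset ℕ → ℝ) :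
    ∑ S ∈ (A ∪ B).powerset, g (S ∩ A) * h (S ∩ B) = (∑ S ∈ A.powerset, g S) * ∑ S ∈ B.powerset, h S := by
  rw [Finset.sum_mul_sum, ← Finset.sum_product']
  refine Finset.sum_bij' (fun S _ => (S ∩ A, S ∩ B)) (fun x _ => x.1 ∪ x.2) ?_ ?_ ?_ ?_ ?_
  · intro S hS
    simp only [mem_product, mem_powerset]
    exact ⟨inter_subset_right, inter_subset_right⟩
  · intro x hx
    simp only [mem_product, mem_powerset] at hx ⊢
    exact union_subset_union hx.1 hx.2
  · intro S hS
    simp only [mem_powerset] at hS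
    rw [← inter_union_distrib_left]
    exact inter_eq_left.2 hS
  · rintro ⟨S, T⟩ hx
    simp only [mem_product, mem_powerset] at hx
    have h1 := Finset.disjoint_left.1 hAB
    ext p
    · simp only [mem_inter, mem_union]
      constructor
      · rintro ⟨h2 | h2, h3⟩
        · exact h2
        · exact absurd (hx.2 h2) (h1 h3)
      · intro h2
        exact ⟨Or.inl h2, hx.1 h2⟩
    · simp only [mem_inter, mem_union]
      constructor
      · rintro ⟨h2 | h2, h3⟩
        · exact absurd h3 (h1 (hx.1 h2))
        · exact h2
      · intro h2
        exact ⟨Or.inr h2, hx.2 h2⟩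
  · intro S hS
    rfl

noncomputable def eS (x : ℕ → ℝ) (k : ℕ) (B : Finset ℕ) : ℝ :=
  ∑ S ∈ B.powerset, if S.card = k then ∏ p ∈ S, x p else 0

noncomputable def nuS (b : ℕ) (S : Finset ℕ) : ℝ := if S.card ≤ b then (-1)^S.card else 0

noncomputable def ES (x : ℕ → ℝ) (b : ℕ) (B : Finset ℕ) : ℝ :=
  ∑ S ∈ B.powerset, nuS b S * ∏ p ∈ S, x p

theorem eS_insert (x : ℕ → ℝ) (k : ℕ) (B : Finset ℕ) (p : ℕ) (hp : p ∉ B) :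
    eS x (k+1) (insert p B) = eS x (k+1) B + x p * eS x k B := by
  unfold eS
  rw [Finset.sum_powerset_insert hp, Finset.mul_sum]
  congr 1
  refine Finset.sum_congr rfl (fun S hS => ?_)
  have hpS : p ∉ S := fun h => hp (Finset.mem_powerset.1 hS h)
  rw [Finset.card_insert_of_notMem hpS, Finset.prod_insert hpS]
  by_cases h : S.card = k <;> simp [h]

theorem ES_insert (x : ℕ → ℝ) (k : ℕ) (B : Finset ℕ) (p : ℕ) (hp : p ∉ B) :
    ES x (k+1) (insert p B) = ES x (k+1) B - x p * ES x k B := by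
  unfold ES
  rw [Finset.sum_powerset_insert hp, Finset.mul_sum, sub_eq_add_neg, ← Finset.sum_neg_distrib]
  congr 1
  refine Finset.sum_congr rfl (fun S hS => ?_)
  have hpS : p ∉ S := fun h => hp (Finset.mem_powerset.1 hS h)
  unfold nuS
  rw [Finset.card_insert_of_notMem hpS, Finset.prod_insert hpS]
  by_cases h : S.card ≤ k
  · simp [h, pow_succ]; ring
  · simp [h]

theorem ES_zero (x : ℕ → ℝ) (B : Finset ℕ) : ES x 0 B = 1 := by
  unfold ES
  rw [Finset.sum_eq_single ∅]
  · simp [nuS]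
  · intro S _ hS
    have : S.card ≠ 0 := by simpa using hS
    simp [nuS, hS]
  · simp

theorem eS_zero (x : ℕ → ℝ) (B : Finset ℕ) : eS x 0 B = 1 := by
  unfold eS
  rw [Finset.sum_eq_single ∅]
  · simp
  · intro S _ hS
    simp [hS]
  · simp

theorem eS_nonneg (x : ℕ → ℝ) (k : ℕ) (B : Finset ℕ) (hx : ∀ p ∈ B, 0 ≤ x p) : 0 ≤ eS x k B := by
  unfold eS
  refine Finset.sum_nonneg (fun S hS => ?_)
  split_ifs
  · exact Finset.prod_nonneg (fun p hp => hx p (Finset.mem_powerset.1 hS hp))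
  · exact le_rfl

theorem eS_one_insert (x : ℕ → ℝ) (B : Finset ℕ) (p : ℕ) (hp : p ∉ B) :
    eS x 1 (insert p B) = eS x 1 B + x p := by
  rw [eS_insert x 0 B p hp, eS_zero, mul_one]

theorem bonf (x : ℕ → ℝ) (B : Finset ℕ) : ∀ b : ℕ, (∀ p ∈ B, 0 ≤ x p ∧ x p ≤ 1) →
    0 ≤ (-1)^b * (ES x b B - ∏ p ∈ B, (1 - x p)) ∧
    (-1)^b * (ES x b B - ∏ p ∈ B, (1 - x p)) ≤ eS x (b+1) B := by
  induction B using Finset.induction_on with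
  | empty =>
    intro b _
    have h1 : ES x b ∅ = 1 := by simp [ES, nuS]
    have h2 : eS x (b+1) ∅ = 0 := by simp [eS]
    rw [h1, h2]; simp
  | insert p B hp ih =>
    intro b hx
    have hxB : ∀ q ∈ B, 0 ≤ x q ∧ x q ≤ 1 := fun q hq => hx q (Finset.mem_insert_of_mem hq)
    have hxp := hx p (Finset.mem_insert_self p B)
    rw [Finset.prod_insert hp]
    have hV0 : 0 ≤ ∏ q ∈ B, (1 - x q) := Finset.prod_nonneg (fun q hq => by linarith [(hxB q hq).2])
    have hV1 : ∏ q ∈ B, (1 - x q) ≤ 1 := Finset.prod_le_one (fun q hq => by linarith [(hxB q hq).2]) (fun q hq => by linarith [(hxB q hq).1])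
    set V := ∏ q ∈ B, (1 - x q)
    cases b with
    | zero =>
      have h := ih 0 hxB
      rw [ES_zero] at h ⊢
      rw [zero_add] at h ⊢
      rw [eS_one_insert x B p hp]
      simp only [pow_zero, one_mul] at h ⊢
      constructor
      · nlinarith
      · nlinarith
    | succ b =>
      have h := ih (b+1) hxB
      have h' := ih b hxB
      rw [eS_insert x _ B p hp, ES_insert x _ B p hp]
      have e : (-1:ℝ)^(b+1) * (ES x (b+1) B - x p * ES x b B - (1 - x p) * V) =
        (-1:ℝ)^(b+1) * (ES x (b+1) B - V) + x p * ((-1)^b * (ES x b B - V)) := by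
        rw [pow_succ]; ring
      rw [e]
      constructor
      · have := mul_nonneg hxp.1 h'.1
        linarith [h.1]
      · have := mul_le_mul_of_nonneg_left h'.2 hxp.1
        linarith [h.2]

theorem add_pow_ge (L x : ℝ) (hL : 0 ≤ L) (hx : 0 ≤ x) (k : ℕ) : L^(k+1) + (k+1) * x * L^k ≤ (L+x)^(k+1) := by
  induction k with
  | zero => simp
  | succ k ih =>
    have : (L+x)^(k+1+1) = (L+x)^(k+1) * (L+x) := pow_succ _ _
    rw [this]
    have h2 := mul_le_mul_of_nonneg_right ih (add_nonneg hL hx)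
    refine le_trans ?_ h2
    have : 0 ≤ (k+1) * x * L^k * x := by positivity
    push_cast
    have e : (L ^ (k + 1) + (↑k + 1) * x * L ^ k) * (L + x) = L^(k+1+1) + (k+1+1) * x * L^(k+1) + (k+1) * x * L^k * x := by ring
    rw [e]; linarith

theorem eS_le (x : ℕ → ℝ) (B : Finset ℕ) : ∀ k : ℕ, (∀ p ∈ B, 0 ≤ x p) →
    eS x k B ≤ (∑ p ∈ B, x p)^k / k.factorial := by
  induction B using Finset.induction_on with
  | empty =>
    intro k _
    cases k with
    | zero => simp [eS_zero]
    | succ k => simp [eS]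
  | insert p B hp ih =>
    intro k hx
    have hxB : ∀ q ∈ B, 0 ≤ x q := fun q hq => hx q (Finset.mem_insert_of_mem hq)
    have hxp := hx p (Finset.mem_insert_self p B)
    cases k with
    | zero => simp [eS_zero]
    | succ k =>
      rw [eS_insert x _ B p hp, Finset.sum_insert hp]
      have hL : 0 ≤ ∑ q ∈ B, x q := Finset.sum_nonneg hxB
      set L := ∑ q ∈ B, x q
      have h1 := ih (k+1) hxB
      have h2 := mul_le_mul_of_nonneg_left (ih k hxB) hxp
      refine le_trans (add_le_add h1 h2) ?_
      have h3 := add_pow_ge L (x p) hL hxp k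
      have hf : (0:ℝ) < k.factorial := by exact_mod_cast Nat.factorial_pos k
      rw [Nat.factorial_succ]
      push_cast
      have e : L ^ (k + 1) / ((↑k + 1) * ↑k.factorial) + x p * (L ^ k / ↑k.factorial) = (L^(k+1) + (k+1) * x p * L^k) / ((↑k + 1) * ↑k.factorial) := by
        field_simp
      rw [e, add_comm (x p) L]
      gcongr

/-- Sieve weights. -/
structure SW (P : Finset ℕ) (lp lm : Finset ℕ → ℝ) (Dp Dm F f : ℝ) : Prop where
  ap : ∀ S, S ⊆ P → |lp S| ≤ 1
  am : ∀ S, S ⊆ P → |lm S| ≤ 1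
  sp : ∀ T, T ⊆ P → (if T = ∅ then (1:ℝ) else 0) ≤ ∑ S ∈ T.powerset, lp S
  sm : ∀ T, T ⊆ P → ∑ S ∈ T.powerset, lm S ≤ (if T = ∅ then (1:ℝ) else 0)
  dp : ∀ S, S ⊆ P → lp S ≠ 0 → ((∏ p ∈ S, p : ℕ) : ℝ) ≤ Dp
  dm : ∀ S, S ⊆ P → lm S ≠ 0 → ((∏ p ∈ S, p : ℕ) : ℝ) ≤ Dm
  vp : ∑ S ∈ P.powerset, lp S * ∏ p ∈ S, (p:ℝ)⁻¹ ≤ F * ∏ p ∈ P, (1 - (p:ℝ)⁻¹)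
  vm : f * ∏ p ∈ P, (1 - (p:ℝ)⁻¹) ≤ ∑ S ∈ P.powerset, lm S * ∏ p ∈ S, (p:ℝ)⁻¹

theorem prod_V_nonneg (P : Finset ℕ) : 0 ≤ ∏ p ∈ P, (1 - (p:ℝ)⁻¹) :=
  Finset.prod_nonneg (fun p _ => by linarith [Nat.cast_inv_le_one p (α := ℝ)])

theorem SW.mono {P lp lm Dp Dm F f Dp' Dm' F' f'} (h : SW P lp lm Dp Dm F f) (h1 : Dp ≤ Dp') (h2 : Dm ≤ Dm')
    (h3 : F ≤ F') (h4 : f' ≤ f) : SW P lp lm Dp' Dm' F' f' where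
  ap := h.ap
  am := h.am
  sp := h.sp
  sm := h.sm
  dp := fun S hS hn => (h.dp S hS hn).trans h1
  dm := fun S hS hn => (h.dm S hS hn).trans h2
  vp := h.vp.trans (mul_le_mul_of_nonneg_right h3 (prod_V_nonneg P))
  vm := (mul_le_mul_of_nonneg_right h4 (prod_V_nonneg P)).trans h.vm

theorem SW_base (P : Finset ℕ) (hP : ∀ p ∈ P, 1 ≤ p) :
    SW P (fun S => (-1)^S.card) (fun S => (-1)^S.card) (∏ p ∈ P, p : ℕ) (∏ p ∈ P, p : ℕ) 1 1 := by
  have hs : ∀ T : Finset ℕ, ∑ S ∈ T.powerset, (-1:ℝ)^S.card = if T = ∅ then 1 else 0 := by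
    intro T
    have := Finset.sum_powerset_neg_one_pow_card (x := T)
    have h2 : ((∑ S ∈ T.powerset, (-1:ℤ)^S.card : ℤ) : ℝ) = ((if T = ∅ then 1 else 0 : ℤ) : ℝ) := by rw [this]
    push_cast at h2
    exact h2
  have hd : ∀ S, S ⊆ P → ((∏ p ∈ S, p : ℕ) : ℝ) ≤ (∏ p ∈ P, p : ℕ) := by
    intro S hS
    exact_mod_cast Nat.le_of_dvd (Finset.prod_pos (fun p hp => hP p hp)) (Finset.prod_dvd_prod_of_subset _ _ _ hS)
  have hv : ∑ S ∈ P.powerset, (-1:ℝ)^S.card * ∏ p ∈ S, (p:ℝ)⁻¹ = ∏ p ∈ P, (1 - (p:ℝ)⁻¹) := by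
    have h := Finset.prod_one_add (f := fun p : ℕ => -(p:ℝ)⁻¹) P
    simp only [← sub_eq_add_neg] at h
    rw [h]
    refine Finset.sum_congr rfl (fun S _ => ?_)
    rw [Finset.prod_neg]
  constructor
  · intro S _; simp
  · intro S _; simp
  · intro T _; exact (hs T).ge
  · intro T _; exact (hs T).le
  · intro S hS _; exact hd S hS
  · intro S hS _; exact hd S hS
  · rw [hv, one_mul]
  · rw [hv, one_mul]

theorem ce_sub (A B T : Finset ℕ) (hT : T ⊆ A ∪ B) : T = (T ∩ A) ∪ (T ∩ B) := by
  rw [← Finset.inter_union_distrib_left]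
  exact (Finset.inter_eq_left.2 hT).symm

theorem ce_prod {M : Type*} [CommMonoid M] (A B T : Finset ℕ) (hAB : Disjoint A B) (hT : T ⊆ A ∪ B) (x : ℕ → M) :
    ∏ p ∈ T, x p = (∏ p ∈ T ∩ A, x p) * ∏ p ∈ T ∩ B, x p := by
  conv_lhs => rw [ce_sub A B T hT]
  rw [Finset.prod_union]
  exact Finset.disjoint_of_subset_left Finset.inter_subset_right (Finset.disjoint_of_subset_right Finset.inter_subset_right hAB)

theorem ce_splitT {A B : Finset ℕ} (hAB : Disjoint A B) (T : Finset ℕ) (hT : T ⊆ A ∪ B) (g h : Finset ℕ → ℝ) :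
    ∑ S ∈ T.powerset, g (S ∩ A) * h (S ∩ B) = (∑ S ∈ (T ∩ A).powerset, g S) * ∑ S ∈ (T ∩ B).powerset, h S := by
  have hd : Disjoint (T ∩ A) (T ∩ B) := Finset.disjoint_of_subset_left Finset.inter_subset_right (Finset.disjoint_of_subset_right Finset.inter_subset_right hAB)
  rw [← ce_split hd, ← ce_sub A B T hT]
  refine Finset.sum_congr rfl (fun S hS => ?_)
  have hS := Finset.mem_powerset.1 hS
  rw [← Finset.inter_assoc, ← Finset.inter_assoc, Finset.inter_eq_left.2 hS]

theorem ES_ones (b : ℕ) (T : Finset ℕ) : ES (fun _ => 1) b T = ∑ S ∈ T.powerset, nuS b S := by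
  unfold ES; simp

theorem ones_V (T : Finset ℕ) : ∏ p ∈ T, (1 - (fun _ : ℕ => (1:ℝ)) p) = if T = ∅ then 1 else 0 := by
  by_cases h : T = ∅
  · simp [h]
  · obtain ⟨p, hp⟩ := Finset.nonempty_iff_ne_empty.2 h
    rw [if_neg h]
    exact Finset.prod_eq_zero hp (by simp)

theorem nuS_abs (b : ℕ) (S : Finset ℕ) : |nuS b S| ≤ 1 := by
  unfold nuS
  split_ifs <;> simp

theorem ce_pw (S : Finset ℕ) (Y : ℝ) (hY : 1 ≤ Y) (hS : ∀ p ∈ S, (p:ℝ) ≤ Y) (b : ℕ) (hb : S.card ≤ b) :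
    ((∏ p ∈ S, p : ℕ) : ℝ) ≤ Y^b := by
  push_cast
  calc ∏ p ∈ S, (p:ℝ) ≤ ∏ p ∈ S, Y := Finset.prod_le_prod (fun p _ => by positivity) hS
    _ = Y^S.card := by simp
    _ ≤ Y^b := pow_le_pow_right₀ hY hb

theorem SW_step {P : Finset ℕ} {lp lm : Finset ℕ → ℝ} {Dp Dm F f : ℝ} (h : SW P lp lm Dp Dm F f)
    (B : Finset ℕ) (hPB : Disjoint P B) (Y : ℝ) (hY : 1 ≤ Y) (hB : ∀ p ∈ B, (p:ℝ) ≤ Y) (b : ℕ) (hb : Even b)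
    (hf : 0 ≤ f) (hF : 0 ≤ F) (ε : ℝ)
    (hε : eS (fun p => (p:ℝ)⁻¹) (b+1) B ≤ ε * ∏ p ∈ B, (1 - (p:ℝ)⁻¹))
    (Dp' Dm' : ℝ) (h1 : Dp * Y^b ≤ Dp') (h2 : Dm * Y^b ≤ Dm') (h3 : Dp * Y^(b+1) ≤ Dm') :
    ∃ lp' lm', SW (P ∪ B) lp' lm' Dp' Dm' (F * (1 + ε)) (f - F * ε) := by
  set I : Finset ℕ → ℝ := fun S => if S.card = b+1 then 1 else 0 with hI
  have hVB := prod_V_nonneg B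
  have hVP := prod_V_nonneg P
  have hbon := bonf (fun p => (p:ℝ)⁻¹) B b (fun p _ => ⟨by positivity, Nat.cast_inv_le_one p⟩)
  rw [hb.neg_one_pow, one_mul] at hbon
  have hbon1 : ∀ T : Finset ℕ, (if T = ∅ then (1:ℝ) else 0) ≤ ∑ S ∈ T.powerset, nuS b S ∧
      ∑ S ∈ T.powerset, nuS b S ≤ (if T = ∅ then (1:ℝ) else 0) + ∑ S ∈ T.powerset, I S := by
    intro T
    have := bonf (fun _ => 1) T b (fun p _ => by norm_num)
    rw [hb.neg_one_pow, one_mul, ones_V, ES_ones] at this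
    have e : eS (fun _ => 1) (b+1) T = ∑ S ∈ T.powerset, I S := by
      unfold eS; simp [hI]
    rw [e] at this
    constructor <;> linarith [this.1, this.2]
  have hprodsplit : ∀ (l k : Finset ℕ → ℝ), ∑ S ∈ (P ∪ B).powerset, l (S ∩ P) * k (S ∩ B) * ∏ p ∈ S, (p:ℝ)⁻¹ =
      (∑ S ∈ P.powerset, l S * ∏ p ∈ S, (p:ℝ)⁻¹) * ∑ S ∈ B.powerset, k S * ∏ p ∈ S, (p:ℝ)⁻¹ := by
    intro l k
    rw [← ce_split hPB]
    refine Finset.sum_congr rfl (fun S hS => ?_)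
    rw [ce_prod P B S hPB (Finset.mem_powerset.1 hS)]
    ring
  have hEI : ∑ S ∈ B.powerset, I S * ∏ p ∈ S, (p:ℝ)⁻¹ = eS (fun p => (p:ℝ)⁻¹) (b+1) B := by
    unfold eS
    refine Finset.sum_congr rfl (fun S _ => ?_)
    simp [hI]
  have he0 := eS_nonneg (fun p => (p:ℝ)⁻¹) (b+1) B (fun p _ => by positivity)
  have hfac : ∀ S, S ⊆ P ∪ B → ((∏ p ∈ S, p : ℕ) : ℝ) = ((∏ p ∈ S ∩ P, p : ℕ) : ℝ) * ((∏ p ∈ S ∩ B, p : ℕ) : ℝ) := by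
    intro S hS
    rw [ce_prod P B S hPB hS]; push_cast; rfl
  have hBS : ∀ S : Finset ℕ, ∀ p ∈ S ∩ B, (p:ℝ) ≤ Y := fun S p hp => hB p (Finset.mem_inter.1 hp).2
  have hpo : ∀ T, T ⊆ P → 0 ≤ ∑ S ∈ T.powerset, lp S := by
    intro T hT
    refine le_trans ?_ (h.sp T hT)
    split_ifs <;> norm_num
  have hTe : ∀ T, T ⊆ P ∪ B → (T = ∅ ↔ (T ∩ P = ∅ ∧ T ∩ B = ∅)) := by
    intro T hT
    constructor
    · rintro rfl; simp
    · rintro ⟨h5, h6⟩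
      rw [ce_sub P B T hT, h5, h6]; simp
  refine ⟨fun S => lp (S ∩ P) * nuS b (S ∩ B), fun S => lm (S ∩ P) * nuS b (S ∩ B) - lp (S ∩ P) * I (S ∩ B), ?_⟩
  constructor
  · intro S hS
    rw [abs_mul]
    exact mul_le_one₀ (h.ap _ Finset.inter_subset_right) (abs_nonneg _) (nuS_abs _ _)
  · intro S hS
    have ha := h.ap (S ∩ P) Finset.inter_subset_right
    have hb' := h.am (S ∩ P) Finset.inter_subset_right
    have hc := nuS_abs b (S ∩ B)
    by_cases hk : (S ∩ B).card = b+1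
    · have : nuS b (S ∩ B) = 0 := by unfold nuS; rw [if_neg (by omega)]
      simp only [hI, this, hk, if_true]
      simpa using ha
    · simp only [hI, hk, if_false, mul_zero, sub_zero]
      rw [abs_mul]
      exact mul_le_one₀ hb' (abs_nonneg _) hc
  · intro T hT
    rw [ce_splitT hPB T hT]
    have h5 := h.sp (T ∩ P) Finset.inter_subset_right
    have h6 := (hbon1 (T ∩ B)).1
    by_cases ht : T = ∅
    · have := (hTe T hT).1 ht
      rw [if_pos this.1] at h5
      rw [if_pos this.2] at h6
      rw [if_pos ht]
      nlinarith
    · rw [if_neg ht]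
      refine mul_nonneg (hpo _ Finset.inter_subset_right) (le_trans ?_ h6)
      split_ifs <;> norm_num
  · intro T hT
    rw [Finset.sum_sub_distrib, ce_splitT hPB T hT, ce_splitT hPB T hT]
    have h5 := h.sp (T ∩ P) Finset.inter_subset_right
    have h5' := h.sm (T ∩ P) Finset.inter_subset_right
    have h50 := hpo (T ∩ P) Finset.inter_subset_right
    obtain ⟨h6, h7⟩ := (hbon1 (T ∩ B))
    have hT1 := hTe T hT
    by_cases hz : T ∩ B = ∅
    · have e1 : ∑ S ∈ (T ∩ B).powerset, nuS b S = 1 := by rw [hz]; simp [nuS]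
      have e2 : ∑ S ∈ (T ∩ B).powerset, I S = 0 := by rw [hz]; simp [hI]
      rw [e1, e2]
      simp only [mul_one, mul_zero, sub_zero]
      refine h5'.trans (le_of_eq ?_)
      by_cases hq : T ∩ P = ∅
      · rw [if_pos hq, if_pos (hT1.2 ⟨hq, hz⟩)]
      · rw [if_neg hq, if_neg (fun h' => hq (hT1.1 h').1)]
    · rw [if_neg hz] at h6 h7
      rw [if_neg (fun h' => hz (hT1.1 h').2)]
      have h8 := mul_le_mul_of_nonneg_right (h5'.trans h5) h6
      have h9 := mul_le_mul_of_nonneg_left h7 h50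
      rw [zero_add] at h9
      linarith
  · intro S hS hn
    have hn1 : lp (S ∩ P) ≠ 0 := left_ne_zero_of_mul hn
    have hn2 : nuS b (S ∩ B) ≠ 0 := right_ne_zero_of_mul hn
    have hc : (S ∩ B).card ≤ b := by
      by_contra hc
      exact hn2 (by unfold nuS; rw [if_neg hc])
    rw [hfac S hS]
    have h5 := h.dp _ Finset.inter_subset_right hn1
    have h6 := ce_pw (S ∩ B) Y hY (hBS S) b hc
    refine le_trans (mul_le_mul h5 h6 (by positivity) (le_trans (by positivity) h5)) h1
  · intro S hS hn
    rw [hfac S hS]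
    by_cases hk : (S ∩ B).card = b+1
    · have h0 : nuS b (S ∩ B) = 0 := by unfold nuS; rw [if_neg (by omega)]
      simp only [h0, mul_zero, zero_sub, ne_eq, neg_eq_zero] at hn
      have hn1 : lp (S ∩ P) ≠ 0 := left_ne_zero_of_mul hn
      have h5 := h.dp _ Finset.inter_subset_right hn1
      have h6 := ce_pw (S ∩ B) Y hY (hBS S) (b+1) hk.le
      refine le_trans (mul_le_mul h5 h6 (by positivity) (le_trans (by positivity) h5)) h3
    · have h0 : I (S ∩ B) = 0 := by simp only [hI]; rw [if_neg hk]
      simp only [h0, mul_zero, sub_zero] at hn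
      have hn1 : lm (S ∩ P) ≠ 0 := left_ne_zero_of_mul hn
      have hn2 : nuS b (S ∩ B) ≠ 0 := right_ne_zero_of_mul hn
      have hc : (S ∩ B).card ≤ b := by
        by_contra hc
        exact hn2 (by unfold nuS; rw [if_neg hc])
      have h5 := h.dm _ Finset.inter_subset_right hn1
      have h6 := ce_pw (S ∩ B) Y hY (hBS S) b hc
      refine le_trans (mul_le_mul h5 h6 (by positivity) (le_trans (by positivity) h5)) h2
  · rw [hprodsplit, Finset.prod_union hPB]
    have h5 := h.vp
    have h6 : ∑ S ∈ B.powerset, nuS b S * ∏ p ∈ S, (p:ℝ)⁻¹ ≤ (1 + ε) * ∏ p ∈ B, (1 - (p:ℝ)⁻¹) := by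
      have := hbon.2
      unfold ES at this
      linarith
    have h7 : 0 ≤ ∑ S ∈ B.powerset, nuS b S * ∏ p ∈ S, (p:ℝ)⁻¹ := by
      have := hbon.1
      unfold ES at this
      linarith
    refine le_trans (mul_le_mul h5 h6 h7 (mul_nonneg hF hVP)) (le_of_eq (by ring))
  · simp only [sub_mul]
    rw [Finset.sum_sub_distrib, hprodsplit, hprodsplit, Finset.prod_union hPB, hEI]
    have h5 := h.vp
    have h5' := h.vm
    have h7 : ∏ p ∈ B, (1 - (p:ℝ)⁻¹) ≤ ∑ S ∈ B.powerset, nuS b S * ∏ p ∈ S, (p:ℝ)⁻¹ := by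
      have := hbon.1
      unfold ES at this
      linarith
    have h8 := mul_le_mul h5' h7 hVB (le_trans (mul_nonneg hf hVP) h5')
    have h9 := mul_le_mul h5 hε he0 (mul_nonneg hF hVP)
    linarith


noncomputable def PP (m : ℕ) (y : ℝ) : Finset ℕ := (PR 0 y).filter (fun p => ¬ p ∣ m)

theorem mem_PP {m : ℕ} {y : ℝ} {p : ℕ} : p ∈ PP m y ↔ p.Prime ∧ (p:ℝ) < y ∧ ¬ p ∣ m := by
  unfold PP
  rw [Finset.mem_filter, mem_PR]
  constructor
  · rintro ⟨⟨h1, _, h2⟩, h3⟩; exact ⟨h1, h2, h3⟩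
  · rintro ⟨h1, h2, h3⟩; exact ⟨⟨h1, by positivity, h2⟩, h3⟩

noncomputable def HBk (q L v C₁ : ℝ) : Prop := ∀ y, C₁ ≤ y → ∀ B, B ⊆ PR (y^q) y →
  ∑ p ∈ B, (p:ℝ)⁻¹ ≤ L ∧ (∏ p ∈ B, (1 - (p:ℝ)⁻¹))⁻¹ ≤ v

theorem PP_split (m : ℕ) (u y : ℝ) (huy : u ≤ y) : PP m y = PP m u ∪ (PR u y).filter (fun p => ¬ p ∣ m) := by
  ext p
  simp only [Finset.mem_union, mem_PP, Finset.mem_filter, mem_PR]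
  constructor
  · rintro ⟨h1, h2, h3⟩
    rcases lt_or_ge (p:ℝ) u with h | h
    · exact Or.inl ⟨h1, h, h3⟩
    · exact Or.inr ⟨⟨h1, h, h2⟩, h3⟩
  · rintro (⟨h1, h2, h3⟩ | ⟨⟨h1, h, h2⟩, h3⟩)
    · exact ⟨h1, h2.trans_le huy, h3⟩
    · exact ⟨h1, h2, h3⟩

theorem PP_disj (m : ℕ) (u y : ℝ) : Disjoint (PP m u) ((PR u y).filter (fun p => ¬ p ∣ m)) := by
  rw [Finset.disjoint_left]
  intro p hp hq
  have h1 := (mem_PP.1 hp).2.1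
  have h2 := (mem_PR.1 (Finset.mem_filter.1 hq).1).2.1
  linarith

theorem V_pos (B : Finset ℕ) (hB : ∀ p ∈ B, p.Prime) : 0 < ∏ p ∈ B, (1 - (p:ℝ)⁻¹) := by
  refine Finset.prod_pos (fun p hp => ?_)
  have : (2:ℝ) ≤ p := by exact_mod_cast (hB p hp).two_le
  have := inv_lt_one_of_one_lt₀ (show (1:ℝ) < p by linarith)
  linarith

theorem sched_step (q L v C₁ D₀ : ℝ) (hq0 : 0 < q) (hq1 : q < 1) (hD : 0 < D₀) (hC : 2 ≤ C₁)
    (HB : HBk q L v C₁) (m : ℕ) (y : ℝ) (hy : C₁ ≤ y) (s : ℝ) {lp lm F f}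
    (h : SW (PP m (y^q)) lp lm (D₀ * (y^q)^s) (D₀ * (y^q)^(s+1)) F f) (hF : 0 ≤ F) (hf : 0 ≤ f) (b : ℕ) (hb : Even b)
    (hv : 0 ≤ v) :
    ∃ lp' lm', SW (PP m y) lp' lm' (D₀ * y^(b + q*s)) (D₀ * y^(b + q*s+1)) (F * (1 + L^(b+1)/(b+1).factorial*v))
      (f - F * (L^(b+1)/(b+1).factorial*v)) := by
  have hy1 : 1 ≤ y := by linarith
  have hy0 : 0 < y := by linarith
  have hqy : y^q ≤ y := by
    conv_rhs => rw [← Real.rpow_one y]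
    exact Real.rpow_le_rpow_of_exponent_le hy1 hq1.le
  rw [PP_split m (y^q) y hqy]
  set B := (PR (y^q) y).filter (fun p => ¬ p ∣ m) with hBdef
  obtain ⟨hB1, hB2⟩ := HB y hy B (Finset.filter_subset _ _)
  have hBp : ∀ p ∈ B, p.Prime := fun p hp => (mem_PR.1 (Finset.mem_filter.1 hp).1).1
  have hV := V_pos B hBp
  refine SW_step h B (PP_disj m _ _) y hy1 (fun p hp => (mem_PR.1 (Finset.mem_filter.1 hp).1).2.2.le) b hb hf hF _ ?_ _ _ ?_ ?_ ?_
  · refine (eS_le _ B (b+1) (fun p _ => by positivity)).trans ?_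
    have h0 : 0 ≤ ∑ p ∈ B, (p:ℝ)⁻¹ := Finset.sum_nonneg (fun p _ => by positivity)
    have h1 : (∑ p ∈ B, (p:ℝ)⁻¹)^(b+1) / (b+1).factorial ≤ L^(b+1)/(b+1).factorial := by gcongr
    refine h1.trans ?_
    have h2 : 1 ≤ v * ∏ p ∈ B, (1 - (p:ℝ)⁻¹) := by
      rw [inv_eq_one_div, div_le_iff₀ hV] at hB2
      exact hB2
    have h3 : 0 ≤ L^(b+1)/(b+1).factorial := le_trans (by positivity) h1
    rw [mul_assoc]
    exact le_mul_of_one_le_right h3 h2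
  · rw [← Real.rpow_mul hy0.le, ← Real.rpow_natCast, mul_assoc, ← Real.rpow_add hy0]
    exact le_of_eq (by ring_nf)
  · rw [← Real.rpow_mul hy0.le, ← Real.rpow_natCast, mul_assoc, ← Real.rpow_add hy0]
    refine mul_le_mul_of_nonneg_left (Real.rpow_le_rpow_of_exponent_le hy1 ?_) hD.le
    nlinarith
  · rw [← Real.rpow_mul hy0.le, ← Real.rpow_natCast, mul_assoc, ← Real.rpow_add hy0]
    refine le_of_eq ?_
    push_cast
    ring_nf

theorem sched_base (m : ℕ) (y C₁ s : ℝ) (hy : y ≤ C₁) (hy1 : 1 ≤ y) (hs : 0 ≤ s) (U : ℝ) (hU : 0 ≤ U) : ∃ lp lm,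
    SW (PP m y) lp lm ((∏ p ∈ PR 0 C₁, p : ℕ) * y^s) ((∏ p ∈ PR 0 C₁, p : ℕ) * y^(s+1)) (1+U) (1-U) := by
  have hpos : ∀ p ∈ PR 0 C₁, 0 < p := fun p hp => (mem_PR.1 hp).1.pos
  have h1 : ((∏ p ∈ PP m y, p : ℕ) : ℝ) ≤ (∏ p ∈ PR 0 C₁, p : ℕ) := by
    have : PP m y ⊆ PR 0 C₁ := by
      intro p hp
      obtain ⟨h1, h2, h3⟩ := mem_PP.1 hp
      exact mem_PR.2 ⟨h1, by positivity, by linarith⟩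
    exact_mod_cast Nat.le_of_dvd (Finset.prod_pos hpos) (Finset.prod_dvd_prod_of_subset _ _ _ this)
  have hD : (0:ℝ) ≤ (∏ p ∈ PR 0 C₁, p : ℕ) := by positivity
  refine ⟨_, _, (SW_base (PP m y) (fun p hp => (mem_PP.1 hp).1.one_lt.le)).mono ?_ ?_ (by linarith) (by linarith)⟩
  · exact h1.trans (le_mul_of_one_le_right hD (Real.one_le_rpow hy1 hs))
  · exact h1.trans (le_mul_of_one_le_right hD (Real.one_le_rpow hy1 (by linarith)))

theorem sched (q L v C₁ : ℝ) (hq0 : 0 < q) (hq1 : q < 1) (hC : 2 ≤ C₁) (HB : HBk q L v C₁)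
    (hL0 : 0 < L) (hL : L^2 ≤ 1.06) (hv : 0 < v) (hε : L^5/120*v ≤ 0.027) : ∀ k : ℕ, ∀ m : ℕ, ∀ y : ℝ, 1 ≤ y → y < C₁^((1/q)^k) → ∀ i : ℕ, 1 ≤ i →
    ∃ lp lm, SW (PP m y) lp lm ((∏ p ∈ PR 0 C₁, p : ℕ) * y^((2*i+2:ℝ)/(1-q)+2*q/(1-q)^2))
      ((∏ p ∈ PR 0 C₁, p : ℕ) * y^((2*i+2:ℝ)/(1-q)+2*q/(1-q)^2+1))
      (1+1.03*(L^(2*i+3)/(2*i+3).factorial*v)) (1-1.03*(L^(2*i+3)/(2*i+3).factorial*v)) := by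
  have hq2 : 0 < 1 - q := by linarith
  have hD : (0:ℝ) < (∏ p ∈ PR 0 C₁, p : ℕ) := by
    have : 0 < ∏ p ∈ PR 0 C₁, p := Finset.prod_pos (fun p hp => (mem_PR.1 hp).1.pos)
    exact_mod_cast this
  have heps : ∀ i : ℕ, 1 ≤ i → L^(2*(i+1)+3)/(2*(i+1)+3).factorial*v ≤ L^(2*i+3)/(2*i+3).factorial*v * (1.06/42) := by
    intro i hi
    have e : ((2*(i+1)+3).factorial:ℝ) = (2*i+5) * (2*i+4) * (2*i+3).factorial := by
      have : 2*(i+1)+3 = (2*i+3)+1+1 := by ring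
      rw [this, Nat.factorial_succ, Nat.factorial_succ]
      push_cast; ring
    rw [e]
    have e2 : L^(2*(i+1)+3) = L^(2*i+3) * L^2 := by rw [← pow_add]; congr 1
    rw [e2]
    have hf : (0:ℝ) < (2*i+3).factorial := by exact_mod_cast Nat.factorial_pos _
    have hi' : (1:ℝ) ≤ i := by exact_mod_cast hi
    have h42 : (42:ℝ) ≤ (2*i+5) * (2*i+4) := by nlinarith
    have e3 : L^(2*i+3) * L^2/((2*i+5) * (2*i+4) * (2*i+3).factorial)*v = L^(2*i+3)/(2*i+3).factorial*v * (L^2/((2*i+5) * (2*i+4))) := by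
      field_simp
    rw [e3]
    gcongr
  have hepos : ∀ i : ℕ, 0 < L^(2*i+3)/(2*i+3).factorial*v := by
    intro i
    have hf : (0:ℝ) < (2*i+3).factorial := by exact_mod_cast Nat.factorial_pos _
    positivity
  have hsm : ∀ i : ℕ, 1 ≤ i → L^(2*i+3)/(2*i+3).factorial*v ≤ 0.027 := by
    intro i hi
    induction i, hi using Nat.le_induction with
    | base => norm_num [Nat.factorial] at hε ⊢; linarith
    | succ i hi ih =>
      have := heps i hi
      have := hepos i
      linarith
  have hexp : ∀ i : ℕ, 0 ≤ (2*i+2:ℝ)/(1-q)+2*q/(1-q)^2 := by intro i; positivity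
  intro k
  induction k with
  | zero =>
    intro m y hy1 hy i hi
    rw [pow_zero, Real.rpow_one] at hy
    have := hepos i
    exact sched_base m y C₁ _ hy.le hy1 (hexp i) _ (by positivity)
  | succ k ih =>
    intro m y hy1 hy i hi
    rcases lt_or_ge y C₁ with h | h
    · have := hepos i
      exact sched_base m y C₁ _ h.le hy1 (hexp i) _ (by positivity)
    · have hy0 : 0 < y := by linarith
      have h1 : y^q < C₁^((1/q)^k) := by
        have h2 := Real.rpow_lt_rpow hy0.le hy hq0
        rw [← Real.rpow_mul (by linarith), pow_succ, mul_assoc, one_div_mul_cancel hq0.ne', mul_one] at h2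
        exact h2
      obtain ⟨lp, lm, h3⟩ := ih m (y^q) (Real.one_le_rpow hy1 hq0.le) h1 (i+1) (by omega)
      have e0 := hepos (i+1)
      have e1 := hsm (i+1) (by omega)
      have e2 := heps i hi
      have e3 := hsm i hi
      have e4 := hepos i
      obtain ⟨lp', lm', h4⟩ := sched_step q L v C₁ _ hq0 hq1 hD hC HB m y h _ h3 (by linarith) (by linarith) (2*i+2) (by exact ⟨i+1, by ring⟩) hv.le
      refine ⟨lp', lm', h4.mono ?_ ?_ ?_ ?_⟩
      · refine le_of_eq ?_
        congr 2
        push_cast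
        field_simp
        ring
      · refine le_of_eq ?_
        congr 2
        push_cast
        field_simp
        ring
      · have e : 2*i+2+1 = 2*i+3 := rfl
        rw [e]
        set x := L^(2*i+3)/(2*i+3).factorial*v
        set x' := L^(2*(i+1)+3)/(2*(i+1)+3).factorial*v
        nlinarith
      · have e : 2*i+2+1 = 2*i+3 := rfl
        rw [e]
        set x := L^(2*i+3)/(2*i+3).factorial*v
        set x' := L^(2*(i+1)+3)/(2*(i+1)+3).factorial*v
        nlinarith

theorem sieve_gen (q L v C₁ : ℝ) (hq0 : 0 < q) (hq1 : q < 1) (hC : 2 ≤ C₁) (HB : HBk q L v C₁)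
    (hL0 : 0 < L) (hL : L^2 ≤ 1.06) (hv : 0 < v) (hε : L^5/120*v ≤ 0.027) (m : ℕ) (y : ℝ) (hy : C₁ ≤ y) :
    ∃ lp lm, SW (PP m y) lp lm ((∏ p ∈ PR 0 C₁, p : ℕ) * y^(4 + q*(4/(1-q)+2*q/(1-q)^2)))
      ((∏ p ∈ PR 0 C₁, p : ℕ) * y^(4 + q*(4/(1-q)+2*q/(1-q)^2)+1))
      ((1+1.03*(L^5/120*v))*(1+L^5/120*v)) (1-1.03*(L^5/120*v) - (1+1.03*(L^5/120*v))*(L^5/120*v)) := by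
  have hD : (0:ℝ) < (∏ p ∈ PR 0 C₁, p : ℕ) := by
    have : 0 < ∏ p ∈ PR 0 C₁, p := Finset.prod_pos (fun p hp => (mem_PR.1 hp).1.pos)
    exact_mod_cast this
  have hy1 : 1 ≤ y := by linarith
  have h1q : 1 < 1/q := by rw [lt_div_iff₀ hq0]; linarith
  obtain ⟨k, hk⟩ : ∃ k : ℕ, y^q < C₁^((1/q)^k) := by
    obtain ⟨n, hn⟩ := pow_unbounded_of_one_lt (y^q) (show (1:ℝ) < C₁ by linarith)
    obtain ⟨k, hk⟩ := pow_unbounded_of_one_lt (n:ℝ) h1q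
    refine ⟨k, hn.trans_le ?_⟩
    rw [← Real.rpow_natCast]
    exact Real.rpow_le_rpow_of_exponent_le (by linarith) hk.le
  obtain ⟨lp, lm, h⟩ := sched q L v C₁ hq0 hq1 hC HB hL0 hL hv hε k m (y^q) (Real.one_le_rpow hy1 hq0.le) hk 1 le_rfl
  have h0 : 0 < L^5/120*v := by positivity
  norm_num [Nat.factorial] at h
  obtain ⟨lp', lm', h'⟩ := sched_step q L v C₁ _ hq0 hq1 hD hC HB m y hy (4/(1-q)+2*q/(1-q)^2) (lp := lp) (lm := lm)
    (F := (1+1.03*(L^5/120*v))) (f := (1-1.03*(L^5/120*v))) (by convert h using 1 <;> norm_num) (by linarith) (by linarith) 4 (by decide) hv.le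
  refine ⟨lp', lm', ?_⟩
  norm_num [Nat.factorial] at h' ⊢
  exact h'


theorem hbk (q L v : ℝ) (hq0 : 0 < q) (hq1 : q < 1) (hL : Real.log (1/q) < L) (hv : 1/q < v) :
    ∃ C₁, 2 ≤ C₁ ∧ HBk q L v C₁ := by
  have h1q : 1 < 1/q := by rw [lt_div_iff₀ hq0]; linarith
  have hl : 0 < Real.log (v / (1/q)) := Real.log_pos (by rw [lt_div_iff₀ (by linarith)]; linarith)
  set δ := min (L - Real.log (1/q)) (Real.log (v / (1/q))) with hδ
  have hδ0 : 0 < δ := lt_min (by linarith) hl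
  obtain ⟨Y, hY, h⟩ := cd_main (1/q) δ h1q.le hδ0
  refine ⟨Y^(1/q), ?_, ?_⟩
  · calc (2:ℝ) ≤ Y := hY
      _ = Y^(1:ℝ) := (Real.rpow_one Y).symm
      _ ≤ _ := Real.rpow_le_rpow_of_exponent_le (by linarith) h1q.le
  · intro y hy B hB
    have hy0 : 0 < y := lt_of_lt_of_le (Real.rpow_pos_of_pos (by linarith) _) hy
    have hYy : Y ≤ y^q := by
      have := Real.rpow_le_rpow (Real.rpow_nonneg (by linarith) _) hy hq0.le
      rwa [← Real.rpow_mul (by linarith), one_div_mul_cancel hq0.ne', Real.rpow_one] at this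
    have := h (y^q) hYy B (by rwa [← Real.rpow_mul hy0.le, mul_one_div_cancel hq0.ne', Real.rpow_one])
    simp only [one_div] at this hδ ⊢
    constructor
    · have h2 := min_le_left (L - Real.log (q⁻¹)) (Real.log (v / q⁻¹))
      linarith [this.1]
    · refine this.2.trans ?_
      have h2 := min_le_right (L - Real.log (q⁻¹)) (Real.log (v / q⁻¹))
      have h3 : Real.exp δ ≤ v / q⁻¹ := by
        rw [hδ]
        calc _ ≤ Real.exp (Real.log (v / q⁻¹)) := Real.exp_le_exp.2 h2
          _ = _ := Real.exp_log (by have : 0 < v := by linarith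
                                    positivity)
      calc q⁻¹ * Real.exp δ ≤ q⁻¹ * (v / q⁻¹) := by gcongr
        _ = v := by field_simp

theorem num_up : Real.log (1/0.36) < 1.0225 := by
  rw [Real.log_lt_iff_lt_exp (by norm_num)]
  have : Real.exp 1.0225 = Real.exp 1 * Real.exp 0.0225 := by rw [← Real.exp_add]; norm_num
  rw [this]
  have h1 := Real.exp_one_gt_d9
  have h2 := Real.add_one_le_exp (0.0225:ℝ)
  nlinarith

theorem num_lo : Real.log (1/0.44) < 0.8215 := by
  rw [Real.log_lt_iff_lt_exp (by norm_num)]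
  have : Real.exp 0.8215 = Real.exp 1 * (Real.exp (-0.1785/64))^64 := by
    rw [← Real.exp_nat_mul, ← Real.exp_add]; norm_num
  rw [this]
  have h1 := Real.exp_one_gt_d9
  have h2 := Real.add_one_le_exp (-0.1785/64:ℝ)
  have h3 : (-0.1785/64 + 1:ℝ)^64 ≤ (Real.exp (-0.1785/64))^64 := pow_le_pow_left₀ (by norm_num) h2 64
  have h4 : (0.8363:ℝ) ≤ (-0.1785/64 + 1:ℝ)^64 := by norm_num
  nlinarith

theorem absorb (D e e' : ℝ) (he : e < e') : ∃ C : ℝ, 2 ≤ C ∧ ∀ y, C ≤ y → D * y^e ≤ y^e' := by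
  have h := (tendsto_rpow_atTop (show 0 < e' - e by linarith)).eventually_ge_atTop D
  obtain ⟨C, hC⟩ := Filter.eventually_atTop.1 h
  refine ⟨max 2 C, le_max_left _ _, fun y hy => ?_⟩
  have hy0 : 0 < y := by linarith [le_max_left 2 C]
  have := hC y (le_trans (le_max_right _ _) hy)
  have h2 : y^e' = y^(e'-e) * y^e := by rw [← Real.rpow_add hy0]; ring_nf
  rw [h2]
  have := Real.rpow_nonneg hy0.le e
  gcongr

theorem sieve_up : ∃ C : ℝ, 2 ≤ C ∧ ∀ m : ℕ, ∀ y, C ≤ y → ∃ lp lm, ∃ Dm f,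
    SW (PP m y) lp lm (y^(6.9:ℝ)) Dm 1.0535 f := by
  obtain ⟨C₁, hC, HB⟩ := hbk 0.36 1.0225 2.78 (by norm_num) (by norm_num) num_up (by norm_num)
  obtain ⟨C₂, hC2, h2⟩ := absorb (∏ p ∈ PR 0 C₁, p : ℕ) (4 + 0.36*(4/(1-0.36)+2*0.36/(1-0.36)^2)) 6.9 (by norm_num)
  refine ⟨max C₁ C₂, le_trans hC (le_max_left _ _), fun m y hy => ?_⟩
  obtain ⟨lp, lm, h⟩ := sieve_gen 0.36 1.0225 2.78 C₁ (by norm_num) (by norm_num) hC HB (by norm_num) (by norm_num)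
    (by norm_num) (by norm_num) m y (le_trans (le_max_left _ _) hy)
  exact ⟨lp, lm, _, _, h.mono (h2 y (le_trans (le_max_right _ _) hy)) le_rfl (by norm_num) le_rfl⟩

theorem sieve_lo : ∃ C : ℝ, 2 ≤ C ∧ ∀ m : ℕ, ∀ y, C ≤ y → ∃ lp lm, ∃ Dp F,
    SW (PP m y) lp lm Dp (y^(9.4:ℝ)) F 0.985 := by
  obtain ⟨C₁, hC, HB⟩ := hbk 0.44 0.8215 2.275 (by norm_num) (by norm_num) num_lo (by norm_num)
  obtain ⟨C₂, hC2, h2⟩ := absorb (∏ p ∈ PR 0 C₁, p : ℕ) (4 + 0.44*(4/(1-0.44)+2*0.44/(1-0.44)^2)+1) 9.4 (by norm_num)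
  refine ⟨max C₁ C₂, le_trans hC (le_max_left _ _), fun m y hy => ?_⟩
  obtain ⟨lp, lm, h⟩ := sieve_gen 0.44 0.8215 2.275 C₁ (by norm_num) (by norm_num) hC HB (by norm_num) (by norm_num)
    (by norm_num) (by norm_num) m y (le_trans (le_max_left _ _) hy)
  exact ⟨lp, lm, _, _, h.mono le_rfl (h2 y (le_trans (le_max_right _ _) hy)) le_rfl (by norm_num)⟩


noncomputable def Lam (p : ℕ) (P : Finset ℕ) (l : Finset ℕ → ℝ) (e : ℕ) : ℝ :=
  ∑ S ∈ P.powerset, if p * ∏ q ∈ S, q = e then l S else 0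

theorem lam_gen (p : ℕ) (P : Finset ℕ) (l : Finset ℕ → ℝ) (E : Finset ℕ) (k : ℕ → ℝ)
    (hE : ∀ S, S ⊆ P → l S ≠ 0 → p * ∏ q ∈ S, q ∈ E) :
    ∑ e ∈ E, Lam p P l e * k e = ∑ S ∈ P.powerset, l S * k (p * ∏ q ∈ S, q) := by
  unfold Lam
  simp only [Finset.sum_mul]
  rw [Finset.sum_comm]
  refine Finset.sum_congr rfl (fun S hS => ?_)
  by_cases h0 : l S = 0
  · simp [h0]
  · rw [Finset.sum_eq_single_of_mem _ (hE S (Finset.mem_powerset.1 hS) h0)]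
    · simp
    · intro e _ he
      rw [if_neg (Ne.symm he), zero_mul]

theorem lam_sum (p : ℕ) (P : Finset ℕ) (l : Finset ℕ → ℝ) (E : Finset ℕ) (n : ℕ) (hP : ∀ q ∈ P, q.Prime)
    (hp : ∀ q ∈ P, Nat.Coprime p q)
    (hE : ∀ S, S ⊆ P → l S ≠ 0 → p * ∏ q ∈ S, q ∈ E) :
    ∑ e ∈ E.filter (fun e => e ∣ n), Lam p P l e = if p ∣ n then ∑ S ∈ (P.filter (fun q => q ∣ n)).powerset, l S else 0 := by
  have h := lam_gen p P l E (fun e => if e ∣ n then 1 else 0) hE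
  have e1 : ∑ e ∈ E.filter (fun e => e ∣ n), Lam p P l e = ∑ e ∈ E, Lam p P l e * (if e ∣ n then 1 else 0) := by
    rw [Finset.sum_filter]
    refine Finset.sum_congr rfl (fun e _ => ?_)
    split_ifs <;> simp
  rw [e1, h]
  have hiff : ∀ S, S ⊆ P → ((p * ∏ q ∈ S, q ∣ n) ↔ (p ∣ n ∧ ∀ q ∈ S, q ∣ n)) := by
    intro S hS
    constructor
    · intro hd
      exact ⟨(Dvd.intro _ rfl).trans hd, fun q hq => (Finset.dvd_prod_of_mem _ hq).trans ((Dvd.intro_left _ rfl).trans hd)⟩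
    · rintro ⟨h1, h2⟩
      refine Nat.Coprime.mul_dvd_of_dvd_of_dvd ?_ h1 ?_
      · exact Nat.Coprime.prod_right (fun q hq => hp q (hS hq))
      · exact Finset.prod_primes_dvd n (fun q hq => (hP q (hS hq)).prime) h2
  by_cases hpn : p ∣ n
  · rw [if_pos hpn]
    have e2 : (P.filter (fun q => q ∣ n)).powerset = P.powerset.filter (fun S => ∀ q ∈ S, q ∣ n) := by
      ext S
      simp only [Finset.mem_powerset, Finset.mem_filter, Finset.subset_iff]
      constructor
      · intro h; exact ⟨fun q hq => (h hq).1, fun q hq => (h hq).2⟩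
      · rintro ⟨h1, h2⟩ q hq; exact ⟨h1 hq, h2 q hq⟩
    rw [e2, Finset.sum_filter]
    refine Finset.sum_congr rfl (fun S hS => ?_)
    have := hiff S (Finset.mem_powerset.1 hS)
    by_cases h3 : ∀ q ∈ S, q ∣ n
    · rw [if_pos (this.2 ⟨hpn, h3⟩), if_pos h3, mul_one]
    · rw [if_neg (fun h' => h3 (this.1 h').2), if_neg h3, mul_zero]
  · rw [if_neg hpn]
    refine Finset.sum_eq_zero (fun S hS => ?_)
    rw [if_neg (fun h' => hpn ((hiff S (Finset.mem_powerset.1 hS)).1 h').1), mul_zero]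

theorem lam_H (p : ℕ) (P : Finset ℕ) (l : Finset ℕ → ℝ) (E : Finset ℕ)
    (hE : ∀ S, S ⊆ P → l S ≠ 0 → p * ∏ q ∈ S, q ∈ E) :
    ∑ e ∈ E, Lam p P l e / e = (p:ℝ)⁻¹ * ∑ S ∈ P.powerset, l S * ∏ q ∈ S, (q:ℝ)⁻¹ := by
  have h := lam_gen p P l E (fun e => (e:ℝ)⁻¹) hE
  simp only [div_eq_mul_inv]
  rw [h, Finset.mul_sum]
  refine Finset.sum_congr rfl (fun S hS => ?_)
  push_cast
  rw [mul_inv, Finset.prod_inv_distrib]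
  ring

theorem lam_abs (p : ℕ) (hp : 1 ≤ p) (P : Finset ℕ) (hP : ∀ q ∈ P, q.Prime) (l : Finset ℕ → ℝ)
    (hl : ∀ S, S ⊆ P → |l S| ≤ 1) (e : ℕ) : |Lam p P l e| ≤ if p ∣ e then 1 else 0 := by
  unfold Lam
  refine (Finset.abs_sum_le_sum_abs _ _).trans ?_
  by_cases hpe : p ∣ e
  · rw [if_pos hpe]
    calc _ ≤ ∑ S ∈ P.powerset, (if S = (e/p).primeFactors then (1:ℝ) else 0) := by
          refine Finset.sum_le_sum (fun S hS => ?_)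
          have hS := Finset.mem_powerset.1 hS
          by_cases h : p * ∏ q ∈ S, q = e
          · rw [if_pos h]
            have : S = (e/p).primeFactors := by
              rw [← h, Nat.mul_div_cancel_left _ hp, Nat.primeFactors_prod (fun q hq => hP q (hS hq))]
            rw [if_pos this]
            exact hl S hS
          · rw [if_neg h, abs_zero]
            split_ifs <;> norm_num
      _ ≤ 1 := by
          rw [Finset.sum_ite_eq']
          split_ifs <;> norm_num
  · rw [if_neg hpe]
    refine (Finset.sum_eq_zero (fun S hS => ?_)).le
    rw [if_neg, abs_zero]
    rintro rfl
    exact hpe (Dvd.intro _ rfl)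

/-- nodes -/
def tq (i : ℕ) : ℚ := 1 + 793/100 * i / 60
def tauq (i : ℕ) : ℚ := min 1 ((94/10 - tq (i+1)) / (69/10))
def cq (i : ℕ) : ℚ := 1 - tq i / (893/100)

theorem num_sum : ∑ i ∈ Finset.range 60, cq i * (1.0535/tauq i) * (((tq (i+1)/tq i) - (tq i/tq (i+1)))/2 + 1/100000) * (1+2/100000) ≤ 1.735 := by
  decide +kernel

theorem num_misc : ∀ i ∈ Finset.range 60, 0 ≤ cq i ∧ cq i ≤ 1 ∧ 0 < tauq i ∧ tauq i ≤ 1 ∧ 1 ≤ tq i ∧ tq i < tq (i+1) ∧ 69/10 * tauq i + tq (i+1) ≤ 94/10 := by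
  decide +kernel


open Filter in
theorem rich_i (t t' τ δ : ℝ) (ht : 1 ≤ t) (htt : t < t') (hτ0 : 0 < τ) (hτ1 : τ ≤ 1) (hδ : 0 < δ) :
    ∀ᶠ z : ℝ in atTop, ∀ m : ℕ, ∃ lp lm, ∃ Dm f, SW (PP m (z^τ)) lp lm ((z^τ)^(6.9:ℝ)) Dm 1.0535 f ∧
      ∑ p ∈ (PR (z^t) (z^t')).filter (fun p => ¬ p ∣ m), (p:ℝ)⁻¹ ≤ Real.log (t'/t) + δ ∧
      ∏ p ∈ PP m (z^τ), (1 - (p:ℝ)⁻¹) ≤ (1/τ * Real.exp δ) * ∏ p ∈ PP m z, (1 - (p:ℝ)⁻¹) := by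
  obtain ⟨C, hC, h1⟩ := sieve_up
  have hρ : 1 ≤ t'/t := by rw [le_div_iff₀ (by linarith)]; linarith
  obtain ⟨Y, hY, h2⟩ := cd_main (t'/t) δ hρ hδ
  have hρ2 : 1 ≤ 1/τ := by rw [le_div_iff₀ hτ0]; linarith
  obtain ⟨Y', hY', h3⟩ := cd_main (1/τ) δ hρ2 hδ
  filter_upwards [(tendsto_rpow_atTop hτ0).eventually_ge_atTop C, (tendsto_rpow_atTop hτ0).eventually_ge_atTop Y',
    (tendsto_rpow_atTop (show 0 < t by linarith)).eventually_ge_atTop Y, eventually_ge_atTop (1:ℝ)] with z z1 z2 z3 z4 m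
  have hz0 : 0 < z := by linarith
  obtain ⟨lp, lm, Dm, f, h⟩ := h1 m (z^τ) z1
  refine ⟨lp, lm, Dm, f, h, ?_, ?_⟩
  · have := (h2 (z^t) z3 ((PR (z^t) (z^t')).filter (fun p => ¬ p ∣ m)) (by
      rw [← Real.rpow_mul hz0.le, mul_div_cancel₀ _ (by linarith)]
      exact Finset.filter_subset _ _)).1
    simpa only [one_div] using this
  · have hzz : z^τ ≤ z := by
      conv_rhs => rw [← Real.rpow_one z]
      exact Real.rpow_le_rpow_of_exponent_le z4 hτ1
    rw [PP_split m (z^τ) z hzz, Finset.prod_union (PP_disj m _ _)]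
    set B := (PR (z^τ) z).filter (fun p => ¬ p ∣ m) with hB
    have h4 := (h3 (z^τ) z2 B (by
      rw [← Real.rpow_mul hz0.le, mul_one_div_cancel hτ0.ne', Real.rpow_one]
      exact Finset.filter_subset _ _)).2
    simp only [one_div (_:ℝ)] at h4 ⊢
    have hV := V_pos B (fun p hp => (mem_PR.1 (Finset.mem_filter.1 hp).1).1)
    rw [inv_eq_one_div, div_le_iff₀ hV] at h4
    have := mul_le_mul_of_nonneg_right h4 (prod_V_nonneg (PP m (z^τ)))
    linarith

theorem log_le_sinh (x : ℝ) (hx : 1 ≤ x) : Real.log x ≤ (x - x⁻¹)/2 := by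
  rw [← Real.sinh_log (by linarith)]
  exact Real.self_le_sinh_iff.2 (Real.log_nonneg hx)

theorem div_filter (e : ℕ) (he : 1 ≤ e) (X : Finset ℕ) : X.filter (fun p => p ∣ e) ⊆ e.divisors := by
  intro p hp
  exact Nat.mem_divisors.2 ⟨(Finset.mem_filter.1 hp).2, Nat.one_le_iff_ne_zero.1 he⟩

open Filter in
theorem richert : ∀ᶠ z : ℝ in atTop, ∀ m D : ℕ, z^(9.4:ℝ) ≤ D → ∃ Lm : ℕ → ℝ,
    (∀ e, 1 ≤ e → |Lm e| ≤ 1 + e.divisors.card) ∧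
    (∀ n, 1 ≤ n → Nat.Coprime n m →
      ∑ e ∈ ((Finset.Icc 1 D).filter (fun e => Nat.Coprime e m)).filter (fun e => e ∣ n), Lm e ≤ 1 ∧
      (0 < ∑ e ∈ ((Finset.Icc 1 D).filter (fun e => Nat.Coprime e m)).filter (fun e => e ∣ n), Lm e →
        (∀ p, p.Prime → p ∣ n → z ≤ p) ∧ ∑ p ∈ n.primeFactors, (1 - Real.log p / (8.93 * Real.log z)) < 1.775)) ∧
    0.005 * ∏ p ∈ PP m z, (1 - (p:ℝ)⁻¹) ≤ ∑ e ∈ (Finset.Icc 1 D).filter (fun e => Nat.Coprime e m), Lm e / e := by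
  obtain ⟨C, hC, hlo⟩ := sieve_lo
  have hall : ∀ᶠ z : ℝ in atTop, ∀ i ∈ Finset.range 60, ∀ m : ℕ, ∃ lp lm, ∃ Dm f, SW (PP m (z^(tauq i:ℝ))) lp lm ((z^(tauq i:ℝ))^(6.9:ℝ)) Dm 1.0535 f ∧
      ∑ p ∈ (PR (z^(tq i:ℝ)) (z^(tq (i+1):ℝ))).filter (fun p => ¬ p ∣ m), (p:ℝ)⁻¹ ≤ Real.log ((tq (i+1):ℝ)/(tq i:ℝ)) + 1/100000 ∧
      ∏ p ∈ PP m (z^(tauq i:ℝ)), (1 - (p:ℝ)⁻¹) ≤ (1/(tauq i:ℝ) * Real.exp (1/100000)) * ∏ p ∈ PP m z, (1 - (p:ℝ)⁻¹) := by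
    rw [Filter.eventually_all_finset]
    intro i hi
    obtain ⟨_, _, h3, h4, h5, h6, _⟩ := num_misc i hi
    exact rich_i _ _ _ _ (by exact_mod_cast h5) (by exact_mod_cast h6) (by exact_mod_cast h3) (by exact_mod_cast h4) (by norm_num)
  filter_upwards [hall, eventually_ge_atTop C] with z hz hzC m D hD
  have hz2 : 2 ≤ z := hC.trans hzC
  have hz0 : 0 < z := by linarith
  obtain ⟨_, lm, _, _, hlm⟩ := hlo m z hzC
  have hz' : ∀ i, ∃ lp : Finset ℕ → ℝ, i ∈ Finset.range 60 → ∃ lm, ∃ Dm f, SW (PP m (z^(tauq i:ℝ))) lp lm ((z^(tauq i:ℝ))^(6.9:ℝ)) Dm 1.0535 f ∧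
      ∑ p ∈ (PR (z^(tq i:ℝ)) (z^(tq (i+1):ℝ))).filter (fun p => ¬ p ∣ m), (p:ℝ)⁻¹ ≤ Real.log ((tq (i+1):ℝ)/(tq i:ℝ)) + 1/100000 ∧
      ∏ p ∈ PP m (z^(tauq i:ℝ)), (1 - (p:ℝ)⁻¹) ≤ (1/(tauq i:ℝ) * Real.exp (1/100000)) * ∏ p ∈ PP m z, (1 - (p:ℝ)⁻¹) := by
    intro i
    by_cases hi : i ∈ Finset.range 60
    · obtain ⟨lp, h⟩ := hz i hi m
      exact ⟨lp, fun _ => h⟩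
    · exact ⟨fun _ => 0, fun h => absurd h hi⟩
  choose lp hlp using hz'
  set R : ℕ → Finset ℕ := fun i => (PR (z^(tq i:ℝ)) (z^(tq (i+1):ℝ))).filter (fun p => ¬ p ∣ m) with hR
  set E := (Finset.Icc 1 D).filter (fun e => Nat.Coprime e m) with hE
  have hRz : ∀ i ∈ Finset.range 60, ∀ p ∈ R i, p.Prime ∧ z ≤ p ∧ (p:ℝ) < z^(tq (i+1):ℝ) ∧ ¬ p ∣ m ∧ z^(tq i:ℝ) ≤ p := by
    intro i hi p hp
    obtain ⟨h1, h2⟩ := Finset.mem_filter.1 hp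
    obtain ⟨h3, h4, h5⟩ := mem_PR.1 h1
    obtain ⟨_, _, _, _, h6, _⟩ := num_misc i hi
    have h7 : (1:ℝ) ≤ (tq i:ℝ) := by exact_mod_cast h6
    refine ⟨h3, le_trans ?_ h4, h5, h2, h4⟩
    conv_lhs => rw [← Real.rpow_one z]
    exact Real.rpow_le_rpow_of_exponent_le (by linarith) h7
  have hPPi : ∀ i ∈ Finset.range 60, PP m (z^(tauq i:ℝ)) ⊆ PP m z := by
    intro i hi p hp
    obtain ⟨_, _, _, h4, _⟩ := num_misc i hi
    obtain ⟨h1, h2, h3⟩ := mem_PP.1 hp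
    refine mem_PP.2 ⟨h1, h2.trans_le ?_, h3⟩
    conv_rhs => rw [← Real.rpow_one z]
    exact Real.rpow_le_rpow_of_exponent_le (by linarith) (by exact_mod_cast h4)
  have hcopS : ∀ S, S ⊆ PP m z → Nat.Coprime (∏ q ∈ S, q) m ∧ 1 ≤ ∏ q ∈ S, q := by
    intro S hS
    constructor
    · refine Nat.Coprime.prod_left (fun q hq => ?_)
      obtain ⟨h1, _, h3⟩ := mem_PP.1 (hS hq)
      exact (Nat.Prime.coprime_iff_not_dvd h1).2 h3
    · exact Finset.prod_pos (fun q hq => (mem_PP.1 (hS hq)).1.pos)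
  -- membership
  have hE0 : ∀ S, S ⊆ PP m z → lm S ≠ 0 → 1 * ∏ q ∈ S, q ∈ E := by
    intro S hS hn
    rw [one_mul]
    refine Finset.mem_filter.2 ⟨Finset.mem_Icc.2 ⟨(hcopS S hS).2, ?_⟩, (hcopS S hS).1⟩
    have := hlm.dm S hS hn
    exact_mod_cast this.trans hD
  have hEi : ∀ i ∈ Finset.range 60, ∀ p ∈ R i, ∀ S, S ⊆ PP m (z^(tauq i:ℝ)) → lp i S ≠ 0 → p * ∏ q ∈ S, q ∈ E := by
    intro i hi p hp S hS hn
    obtain ⟨h1, h2, h3, h4, _⟩ := hRz i hi p hp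
    obtain ⟨hc1, hc2⟩ := hcopS S (hS.trans (hPPi i hi))
    obtain ⟨_, _, _, hsw, _, _⟩ := hlp i hi
    obtain ⟨_, _, _, _, _, _, h9⟩ := num_misc i hi
    refine Finset.mem_filter.2 ⟨Finset.mem_Icc.2 ⟨?_, ?_⟩, ?_⟩
    · exact Nat.mul_pos h1.pos hc2
    · have h5 := hsw.dp S hS hn
      have h6 : (p:ℝ) * ((∏ q ∈ S, q : ℕ):ℝ) ≤ z^(tq (i+1):ℝ) * (z^(tauq i:ℝ))^(6.9:ℝ) := by gcongr
      rw [← Real.rpow_mul hz0.le, ← Real.rpow_add hz0] at h6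
      have h7 : z^((tq (i+1):ℝ) + (tauq i:ℝ) * 6.9) ≤ z^(9.4:ℝ) := by
        refine Real.rpow_le_rpow_of_exponent_le (by linarith) ?_
        have : ((69/10 * tauq i + tq (i+1) : ℚ):ℝ) ≤ ((94/10:ℚ):ℝ) := by exact_mod_cast h9
        push_cast at this
        linarith
      exact_mod_cast (h6.trans h7).trans hD
    · exact Nat.Coprime.mul_left ((Nat.Prime.coprime_iff_not_dvd h1).2 h4) hc1
  have hPz : ∀ q ∈ PP m z, q.Prime := fun q hq => (mem_PP.1 hq).1
  have hPi : ∀ i ∈ Finset.range 60, ∀ q ∈ PP m (z^(tauq i:ℝ)), q.Prime := fun i hi q hq => hPz q (hPPi i hi hq)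
  have hcopp : ∀ i ∈ Finset.range 60, ∀ p ∈ R i, ∀ q ∈ PP m (z^(tauq i:ℝ)), Nat.Coprime p q := by
    intro i hi p hp q hq
    obtain ⟨h1, h2, _⟩ := hRz i hi p hp
    have h3 := mem_PP.1 (hPPi i hi hq)
    refine (Nat.coprime_primes h1 h3.1).2 ?_
    rintro rfl
    linarith [h3.2.1]
  refine ⟨fun e => Lam 1 (PP m z) lm e - 1/1.775 * ∑ i ∈ Finset.range 60, (cq i:ℝ) * ∑ p ∈ R i, Lam p (PP m (z^(tauq i:ℝ))) (lp i) e, ?_, ?_, ?_⟩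
  · intro e he
    have h1 := lam_abs 1 le_rfl (PP m z) hPz lm hlm.am e
    rw [if_pos (one_dvd e)] at h1
    have h2 : |∑ i ∈ Finset.range 60, (cq i:ℝ) * ∑ p ∈ R i, Lam p (PP m (z^(tauq i:ℝ))) (lp i) e| ≤ e.divisors.card := by
      have hdis : ∀ i ∈ Finset.range 60, ∀ j ∈ Finset.range 60, i ≠ j → Disjoint (R i) (R j) := by
        have key : ∀ i ∈ Finset.range 60, ∀ j ∈ Finset.range 60, i < j → Disjoint (R i) (R j) := by
          intro i hi j hj hij
          rw [Finset.disjoint_left]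
          intro p hp hq
          have h3 := (hRz i hi p hp).2.2.1
          have h4 := (hRz j hj p hq).2.2.2.2
          have h5 : tq (i+1) ≤ tq j := by
            unfold tq
            have : ((i+1:ℕ):ℚ) ≤ j := by exact_mod_cast hij
            gcongr
          have h6 : z^(tq (i+1):ℝ) ≤ z^(tq j:ℝ) := Real.rpow_le_rpow_of_exponent_le (by linarith) (by exact_mod_cast h5)
          linarith
        intro i hi j hj hij
        rcases lt_or_gt_of_ne hij with h | h
        · exact key i hi j hj h
        · exact (key j hj i hi h).symm
      calc _ ≤ ∑ i ∈ Finset.range 60, |(cq i:ℝ) * ∑ p ∈ R i, Lam p (PP m (z^(tauq i:ℝ))) (lp i) e| := Finset.abs_sum_le_sum_abs _ _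
        _ ≤ ∑ i ∈ Finset.range 60, ∑ p ∈ R i, (if p ∣ e then (1:ℝ) else 0) := by
            refine Finset.sum_le_sum (fun i hi => ?_)
            obtain ⟨hc0, hc1, _⟩ := num_misc i hi
            obtain ⟨_, _, _, hsw, _, _⟩ := hlp i hi
            rw [abs_mul, abs_of_nonneg (show (0:ℝ) ≤ (cq i:ℝ) by exact_mod_cast hc0)]
            have h3 : |∑ p ∈ R i, Lam p (PP m (z^(tauq i:ℝ))) (lp i) e| ≤ ∑ p ∈ R i, (if p ∣ e then (1:ℝ) else 0) := by
              refine (Finset.abs_sum_le_sum_abs _ _).trans (Finset.sum_le_sum (fun p hp => ?_))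
              exact lam_abs p (hRz i hi p hp).1.one_lt.le _ (hPi i hi) _ hsw.ap e
            calc _ ≤ 1 * |∑ p ∈ R i, Lam p (PP m (z^(tauq i:ℝ))) (lp i) e| := by
                  gcongr
                  exact_mod_cast hc1
              _ ≤ _ := by rw [one_mul]; exact h3
        _ = ∑ p ∈ (Finset.range 60).biUnion R, (if p ∣ e then (1:ℝ) else 0) := by
            rw [Finset.sum_biUnion]
            intro i hi j hj hij
            exact hdis i hi j hj hij
        _ = ((((Finset.range 60).biUnion R).filter (fun p => p ∣ e)).card : ℝ) := by
            rw [Finset.sum_boole]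
        _ ≤ _ := by
            have := div_filter e he ((Finset.range 60).biUnion R)
            exact_mod_cast Finset.card_le_card this
    have hd0 : (0:ℝ) ≤ e.divisors.card := by positivity
    set X := ∑ i ∈ Finset.range 60, (cq i:ℝ) * ∑ p ∈ R i, Lam p (PP m (z^(tauq i:ℝ))) (lp i) e
    rw [abs_le] at h1 h2 ⊢
    constructor
    · norm_num; linarith
    · norm_num; linarith
  · intro n hn hnm
    have hsum : ∑ e ∈ E.filter (fun e => e ∣ n), (Lam 1 (PP m z) lm e - 1/1.775 * ∑ i ∈ Finset.range 60, (cq i:ℝ) * ∑ p ∈ R i, Lam p (PP m (z^(tauq i:ℝ))) (lp i) e)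
       = ∑ S ∈ ((PP m z).filter (fun q => q ∣ n)).powerset, lm S - 1/1.775 * ∑ i ∈ Finset.range 60, (cq i:ℝ) * ∑ p ∈ R i, if p ∣ n then ∑ S ∈ ((PP m (z^(tauq i:ℝ))).filter (fun q => q ∣ n)).powerset, lp i S else 0 := by
      rw [Finset.sum_sub_distrib, lam_sum 1 _ lm E n hPz (fun q _ => Nat.coprime_one_left q) hE0, if_pos (one_dvd n), ← Finset.mul_sum, Finset.sum_comm]
      congr 2
      refine Finset.sum_congr rfl (fun i hi => ?_)
      rw [← Finset.mul_sum, Finset.sum_comm]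
      congr 1
      refine Finset.sum_congr rfl (fun p hp => ?_)
      exact lam_sum p _ _ E n (hPi i hi) (hcopp i hi p hp) (hEi i hi p hp)
    rw [hsum]
    have hA := hlm.sm ((PP m z).filter (fun q => q ∣ n)) (Finset.filter_subset _ _)
    have hBlow : ∀ i ∈ Finset.range 60, (if (PP m z).filter (fun q => q ∣ n) = ∅ then (1:ℝ) else 0) ≤
        ∑ S ∈ ((PP m (z^(tauq i:ℝ))).filter (fun q => q ∣ n)).powerset, lp i S := by
      intro i hi
      obtain ⟨_, _, _, hsw, _, _⟩ := hlp i hi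
      refine le_trans ?_ (hsw.sp ((PP m (z^(tauq i:ℝ))).filter (fun q => q ∣ n)) (Finset.filter_subset _ _))
      by_cases h : (PP m z).filter (fun q => q ∣ n) = ∅
      · have : (PP m (z^(tauq i:ℝ))).filter (fun q => q ∣ n) = ∅ := by
          rw [← Finset.subset_empty, ← h]
          exact Finset.filter_subset_filter _ (hPPi i hi)
        rw [if_pos h, if_pos this]
      · rw [if_neg h]
        split_ifs <;> norm_num
    have hsub : ∑ i ∈ Finset.range 60, (cq i:ℝ) * ∑ p ∈ R i, (if p ∣ n then (if (PP m z).filter (fun q => q ∣ n) = ∅ then (1:ℝ) else 0) else 0) ≤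
        ∑ i ∈ Finset.range 60, (cq i:ℝ) * ∑ p ∈ R i, if p ∣ n then ∑ S ∈ ((PP m (z^(tauq i:ℝ))).filter (fun q => q ∣ n)).powerset, lp i S else 0 := by
      refine Finset.sum_le_sum (fun i hi => ?_)
      obtain ⟨hc0, hc1, _⟩ := num_misc i hi
      refine mul_le_mul_of_nonneg_left ?_ (by exact_mod_cast hc0)
      refine Finset.sum_le_sum (fun p hp => ?_)
      by_cases hpn : p ∣ n
      · rw [if_pos hpn, if_pos hpn]; exact hBlow i hi
      · rw [if_neg hpn, if_neg hpn]
    have hnon : 0 ≤ ∑ i ∈ Finset.range 60, (cq i:ℝ) * ∑ p ∈ R i, (if p ∣ n then (if (PP m z).filter (fun q => q ∣ n) = ∅ then (1:ℝ) else 0) else 0) := by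
      refine Finset.sum_nonneg (fun i hi => ?_)
      obtain ⟨hc0, hc1, _⟩ := num_misc i hi
      refine mul_nonneg (by exact_mod_cast hc0) (Finset.sum_nonneg (fun p _ => ?_))
      split_ifs <;> norm_num
    set X := ∑ i ∈ Finset.range 60, (cq i:ℝ) * ∑ p ∈ R i, if p ∣ n then ∑ S ∈ ((PP m (z^(tauq i:ℝ))).filter (fun q => q ∣ n)).powerset, lp i S else 0
    constructor
    · have : (if (PP m z).filter (fun q => q ∣ n) = ∅ then (1:ℝ) else 0) ≤ 1 := by split_ifs <;> norm_num
      norm_num; linarith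
    · intro hpos
      by_cases h : (PP m z).filter (fun q => q ∣ n) = ∅
      swap
      · rw [if_neg h] at hA
        exfalso
        have h0 : 0 ≤ 1/1.775 * X := mul_nonneg (by norm_num) (hnon.trans hsub)
        linarith
      rw [if_pos h] at hA hsub
      have hall : ∀ p, p.Prime → p ∣ n → z ≤ p := by
        intro p hp hpn
        by_contra hlt
        push Not at hlt
        have : p ∈ (PP m z).filter (fun q => q ∣ n) := by
          refine Finset.mem_filter.2 ⟨mem_PP.2 ⟨hp, hlt, fun hpm => ?_⟩, hpn⟩
          have := Nat.dvd_gcd hpn hpm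
          rw [hnm] at this
          exact hp.one_lt.ne' (Nat.dvd_one.1 this)
        rw [h] at this
        exact absurd this (Finset.notMem_empty p)
      refine ⟨hall, ?_⟩
      have hX : X < 1.775 := by
        have : 1/1.775 * X < 1 := by linarith
        norm_num at this ⊢
        linarith
      refine lt_of_le_of_lt (le_trans ?_ hsub) hX
      -- sum over prime factors
      have hlz : 0 < Real.log z := Real.log_pos (by linarith)
      have hpt : ∀ p ∈ n.primeFactors, 1 - Real.log p / (8.93 * Real.log z) ≤ ∑ i ∈ Finset.range 60, (cq i:ℝ) * (if p ∈ R i then 1 else 0) := by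
        intro p hp
        have hpp := Nat.prime_of_mem_primeFactors hp
        have hpn := Nat.dvd_of_mem_primeFactors hp
        have hzp := hall p hpp hpn
        have hp0 : (0:ℝ) < p := by linarith
        have hnn : ∀ i ∈ Finset.range 60, 0 ≤ (cq i:ℝ) * (if p ∈ R i then 1 else 0) := by
          intro i hi
          obtain ⟨hc0, hc1, _⟩ := num_misc i hi
          refine mul_nonneg (by exact_mod_cast hc0) ?_
          split_ifs <;> norm_num
        rcases lt_or_ge (p:ℝ) (z^(8.93:ℝ)) with hlt | hge
        · set u := Real.log p / Real.log z with hu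
          have hpu : (p:ℝ) = z^u := by
            rw [Real.rpow_def_of_pos hz0, hu, mul_div_cancel₀ _ hlz.ne', Real.exp_log hp0]
          have hu1 : 1 ≤ u := by
            rw [hu, le_div_iff₀ hlz, one_mul]
            exact Real.log_le_log hz0 hzp
          have hu2 : u < 8.93 := by
            rw [hpu] at hlt
            exact (Real.rpow_lt_rpow_left_iff (by linarith)).1 hlt
          set i := ⌊(u-1)*60/7.93⌋₊ with hi
          have hi0 : 0 ≤ (u-1)*60/7.93 := by
            have : 0 ≤ u - 1 := by linarith
            positivity
          have hi1 := Nat.floor_le hi0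
          have hi2 := Nat.lt_floor_add_one ((u-1)*60/7.93)
          rw [← hi] at hi1 hi2
          have hi60 : i ∈ Finset.range 60 := by
            rw [Finset.mem_range, hi, Nat.floor_lt hi0]
            norm_num
            linarith
          have ht1 : (tq i:ℝ) ≤ u := by
            unfold tq
            push_cast
            rw [le_div_iff₀ (by norm_num)] at hi1
            linarith
          have ht2 : u < (tq (i+1):ℝ) := by
            unfold tq
            push_cast
            rw [div_lt_iff₀ (by norm_num)] at hi2
            linarith
          have hpR : p ∈ R i := by
            refine Finset.mem_filter.2 ⟨mem_PR.2 ⟨hpp, ?_, ?_⟩, fun hpm => ?_⟩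
            · rw [hpu]; exact Real.rpow_le_rpow_of_exponent_le (by linarith) ht1
            · rw [hpu]; exact Real.rpow_lt_rpow_of_exponent_lt (by linarith) ht2
            · have := Nat.dvd_gcd hpn hpm
              rw [hnm] at this
              exact hpp.one_lt.ne' (Nat.dvd_one.1 this)
          refine le_trans ?_ (Finset.single_le_sum hnn hi60)
          rw [if_pos hpR, mul_one]
          unfold cq
          push_cast
          have : Real.log p / (8.93 * Real.log z) = u / 8.93 := by
            rw [hu]; field_simp
          rw [this]
          norm_num
          linarith
        · refine le_trans ?_ (Finset.sum_nonneg hnn)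
          have : 8.93 * Real.log z ≤ Real.log p := by
            rw [← Real.log_rpow hz0]
            exact Real.log_le_log (Real.rpow_pos_of_pos hz0 _) hge
          have : 1 ≤ Real.log p / (8.93 * Real.log z) := by
            rw [le_div_iff₀ (by positivity), one_mul]; exact this
          linarith
      refine (Finset.sum_le_sum hpt).trans (le_of_eq ?_)
      rw [Finset.sum_comm]
      refine Finset.sum_congr rfl (fun i hi => ?_)
      rw [← Finset.mul_sum]
      congr 1
      rw [← Finset.sum_filter, ← Finset.sum_filter]
      have : n.primeFactors.filter (fun p => p ∈ R i) = (R i).filter (fun p => p ∣ n) := by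
        ext p
        simp only [Finset.mem_filter]
        constructor
        · rintro ⟨h1, h2⟩; exact ⟨h2, Nat.dvd_of_mem_primeFactors h1⟩
        · rintro ⟨h1, h2⟩; exact ⟨Nat.mem_primeFactors.2 ⟨(hRz i hi p h1).1, h2, Nat.one_le_iff_ne_zero.1 hn⟩, h1⟩
      rw [this]
  · have hVz := prod_V_nonneg (PP m z)
    have hsum : ∑ e ∈ E, (Lam 1 (PP m z) lm e - 1/1.775 * ∑ i ∈ Finset.range 60, (cq i:ℝ) * ∑ p ∈ R i, Lam p (PP m (z^(tauq i:ℝ))) (lp i) e) / (e:ℝ)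
       = ∑ S ∈ (PP m z).powerset, lm S * ∏ q ∈ S, (q:ℝ)⁻¹ - 1/1.775 * ∑ i ∈ Finset.range 60, (cq i:ℝ) * ∑ p ∈ R i, (p:ℝ)⁻¹ * ∑ S ∈ (PP m (z^(tauq i:ℝ))).powerset, lp i S * ∏ q ∈ S, (q:ℝ)⁻¹ := by
      have h0 := lam_H 1 (PP m z) lm E hE0
      simp only [sub_div, mul_div_assoc, Finset.sum_div]
      rw [Finset.sum_sub_distrib, h0, ← Finset.mul_sum, Finset.sum_comm]
      rw [Nat.cast_one, inv_one, one_mul]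
      congr 2
      refine Finset.sum_congr rfl (fun i hi => ?_)
      rw [← Finset.mul_sum, Finset.sum_comm]
      congr 1
      refine Finset.sum_congr rfl (fun p hp => ?_)
      exact lam_H p _ _ E (hEi i hi p hp)
    rw [hsum]
    have hvm := hlm.vm
    set V := ∏ p ∈ PP m z, (1 - (p:ℝ)⁻¹) with hV
    have hexp : Real.exp (1/100000) ≤ 1 + 2/100000 := by
      have := Real.abs_exp_sub_one_le (x := 1/100000) (by norm_num [abs_of_pos])
      rw [abs_le] at this
      have h2 := this.2
      rw [abs_of_pos (by norm_num)] at h2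
      linarith
    have hterm : ∀ i ∈ Finset.range 60, (cq i:ℝ) * ∑ p ∈ R i, (p:ℝ)⁻¹ * ∑ S ∈ (PP m (z^(tauq i:ℝ))).powerset, lp i S * ∏ q ∈ S, (q:ℝ)⁻¹
       ≤ (((cq i * (1.0535/tauq i) * (((tq (i+1)/tq i) - (tq i/tq (i+1)))/2 + 1/100000) * (1+2/100000)) : ℚ) : ℝ) * V := by
      intro i hi
      obtain ⟨_, _, _, hsw, h2, h3⟩ := hlp i hi
      obtain ⟨g1, g2, g3, g4, g5, g6, _⟩ := num_misc i hi
      have g1' : (0:ℝ) ≤ (cq i:ℝ) := by exact_mod_cast g1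
      have g3' : (0:ℝ) < (tauq i:ℝ) := by exact_mod_cast g3
      have g5' : (1:ℝ) ≤ (tq i:ℝ) := by exact_mod_cast g5
      have g6' : (tq i:ℝ) < (tq (i+1):ℝ) := by exact_mod_cast g6
      have h4 := hsw.vp
      have hx : 1 ≤ (tq (i+1):ℝ)/(tq i:ℝ) := by rw [le_div_iff₀ (by linarith)]; linarith
      have h5 := log_le_sinh _ hx
      rw [inv_div] at h5
      have h6 : 0 ≤ (((tq (i+1):ℝ)/(tq i:ℝ)) - ((tq i:ℝ)/(tq (i+1):ℝ)))/2 := (Real.log_nonneg hx).trans h5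
      rw [← Finset.sum_mul]
      have hs0 : 0 ≤ ∑ p ∈ R i, (p:ℝ)⁻¹ := Finset.sum_nonneg (fun p _ => by positivity)
      have h7 : ∑ S ∈ (PP m (z^(tauq i:ℝ))).powerset, lp i S * ∏ q ∈ S, (q:ℝ)⁻¹ ≤ 1.0535 * ((1/(tauq i:ℝ) * (1+2/100000)) * V) := by
        refine h4.trans ?_
        refine mul_le_mul_of_nonneg_left (h3.trans ?_) (by norm_num)
        gcongr
      calc (cq i:ℝ) * ((∑ p ∈ R i, (p:ℝ)⁻¹) * ∑ S ∈ (PP m (z^(tauq i:ℝ))).powerset, lp i S * ∏ q ∈ S, (q:ℝ)⁻¹)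
          ≤ (cq i:ℝ) * ((∑ p ∈ R i, (p:ℝ)⁻¹) * (1.0535 * ((1/(tauq i:ℝ) * (1+2/100000)) * V))) := by gcongr
        _ ≤ (cq i:ℝ) * (((((tq (i+1):ℝ)/(tq i:ℝ)) - ((tq i:ℝ)/(tq (i+1):ℝ)))/2 + 1/100000) * (1.0535 * ((1/(tauq i:ℝ) * (1+2/100000)) * V))) := by
            refine mul_le_mul_of_nonneg_left (mul_le_mul_of_nonneg_right (h2.trans (by linarith)) (by positivity)) g1'
        _ = _ := by push_cast; ring
    have htot := Finset.sum_le_sum hterm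
    rw [← Finset.sum_mul] at htot
    have hq : (((∑ i ∈ Finset.range 60, cq i * (1.0535/tauq i) * (((tq (i+1)/tq i) - (tq i/tq (i+1)))/2 + 1/100000) * (1+2/100000)) : ℚ) : ℝ) ≤ ((1.735:ℚ):ℝ) := by
      exact_mod_cast num_sum
    rw [Rat.cast_sum] at hq
    have h8 := mul_le_mul_of_nonneg_right hq hVz
    have h9 := htot.trans h8
    push_cast at h9
    norm_num at h9 hvm ⊢
    linarith


theorem telesc (K : ℕ) (hK : 1 ≤ K) : ∏ n ∈ Finset.Icc 2 K, (1 - (n:ℝ)⁻¹) = (K:ℝ)⁻¹ := by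
  induction K, hK using Nat.le_induction with
  | base => simp
  | succ K hK ih =>
    rw [Finset.prod_Icc_succ_top (by omega), ih]
    have : (0:ℝ) < K := by exact_mod_cast hK
    push_cast
    field_simp
    ring

theorem V_triv (m : ℕ) (y : ℝ) (hy : 1 ≤ y) : y⁻¹ ≤ ∏ p ∈ PP m y, (1 - (p:ℝ)⁻¹) := by
  have hK : 1 ≤ ⌊y⌋₊ := Nat.one_le_iff_ne_zero.2 (by rw [Ne, Nat.floor_eq_zero]; linarith)
  have hsub : PP m y ⊆ Finset.Icc 2 ⌊y⌋₊ := by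
    intro p hp
    obtain ⟨h1, h2, _⟩ := mem_PP.1 hp
    exact Finset.mem_Icc.2 ⟨h1.two_le, Nat.le_floor h2.le⟩
  have h1 := telesc _ hK
  have hfy := Nat.floor_le (show 0 ≤ y by linarith)
  have hK0 : (0:ℝ) < ⌊y⌋₊ := by exact_mod_cast hK
  calc y⁻¹ ≤ ((⌊y⌋₊:ℕ):ℝ)⁻¹ := by gcongr
    _ = _ := h1.symm
    _ = (∏ n ∈ Finset.Icc 2 ⌊y⌋₊ \ PP m y, (1 - (n:ℝ)⁻¹)) * ∏ p ∈ PP m y, (1 - (p:ℝ)⁻¹) := (Finset.prod_sdiff hsub).symm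
    _ ≤ 1 * ∏ p ∈ PP m y, (1 - (p:ℝ)⁻¹) := by
        refine mul_le_mul_of_nonneg_right ?_ (prod_V_nonneg _)
        refine Finset.prod_le_one (fun p _ => by linarith [Nat.cast_inv_le_one p (α := ℝ)]) (fun p _ => ?_)
        have : (0:ℝ) ≤ (p:ℝ)⁻¹ := by positivity
        linarith
    _ = _ := one_mul _

open Filter in
theorem V_low (θ : ℝ) (hθ : 0 < θ) (hθ1 : θ ≤ 1) : ∀ᶠ z : ℝ in atTop, ∀ m : ℕ, z^(-θ) ≤ ∏ p ∈ PP m z, (1 - (p:ℝ)⁻¹) := by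
  have h := rich_i 1 2 (θ/2) 1 le_rfl (by norm_num) (by linarith) (by linarith) one_pos
  filter_upwards [h, eventually_ge_atTop (1:ℝ), (tendsto_rpow_atTop (show 0 < θ/2 by linarith)).eventually_ge_atTop (1/(θ/2) * Real.exp 1)] with z hz hz1 hz2 m
  obtain ⟨_, _, _, _, _, _, h3⟩ := hz m
  have hz0 : 0 < z := by linarith
  have h4 := V_triv m (z^(θ/2)) (Real.one_le_rpow hz1 (by linarith))
  have h5 := h4.trans h3
  have h6 : (z^(θ/2))⁻¹ ≤ z^(θ/2) * ∏ p ∈ PP m z, (1 - (p:ℝ)⁻¹) :=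
    h5.trans (mul_le_mul_of_nonneg_right hz2 (prod_V_nonneg _))
  have hpz : 0 < z^(θ/2) := Real.rpow_pos_of_pos hz0 _
  have h7 : z^(-θ) = (z^(θ/2))⁻¹ / z^(θ/2) := by
    rw [← Real.rpow_neg hz0.le, ← Real.rpow_sub hz0]; ring_nf
  rw [h7, div_le_iff₀ hpz]
  linarith

theorem rp_mul {X A B a b : ℝ} (hX : 0 < X) (hB0 : 0 ≤ B) (hA : A ≤ X^a) (hB : B ≤ X^b) : A * B ≤ X^(a+b) := by
  rw [Real.rpow_add hX]
  exact mul_le_mul hA hB hB0 (Real.rpow_nonneg hX.le _)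

theorem rp_sq {X A a : ℝ} (hX : 0 < X) (hA0 : 0 ≤ A) (hA : A ≤ X^a) : A^2 ≤ X^(2*a) := by
  have := rp_mul hX hA0 hA hA
  rw [← two_mul] at this
  rw [pow_two]; exact this

theorem rp_cube {X A a : ℝ} (hX : 0 < X) (hA0 : 0 ≤ A) (hA : A ≤ X^a) : A^3 ≤ X^(3*a) := by
  have := rp_mul hX hA0 (rp_sq hX hA0 hA) hA
  have e : 2*a+a = 3*a := by ring
  rw [e] at this
  rw [pow_succ]; exact this

theorem rp_sqrt {X A a : ℝ} (hX : 0 < X) (hA : A ≤ X^a) : √A ≤ X^(a/2) := by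
  have h := Real.sqrt_le_sqrt hA
  rwa [Real.sqrt_eq_rpow (X^a), ← Real.rpow_mul hX.le, mul_one_div] at h

theorem rp_mono {X A a b : ℝ} (hX : 1 ≤ X) (hA : A ≤ X^a) (h : a ≤ b) : A ≤ X^b :=
  hA.trans (Real.rpow_le_rpow_of_exponent_le hX h)

theorem rp_add {X A B a ε : ℝ} (hX : 0 < X) (h2 : 32 ≤ X^ε) (hA : A ≤ X^a) (hB : B ≤ X^a) : A + B ≤ X^(a+ε) := by
  rw [Real.rpow_add hX]
  have := Real.rpow_pos_of_pos hX a
  nlinarith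

theorem rp_div {X A a : ℝ} (hX : 0 < X) (hA : A ≤ X^a) : A / X ≤ X^(a-1) := by
  rw [Real.rpow_sub hX, Real.rpow_one]
  gcongr

theorem rp_junk (X α γ ω ε ε₁ : ℝ) (hX : 1 ≤ X) (hε : 0 < ε) (hα : 1/2 ≤ α) (hi : 2 ≤ 2*α+ω+γ)
    (hω : 0 ≤ ω) (hγ : 0 ≤ γ) (hε₁ : 0 < ε₁)
    (N P Q Q₀ M W J T : ℝ) (hN : N ≤ X^α) (hN0 : 0 ≤ N) (hP : P ≤ N) (hP0 : 0 ≤ P) (hQ : Q ≤ Q₀) (hQ0 : 0 ≤ Q) (hQ1 : Q₀ ≤ X^ω)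
    (hM0 : 0 ≤ M) (hM : M ≤ X^γ) (hW0 : 0 ≤ W) (hW : W ≤ X^ε) (hJ0 : 0 ≤ J) (hJ : J ≤ X^ε)
    (hT0 : 0 ≤ T) (hT : T ≤ X^(γ-ε₁+ε)) (h32 : 32 ≤ X^ε) :
    N * P * Q * T / X + √(32 * J^2 * W^2 * N^2 * Q₀ * T * (Q₀ * M / X + 1)) ≤ X^(2*α+ω+γ-1-ε₁/2+5*ε) := by
  have h0 : 0 < X := by linarith
  have hQ00 : 0 ≤ Q₀ := hQ0.trans hQ
  have h1 : N * P * Q * T / X ≤ X^(2*α+ω+γ-1-ε₁/2+4*ε) := by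
    have := rp_div h0 (rp_mul h0 hT0 (rp_mul h0 hQ0 (rp_mul h0 hP0 hN (hP.trans hN)) (hQ.trans hQ1)) hT)
    exact rp_mono hX this (by linarith)
  have h2 : Q₀ * M / X + 1 ≤ X^(2*α+ω+γ-2+ε) := by
    refine rp_add h0 h32 ?_ ?_
    · exact rp_mono hX (rp_div h0 (rp_mul h0 hM0 hQ1 hM)) (by linarith)
    · exact Real.one_le_rpow hX (by linarith)
  have h3 : √(32 * J^2 * W^2 * N^2 * Q₀ * T * (Q₀ * M / X + 1)) ≤ X^(2*α+ω+γ-1-ε₁/2+4*ε) := by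
    have := rp_sqrt h0 (rp_mul h0 (by positivity) (rp_mul h0 hT0 (rp_mul h0 hQ00 (rp_mul h0 (by positivity) (rp_mul h0 (by positivity) (rp_mul h0 (by positivity) h32 (rp_sq h0 hJ0 hJ)) (rp_sq h0 hW0 hW)) (rp_sq h0 hN0 hN)) hQ1) hT) h2)
    exact rp_mono hX this (by linarith)
  have := rp_add h0 h32 h1 h3
  exact rp_mono hX this (by linarith)

theorem cg_ineq (X α γ ω lam ε ε₁ : ℝ) (hX : 1 ≤ X) (hε : 0 < ε) (hα : 1/2 ≤ α)
    (hω : 0 ≤ ω) (hγ : 0 ≤ γ) (hε₁ : 0 < ε₁) (hεε : 60 * ε ≤ ε₁) (hε₁1 : ε₁ ≤ 1/2)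
    (i1 : 2 + 4*ε₁ ≤ 2*α+ω+γ) (i2 : lam + 4*ε₁ ≤ α+γ-1) (i3 : lam + 4*ε₁ ≤ 2*γ+α+ω-2) (i4 : 2*lam + 4*ε₁ ≤ 2*γ-1)
    (N P Q Q₀ M D W J C G T H η L : ℝ) (hN : N ≤ X^α) (hN0 : 0 ≤ N) (hP : P ≤ N) (hPl : X^(α-ε) ≤ P) (hQ : Q ≤ Q₀) (hQl : X^(ω-ε) ≤ Q) (hQ1 : Q₀ ≤ X^ω)
    (hMl : X^(γ-ε) ≤ M) (hM : M ≤ X^γ) (hD0 : 0 ≤ D) (hD : D ≤ X^(lam+ε)) (hW0 : 0 ≤ W) (hW : W ≤ X^ε) (hJ0 : 0 ≤ J) (hJ : J ≤ X^ε)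
    (hC0 : 0 ≤ C) (hC : C ≤ X^(2*ε)) (hG : G ≤ X^(ε₁+ε)) 
    (hT0 : 0 ≤ T) (hT : T ≤ X^(γ-ε₁+ε)) (hH0 : 0 ≤ H) (hH : H ≤ X^ε) (hη0 : 0 ≤ η) (hη : η ≤ X^(-ε₁))
    (hL : 0.005 * X^(-ε) ≤ L) (h32 : 200 ≤ X^ε) :
    G * √(16 * J^2 * C^2 * W^3 * N^2 * Q₀ * (D * N + M) * (N * Q₀ * D / X + 1))
      + C * W * (N * P * Q * T / X + √(32 * J^2 * W^2 * N^2 * Q₀ * T * (Q₀ * M / X + 1)))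
      + C * P^2 * Q / X * (η * M * H + D)
      + (N * P * Q * T / X + √(32 * J^2 * W^2 * N^2 * Q₀ * T * (Q₀ * M / X + 1))) < P^2 * Q * (M / X) * L := by
  have h0 : 0 < X := by linarith
  have hP0 : 0 ≤ P := (Real.rpow_nonneg h0.le _).trans hPl
  have hQ0 : 0 ≤ Q := (Real.rpow_nonneg h0.le _).trans hQl
  have hM0 : 0 ≤ M := (Real.rpow_nonneg h0.le _).trans hMl
  have hQ00 : 0 ≤ Q₀ := hQ0.trans hQ
  have h33 : 32 ≤ X^ε := by linarith
  have hj := rp_junk X α γ ω ε ε₁ hX hε hα (by linarith) hω hγ hε₁ N P Q Q₀ M W J T hN hN0 hP hP0 hQ hQ0 hQ1 hM0 hM hW0 hW hJ0 hJ hT0 hT h33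
  set jk := N * P * Q * T / X + √(32 * J^2 * W^2 * N^2 * Q₀ * T * (Q₀ * M / X + 1)) with hjk
  have hjk0 : 0 ≤ jk := by positivity
  set B := 2*α+ω+γ-1-ε₁/2+8*ε with hB
  have e4 : jk ≤ X^B := rp_mono hX hj (by linarith)
  have e2 : C * W * jk ≤ X^B := rp_mono hX (rp_mul h0 hjk0 (rp_mul h0 hW0 hC hW) hj) (by linarith)
  have e3 : C * P^2 * Q / X * (η * M * H + D) ≤ X^B := by
    have h1 := rp_div h0 (rp_mul h0 hQ0 (rp_mul h0 (by positivity) hC (rp_sq h0 hP0 (hP.trans hN))) (hQ.trans hQ1))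
    have h2 : η * M * H + D ≤ X^(γ-ε₁+ε+ε) := by
      refine rp_add h0 h33 ?_ ?_
      · exact rp_mono hX (rp_mul h0 hH0 (rp_mul h0 hM0 hη hM) hH) (by linarith)
      · exact rp_mono hX hD (by linarith)
    exact rp_mono hX (rp_mul h0 (by positivity) h1 h2) (by linarith)
  have e1 : G * √(16 * J^2 * C^2 * W^3 * N^2 * Q₀ * (D * N + M) * (N * Q₀ * D / X + 1)) ≤ X^B := by
    have a1 := rp_mul h0 hN0 hD hN
    have a2 := rp_div h0 (rp_mul h0 hD0 (rp_mul h0 hQ00 hN hQ1) hD)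
    have hb0 : 0 ≤ N * Q₀ * D / X := by positivity
    have a3 : (D * N + M) * (N * Q₀ * D / X + 1) ≤ X^(2*α+ω+2*γ-2-4*ε₁+2*ε+ε+ε) := by
      have ee : (D * N + M) * (N * Q₀ * D / X + 1) = (D * N * (N * Q₀ * D / X) + D * N) + (M * (N * Q₀ * D / X) + M) := by ring
      rw [ee]
      refine rp_add h0 h33 (rp_add h0 h33 ?_ ?_) (rp_add h0 h33 ?_ ?_)
      · exact rp_mono hX (rp_mul h0 hb0 a1 a2) (by linarith)
      · exact rp_mono hX a1 (by linarith)
      · exact rp_mono hX (rp_mul h0 hb0 hM a2) (by linarith)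
      · exact rp_mono hX hM (by linarith)
    have h16 : (16:ℝ) ≤ X^ε := by linarith
    have a4 := rp_mul h0 (by positivity) (rp_mul h0 hQ00 (rp_mul h0 (by positivity) (rp_mul h0 (by positivity) (rp_mul h0 (by positivity) (rp_mul h0 (by positivity) h16 (rp_sq h0 hJ0 hJ)) (rp_sq h0 hC0 hC)) (rp_cube h0 hW0 hW)) (rp_sq h0 hN0 hN)) hQ1) a3
    rw [← mul_assoc] at a4
    have a5 := rp_mul h0 (Real.sqrt_nonneg _) hG (rp_sqrt h0 a4)
    exact rp_mono hX a5 (by linarith)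
  have hXB := Real.rpow_pos_of_pos h0 B
  have main : X^(2*α+ω+γ-1-6*ε) ≤ P^2 * Q * (M / X) * L := by
    have h1 : X^(2*α+ω+γ-1-6*ε) = (X^(α-ε))^2 * X^(ω-ε) * (X^(γ-ε)/X) * (X^(-ε) * X^(-ε)) := by
      rw [pow_two, ← Real.rpow_add h0, ← Real.rpow_add h0, div_eq_mul_inv, ← Real.rpow_neg_one X, ← Real.rpow_add h0, ← Real.rpow_add h0, ← Real.rpow_add h0, ← Real.rpow_add h0]
      ring_nf
    have h2 : X^(-ε) * X^(-ε) ≤ L := by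
      refine le_trans ?_ hL
      refine mul_le_mul_of_nonneg_right ?_ (Real.rpow_nonneg h0.le _)
      rw [Real.rpow_neg h0.le]
      calc (X^ε)⁻¹ ≤ (200:ℝ)⁻¹ := by gcongr
        _ = 0.005 := by norm_num
    rw [h1]
    have g1 := Real.rpow_nonneg h0.le (α-ε)
    have g2 := Real.rpow_nonneg h0.le (ω-ε)
    have g3 := Real.rpow_nonneg h0.le (γ-ε)
    have g4 := Real.rpow_nonneg h0.le (-ε)
    gcongr
  have fin : 5 * X^B ≤ X^(2*α+ω+γ-1-6*ε) := by
    calc 5 * X^B ≤ X^ε * X^B := by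
          refine mul_le_mul_of_nonneg_right (by linarith) hXB.le
      _ = X^(ε+B) := (Real.rpow_add h0 _ _).symm
      _ ≤ _ := Real.rpow_le_rpow_of_exponent_le hX (by linarith)
  linarith


theorem K_lem (η : ℝ) (hη : 0 < η) (hη1 : η ≤ 1) (M : ℕ) (hM : 1 ≤ M) : ∃ K : ℕ → ℕ,
    (∀ e, 1 ≤ e → e ≤ M → 1 ≤ K e ∧ K e * e ≤ M ∧ (M:ℝ) < (1+η) * (e * (K e + 1))) ∧
    ∀ E : Finset ℕ, (∀ e ∈ E, 1 ≤ e ∧ e ≤ M) → ((E.image K).card : ℝ) ≤ 2 * Real.log M / η + 1 := by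
  classical
  have hl : η / 2 ≤ Real.log (1+η) := by
    have h := Real.one_sub_inv_le_log_of_pos (show 0 < 1 + η by linarith)
    have : η / 2 ≤ 1 - (1+η)⁻¹ := by
      have h1 : 1 - (1+η)⁻¹ = η / (1+η) := by field_simp; ring
      rw [h1]; gcongr; linarith
    linarith
  have hl0 : 0 < Real.log (1+η) := by linarith
  have hM0 : (0:ℝ) < M := by exact_mod_cast hM
  refine ⟨fun e => ⌊(1+η)^⌊Real.log (M/e) / Real.log (1+η)⌋₊⌋₊, ?_, ?_⟩
  · intro e he heM
    have he0 : (0:ℝ) < e := by exact_mod_cast he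
    have hMe : 1 ≤ (M:ℝ)/e := by rw [one_le_div he0]; exact_mod_cast heM
    set i := ⌊Real.log (M/e) / Real.log (1+η)⌋₊ with hi
    have h1 : (1+η)^i ≤ (M:ℝ)/e := by
      have := Nat.floor_le (div_nonneg (Real.log_nonneg hMe) hl0.le)
      rw [← hi, le_div_iff₀ hl0, ← Real.log_pow] at this
      exact (Real.log_le_log_iff (by positivity) (by positivity)).1 this
    have h2 : (M:ℝ)/e < (1+η)^(i+1) := by
      have := Nat.lt_floor_add_one (Real.log (M/e) / Real.log (1+η))
      rw [← hi, div_lt_iff₀ hl0] at this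
      have h3 : Real.log (M/e) < Real.log ((1+η)^(i+1)) := by rw [Real.log_pow]; push_cast; exact this
      exact (Real.log_lt_log_iff (by positivity) (by positivity)).1 h3
    have hp1 : 1 ≤ (1+η)^i := one_le_pow₀ (by linarith)
    refine ⟨?_, ?_, ?_⟩
    · exact Nat.le_floor (by exact_mod_cast hp1)
    · have := Nat.floor_le (show 0 ≤ (1+η)^i by positivity)
      have h4 := this.trans h1
      rw [le_div_iff₀ he0] at h4
      exact_mod_cast h4
    · rw [div_lt_iff₀ he0, pow_succ] at h2
      have := Nat.lt_floor_add_one ((1+η)^i)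
      calc (M:ℝ) < (1+η)^i * (1+η) * e := h2
        _ ≤ (((⌊(1+η)^i⌋₊:ℕ):ℝ)+1) * (1+η) * e := by gcongr
        _ = _ := by ring
  · intro E hE
    have hsub : E.image (fun e : ℕ => ⌊(1+η)^⌊Real.log (M/e) / Real.log (1+η)⌋₊⌋₊) ⊆
        (Finset.range (⌊2 * Real.log M / η⌋₊ + 1)).image (fun i => ⌊(1+η)^i⌋₊) := by
      intro x hx
      obtain ⟨e, he, rfl⟩ := Finset.mem_image.1 hx
      refine Finset.mem_image.2 ⟨_, ?_, rfl⟩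
      rw [Finset.mem_range, Nat.lt_succ_iff]
      refine Nat.floor_le_floor ?_
      obtain ⟨h1, h2⟩ := hE e he
      have he0 : (1:ℝ) ≤ e := by exact_mod_cast h1
      have hlM : 0 ≤ Real.log M := Real.log_nonneg (by exact_mod_cast hM)
      calc Real.log (M/e) / Real.log (1+η) ≤ Real.log M / (η/2) := by
            gcongr
            exact div_le_self hM0.le he0
        _ = _ := by field_simp
    have h := (Finset.card_le_card hsub).trans Finset.card_image_le
    rw [Finset.card_range] at h
    have h3 : 0 ≤ 2 * Real.log M / η := by
      have : 0 ≤ Real.log M := Real.log_nonneg (by exact_mod_cast hM)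
      positivity
    have h4 := Nat.floor_le h3
    have h5 : ((E.image (fun e : ℕ => ⌊(1+η)^⌊Real.log (M/e) / Real.log (1+η)⌋₊⌋₊)).card : ℝ) ≤ (⌊2 * Real.log M / η⌋₊ + 1 : ℕ) := by
      exact_mod_cast h
    push_cast at h5
    linarith

theorem bdry_card (η : ℝ) (hη : 0 < η) (M : ℕ) :
    (((Finset.Icc 1 M).filter (fun n : ℕ => (M:ℝ) < (1 + η) * n)).card : ℝ) ≤ η * M + 1 := by
  have hsub : (Finset.Icc 1 M).filter (fun n : ℕ => (M:ℝ) < (1 + η) * n) ⊆ Finset.Ioc ⌊(M:ℝ)/(1+η)⌋₊ M := by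
    intro n hn
    obtain ⟨h1, h2⟩ := Finset.mem_filter.1 hn
    rw [Finset.mem_Ioc]
    refine ⟨?_, (Finset.mem_Icc.1 h1).2⟩
    rw [Nat.floor_lt (by positivity), div_lt_iff₀ (by linarith)]
    linarith
  have h := Finset.card_le_card hsub
  rw [Nat.card_Ioc] at h
  have hle : ⌊(M:ℝ)/(1+η)⌋₊ ≤ M := by
    have : (M:ℝ)/(1+η) ≤ M := div_le_self (by positivity) (by linarith)
    exact_mod_cast (Nat.floor_le (by positivity)).trans this
  have h' : (((Finset.Icc 1 M).filter (fun n : ℕ => (M:ℝ) < (1 + η) * n)).card : ℝ) ≤ M - ⌊(M:ℝ)/(1+η)⌋₊ := by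
    rw [← Nat.cast_sub hle]; exact_mod_cast h
  have h3 := Nat.lt_floor_add_one ((M:ℝ)/(1+η))
  have h4 : (M:ℝ) - η * M ≤ M/(1+η) := by
    rw [le_div_iff₀ (by linarith)]
    have : 0 ≤ (M:ℝ) := by positivity
    nlinarith [mul_nonneg (sq_nonneg η) this]
  linarith

theorem sq_card (z : ℝ) (hz : 1 ≤ z) (M : ℕ) (S : Finset ℕ)
    (hS : ∀ n ∈ S, (1 ≤ n ∧ n ≤ M) ∧ (n = 1 ∨ ∃ p : ℕ, p.Prime ∧ z ≤ p ∧ p^2 ∣ n)) :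
    (S.card : ℝ) ≤ 1 + 2 * M / z := by
  classical
  have hc : 1 ≤ ⌈z⌉₊ := Nat.one_le_ceil_iff.2 (by linarith)
  have hsub : S ⊆ {1} ∪ (Finset.Ioo (⌈z⌉₊ - 1) (M+1)).biUnion (fun k => (Finset.Ioc 0 M).filter (fun n => k^2 ∣ n)) := by
    intro n hn
    obtain ⟨⟨h1, h2⟩, h3⟩ := hS n hn
    rw [Finset.mem_union, Finset.mem_singleton]
    rcases h3 with h | ⟨p, hp, hzp, hpn⟩
    · exact Or.inl h
    · refine Or.inr (Finset.mem_biUnion.2 ⟨p, ?_, ?_⟩)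
      · rw [Finset.mem_Ioo]
        have : ⌈z⌉₊ ≤ p := Nat.ceil_le.2 hzp
        have h4 := Nat.le_of_dvd h1 hpn
        have h5 : p ≤ p^2 := Nat.le_self_pow (by norm_num) p
        omega
      · exact Finset.mem_filter.2 ⟨Finset.mem_Ioc.2 ⟨h1, h2⟩, hpn⟩
  have h := ((Finset.card_le_card hsub).trans (Finset.card_union_le _ _))
  have h2 := h.trans (Nat.add_le_add_left Finset.card_biUnion_le _)
  simp only [Nat.Ioc_filter_dvd_card_eq_div, Finset.card_singleton] at h2
  have h3 : (S.card:ℝ) ≤ 1 + ∑ k ∈ Finset.Ioo (⌈z⌉₊ - 1) (M+1), ((M / k^2 : ℕ):ℝ) := by exact_mod_cast h2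
  have h4 : ∑ k ∈ Finset.Ioo (⌈z⌉₊ - 1) (M+1), ((M / k^2 : ℕ):ℝ) ≤ M * ∑ k ∈ Finset.Ioo (⌈z⌉₊ - 1) (M+1), ((k:ℝ)^2)⁻¹ := by
    rw [Finset.mul_sum]
    refine Finset.sum_le_sum (fun k _ => ?_)
    have := Nat.cast_div_le (α := ℝ) (m := M) (n := k^2)
    rw [← div_eq_mul_inv]; push_cast at this; exact this
  have h5 := sum_Ioo_inv_sq_le (α := ℝ) (⌈z⌉₊ - 1) (M+1)
  have h6 : (((⌈z⌉₊ - 1 : ℕ):ℝ) + 1) = ⌈z⌉₊ := by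
    rw [Nat.cast_sub hc]; simp
  rw [h6] at h5
  have h7 : (2:ℝ) / ⌈z⌉₊ ≤ 2 / z := by
    gcongr; exact Nat.le_ceil z
  have h8 : (M:ℝ) * ∑ k ∈ Finset.Ioo (⌈z⌉₊ - 1) (M+1), ((k:ℝ)^2)⁻¹ ≤ M * (2/z) := by
    gcongr; exact h5.trans h7
  have h9 : (M:ℝ) * (2/z) = 2 * M / z := by ring
  linarith

theorem omega_bd (n : ℕ) (hn : 1 ≤ n) (z B A : ℝ) (hz : 1 < z) (hB : 0 < B) (hsq : ∀ p, p.Prime → p ∣ n → ¬ p^2 ∣ n)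
    (hs : ∑ p ∈ n.primeFactors, (1 - Real.log p / B) < 1.775) (hA : Real.log n ≤ A) :
    (n.primeFactorsList.length : ℝ) < 1.775 + A / B := by
  have hsf : Squarefree n := by
    rw [Nat.squarefree_iff_prime_squarefree]
    intro p hp hpn
    rw [← pow_two] at hpn
    exact hsq p hp ((dvd_pow_self p two_ne_zero).trans hpn) hpn
  have hcard : n.primeFactorsList.length = n.primeFactors.card := by
    have := (Nat.squarefree_iff_nodup_primeFactorsList (by omega)).1 hsf
    rw [Nat.primeFactors, List.card_toFinset, this.dedup]
  have hprod := Nat.prod_primeFactors_of_squarefree hsf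
  have hlog : ∑ p ∈ n.primeFactors, Real.log p = Real.log n := by
    rw [← Real.log_prod]
    · rw [← Nat.cast_prod, hprod]
    · intro p hp
      exact_mod_cast (Nat.prime_of_mem_primeFactors hp).ne_zero
  rw [Finset.sum_sub_distrib, ← Finset.sum_div, hlog] at hs
  simp only [Finset.sum_const, nsmul_eq_mul, mul_one] at hs
  rw [hcard]
  have : Real.log n / B ≤ A / B := by gcongr
  linarith


set_option maxHeartbeats 2000000 in
theorem cg_core (α γ ω lam ε ε₁ : ℝ) (hα : 1/2 ≤ α) (hα1 : α ≤ 1) (hω : 0 ≤ ω) (hω1 : ω ≤ 1) (hγ1 : γ ≤ 1)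
    (hlam : 0 < lam) (hε : 0 < ε) (hε₁ : 0 < ε₁) (hεε : 60 * ε ≤ ε₁) (hε₁1 : ε₁ ≤ 1/2) (hεl : ε₁ ≤ lam / 9.4)
    (i1 : 2+4*ε₁ ≤ 2*α+ω+γ) (i2 : lam+4*ε₁ ≤ α+γ-1) (i3 : lam+4*ε₁ ≤ 2*γ+α+ω-2) (i4 : 2*lam+4*ε₁ ≤ 2*γ-1)
    (m : ℕ) (hm : 1 ≤ m) (h200 : 200 ≤ (m:ℝ)^ε) (hJ : (Nat.clog 2 m : ℝ) + 1 ≤ (m:ℝ)^ε)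
    (hlog : 2 * Real.log m + 1 ≤ (m:ℝ)^ε)
    (hW : ∀ u : ℕ, 1 ≤ u → u ≤ 4 * m^3 → u.divisors.card ≤ ⌊(m:ℝ)^ε⌋₊)
    (hV : ((m:ℝ)^(lam/9.4))^(-ε) ≤ ∏ p ∈ PP m ((m:ℝ)^(lam/9.4)), (1 - (p:ℝ)⁻¹))
    (hr : ∀ D : ℕ, ((m:ℝ)^(lam/9.4))^(9.4:ℝ) ≤ D → ∃ Lm : ℕ → ℝ,
    (∀ e, 1 ≤ e → |Lm e| ≤ 1 + e.divisors.card) ∧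
    (∀ n, 1 ≤ n → Nat.Coprime n m →
      ∑ e ∈ ((Finset.Icc 1 D).filter (fun e => Nat.Coprime e m)).filter (fun e => e ∣ n), Lm e ≤ 1 ∧
      (0 < ∑ e ∈ ((Finset.Icc 1 D).filter (fun e => Nat.Coprime e m)).filter (fun e => e ∣ n), Lm e →
        (∀ p : ℕ, p.Prime → p ∣ n → (m:ℝ)^(lam/9.4) ≤ p) ∧ ∑ p ∈ n.primeFactors, (1 - Real.log p / (8.93 * Real.log ((m:ℝ)^(lam/9.4)))) < 1.775)) ∧
    0.005 * ∏ p ∈ PP m ((m:ℝ)^(lam/9.4)), (1 - (p:ℝ)⁻¹) ≤ ∑ e ∈ (Finset.Icc 1 D).filter (fun e => Nat.Coprime e m), Lm e / e)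
    (a : ZMod m) (ha : IsUnit a) (P Q : Finset ℕ)
    (hP : ∀ x ∈ P, 1 ≤ x ∧ x ≤ ⌊(m:ℝ)^α⌋₊ ∧ Nat.Coprime x m)
    (hQ : ∀ x ∈ Q, 1 ≤ x ∧ x ≤ ⌊(m:ℝ)^ω⌋₊ ∧ Nat.Coprime x m)
    (hPc : (m:ℝ)^(α-ε) ≤ P.card) (hQc : (m:ℝ)^(ω-ε) ≤ Q.card) :
    ∃ n x y q : ℕ, x ∈ P ∧ y ∈ P ∧ q ∈ Q ∧ 1 < n ∧ (n:ℝ) ≤ (m:ℝ)^γ ∧ Nat.Coprime n m ∧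
      (n:ZMod m) * x * (y * q : ℕ) = a ∧ (n.primeFactorsList.length : ℝ) < 1.775 + γ / (0.95 * lam) := by
  classical
  haveI : NeZero m := ⟨by omega⟩
  set X : ℝ := (m:ℝ) with hXdef
  have hX1 : 1 ≤ X := by rw [hXdef]; exact_mod_cast hm
  have hX0 : 0 < X := by linarith
  have hXgt : 1 < X := by
    by_contra h
    have : X = 1 := by linarith
    rw [this, Real.one_rpow] at h200
    norm_num at h200
  have hlX : 0 < Real.log X := Real.log_pos hXgt
  set z := X^(lam/9.4) with hz
  have hz1 : 1 < z := Real.one_lt_rpow hXgt (by positivity)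
  have hz0 : 0 < z := by linarith
  have hγ0 : 1/2 ≤ γ := by linarith
  have h32 : 32 ≤ X^ε := by linarith
  have one_le : ∀ c : ℝ, 0 ≤ c → 1 ≤ X^c := fun c hc => Real.one_le_rpow hX1 hc
  have le_m : ∀ c : ℝ, c ≤ 1 → ⌊X^c⌋₊ ≤ m := by
    intro c hc
    have h1 : X^c ≤ X^(1:ℝ) := Real.rpow_le_rpow_of_exponent_le hX1 hc
    rw [Real.rpow_one] at h1
    have h2 := (Nat.floor_le (show 0 ≤ X^c by positivity)).trans h1
    rw [hXdef] at h2
    exact_mod_cast h2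
  set M := ⌊X^γ⌋₊ with hMdef
  set N := ⌊X^α⌋₊ with hNdef
  set Q₀ := ⌊X^ω⌋₊ with hQ₀def
  set D := ⌈X^lam⌉₊ with hDdef
  set W := ⌊X^ε⌋₊ with hWdef
  set J := Nat.clog 2 m with hJdef
  set η := X^(-ε₁) with hηdef
  set T := X^(γ-ε₁+ε) with hTdef
  have hη0 : 0 < η := Real.rpow_pos_of_pos hX0 _
  have hη1 : η ≤ 1 := Real.rpow_le_one_of_one_le_of_nonpos hX1 (by linarith)
  have hMle : (M:ℝ) ≤ X^γ := Nat.floor_le (by positivity)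
  have hMge : X^(γ-ε) ≤ M := by
    have h1 : X^γ = X^(γ-ε) * X^ε := by rw [← Real.rpow_add hX0]; ring_nf
    have h2 := Nat.lt_floor_add_one (X^γ)
    have h3 := one_le (γ-ε) (by linarith)
    rw [← hMdef] at h2
    have h4 : X^(γ-ε) * 200 ≤ X^γ := by rw [h1]; gcongr
    linarith
  have hDle : (D:ℝ) ≤ X^(lam+ε) := by
    have h1 := Nat.ceil_lt_add_one (show 0 ≤ X^lam by positivity)
    rw [Real.rpow_add hX0]
    have h3 := one_le lam hlam.le
    have h4 : X^lam * 200 ≤ X^lam * X^ε := by gcongr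
    rw [← hDdef] at h1
    linarith
  have hDM : D ≤ M := Nat.le_floor (hDle.trans (Real.rpow_le_rpow_of_exponent_le hX1 (by linarith)))
  have hMm : M ≤ m := le_m γ hγ1
  have hN1 : 1 ≤ N := Nat.le_floor (by simpa using one_le α (by linarith))
  have hM1 : 1 ≤ M := Nat.le_floor (by simpa using one_le γ (by linarith))
  have hJ1 : m ≤ 2^J := Nat.le_pow_clog (by norm_num) m
  have hm1' : 1 < m := by
    have : (1:ℝ) < m := hXgt
    exact_mod_cast this
  have hJ2 : 2^J ≤ 2 * m := by
    have h1 := Nat.pow_pred_clog_lt_self (b := 2) (by norm_num) hm1'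
    have h2 : 1 ≤ J := Nat.clog_pos (by norm_num) hm1'
    have h3 : 2^J = 2 * 2^(J-1) := by rw [← pow_succ']; congr 1; omega
    rw [h3]
    have h4 : 2^(J-1) < m := by simpa [hJdef] using h1
    omega
  obtain ⟨K, hK, hKc⟩ := K_lem η hη0 hη1 M hM1
  have hzD : z^(9.4:ℝ) ≤ D := by
    rw [hz, ← Real.rpow_mul hX0.le]
    have : lam / 9.4 * 9.4 = lam := by norm_num
    rw [this]; exact Nat.le_ceil _
  obtain ⟨Lm, hL1, hL2, hL3⟩ := hr D hzD
  set E := (Finset.Icc 1 D).filter (fun e => Nat.Coprime e m) with hE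
  have hEm : ∀ e ∈ E, 1 ≤ e ∧ e ≤ D ∧ Nat.Coprime e m := by
    intro e he
    obtain ⟨h1, h2⟩ := Finset.mem_filter.1 he
    exact ⟨(Finset.mem_Icc.1 h1).1, (Finset.mem_Icc.1 h1).2, h2⟩
  have hDm : D ≤ m := hDM.trans hMm
  have hWle : (W:ℝ) ≤ X^ε := Nat.floor_le (by positivity)
  have hΛ : ∀ e ∈ E, |Lm e| ≤ 1 + (W:ℝ) := by
    intro e he
    obtain ⟨h1, h2, _⟩ := hEm e he
    refine (hL1 e h1).trans ?_
    have h3 : m ≤ m^3 := Nat.le_self_pow (by norm_num) m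
    have := hW e h1 (by omega)
    have : (e.divisors.card : ℝ) ≤ W := by exact_mod_cast this
    linarith
  have hT1 : (((Finset.Icc 1 M).filter (fun n : ℕ => (M:ℝ) < (1 + η) * n)).card : ℝ) ≤ T := by
    refine (bdry_card η hη0 M).trans ?_
    have h1 : η * M ≤ X^(γ-ε₁) := by
      have : X^(γ-ε₁) = η * X^γ := by rw [hηdef, ← Real.rpow_add hX0]; ring_nf
      rw [this]; gcongr
    have h2 := one_le (γ-ε₁) (by linarith)
    have h3 : T = X^(γ-ε₁) * X^ε := by rw [hTdef, ← Real.rpow_add hX0]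
    have h4 : X^(γ-ε₁) * 200 ≤ X^(γ-ε₁) * X^ε := by gcongr
    linarith
  set S := (Finset.Icc 1 M).filter (fun n => n = 1 ∨ ∃ p : ℕ, p.Prime ∧ z ≤ p ∧ p^2 ∣ n) with hSdef
  have hS1 : ∀ n ∈ S, 1 ≤ n ∧ n ≤ M := fun n hn => Finset.mem_Icc.1 (Finset.mem_filter.1 hn).1
  have hT2 : (S.card : ℝ) ≤ T := by
    refine (sq_card z hz1.le M S (fun n hn => ⟨hS1 n hn, (Finset.mem_filter.1 hn).2⟩)).trans ?_
    have h1 : (M:ℝ) / z ≤ X^(γ-ε₁) := by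
      rw [div_le_iff₀ hz0, hz, ← Real.rpow_add hX0]
      refine hMle.trans (Real.rpow_le_rpow_of_exponent_le hX1 (by linarith))
    have h2 := one_le (γ-ε₁) (by linarith)
    have h3 : T = X^(γ-ε₁) * X^ε := by rw [hTdef, ← Real.rpow_add hX0]
    have h4 : X^(γ-ε₁) * 200 ≤ X^(γ-ε₁) * X^ε := by gcongr
    rw [mul_div_assoc]
    linarith
  have hdist := cc_dist m N Q₀ M D W J a ha P Q E hP hQ hEm hN1 (le_m α hα1) (le_m ω hω1) hDm hMm hJ1 hJ2 hW Lm
    (1 + (W:ℝ)) hΛ (by positivity) η hη0.le K (fun e he => (hK e (hEm e he).1 ((hEm e he).2.1.trans hDM)).1)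
    (fun e he => (hK e (hEm e he).1 ((hEm e he).2.1.trans hDM)).2.1)
    (fun e he => (hK e (hEm e he).1 ((hEm e he).2.1.trans hDM)).2.2)
    (2 * Real.log M / η + 1) (hKc E (fun e he => ⟨(hEm e he).1, (hEm e he).2.1.trans hDM⟩)) T hT1
  have hjunk := cc_junk m N Q₀ M W J a ha P Q S hP hQ hS1 hN1 (le_m α hα1) (le_m ω hω1) hMm hJ1 hJ2 hW T hT2
  have cardle : ∀ (A : Finset ℕ) (B : ℕ), (∀ x ∈ A, 1 ≤ x ∧ x ≤ B ∧ Nat.Coprime x m) → (A.card : ℝ) ≤ B := by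
    intro A B h
    have : A ⊆ Finset.Icc 1 B := fun x hx => Finset.mem_Icc.2 ⟨(h x hx).1, (h x hx).2.1⟩
    have := Finset.card_le_card this
    rw [Nat.card_Icc] at this
    exact_mod_cast this
  have hG : 2 * Real.log M / η + 1 ≤ X^(ε₁+ε) := by
    have h1 : Real.log M ≤ Real.log X := Real.log_le_log (by exact_mod_cast hM1) (by rw [hXdef]; exact_mod_cast hMm)
    have h2 : η⁻¹ = X^ε₁ := by rw [hηdef, Real.rpow_neg hX0.le, inv_inv]
    have h3 := one_le ε₁ hε₁.le
    rw [div_eq_mul_inv, h2, Real.rpow_add hX0]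
    calc 2 * Real.log M * X^ε₁ + 1 ≤ 2 * Real.log X * X^ε₁ + X^ε₁ := by gcongr
      _ = X^ε₁ * (2 * Real.log X + 1) := by ring
      _ ≤ _ := by gcongr
  have hH : ∑ e ∈ Finset.Icc 1 D, 1/(e:ℝ) ≤ X^ε := by
    have h1 := harmonic_le_one_add_log D
    rw [harmonic_eq_sum_Icc] at h1
    push_cast at h1
    simp only [one_div]
    have hD1 : 1 ≤ D := Nat.one_le_ceil_iff.2 (by positivity)
    have h2 : Real.log D ≤ Real.log X := Real.log_le_log (by exact_mod_cast hD1) (by rw [hXdef]; exact_mod_cast hDm)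
    linarith
  have hLl : 0.005 * X^(-ε) ≤ ∑ e ∈ E, Lm e / e := by
    refine le_trans ?_ hL3
    have h1 : X^(-ε) ≤ z^(-ε) := by
      refine Real.rpow_le_rpow_of_nonpos hz0 ?_ (by linarith)
      have : z ≤ X^(1:ℝ) := Real.rpow_le_rpow_of_exponent_le hX1 (by rw [div_le_one (by norm_num)]; linarith)
      rwa [Real.rpow_one] at this
    have := h1.trans hV
    linarith
  have hineq := cg_ineq X α γ ω lam ε ε₁ hX1 hε hα hω (by linarith) hε₁ hεε hε₁1 i1 i2 i3 i4
    N P.card Q.card Q₀ M D W (J+1) (1 + W) (2 * Real.log M / η + 1) T (∑ e ∈ Finset.Icc 1 D, 1/(e:ℝ)) η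
    (∑ e ∈ E, Lm e / e) (Nat.floor_le (by positivity)) (by positivity) (cardle P N hP) hPc (cardle Q Q₀ hQ) hQc
    (Nat.floor_le (by positivity)) hMge hMle (by positivity) hDle (by positivity) hWle (by positivity) hJ
    (by positivity) (by
      rw [two_mul, Real.rpow_add hX0]
      nlinarith) hG (by positivity) le_rfl (Finset.sum_nonneg (fun _ _ => by positivity)) hH hη0.le le_rfl hLl h200
  have hmain : ∑ n ∈ S, cr m a P Q n < ∑ n ∈ Finset.Icc 1 M, cr m a P Q n * (∑ e ∈ E.filter (fun e => e ∣ n), Lm e) := by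
    have := (abs_le.1 hdist).1
    linarith
  -- extract
  have hex : ∃ n ∈ Finset.Icc 1 M, n ∉ S ∧ 0 < cr m a P Q n * (∑ e ∈ E.filter (fun e => e ∣ n), Lm e) := by
    by_contra hcon
    push Not at hcon
    have hle : ∑ n ∈ Finset.Icc 1 M, cr m a P Q n * (∑ e ∈ E.filter (fun e => e ∣ n), Lm e) ≤
        ∑ n ∈ Finset.Icc 1 M, if n ∈ S then cr m a P Q n else 0 := by
      refine Finset.sum_le_sum (fun n hn => ?_)
      split_ifs with h
      · by_cases hc : Nat.Coprime n m
        · have := (hL2 n (Finset.mem_Icc.1 hn).1 hc).1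
          have h0 := cr_nonneg m a P Q n
          nlinarith
        · rw [cr_zero m a ha P Q n hc]; simp
      · exact hcon n hn h
    rw [← Finset.sum_filter] at hle
    have : (Finset.Icc 1 M).filter (fun n => n ∈ S) = S := by
      ext n
      simp only [Finset.mem_filter]
      exact ⟨fun h => h.2, fun h => ⟨Finset.mem_Icc.2 (hS1 n h), h⟩⟩
    rw [this] at hle
    linarith
  obtain ⟨n, hn, hnS, hpos⟩ := hex
  have h0 := cr_nonneg m a P Q n
  have hcr : 0 < cr m a P Q n := by
    rcases h0.lt_or_eq with h | h
    · exact h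
    · rw [← h] at hpos; simp at hpos
  have hw := (pos_iff_pos_of_mul_pos hpos).1 hcr
  have hcop : Nat.Coprime n m := by
    by_contra hc
    rw [cr_zero m a ha P Q n hc] at hcr
    exact lt_irrefl _ hcr
  obtain ⟨hn1, hnM⟩ := Finset.mem_Icc.1 hn
  obtain ⟨hw1, hw2⟩ := (hL2 n hn1 hcop).2 hw
  have hnS' : ¬ (n = 1 ∨ ∃ p : ℕ, p.Prime ∧ z ≤ p ∧ p^2 ∣ n) := fun h => hnS (Finset.mem_filter.2 ⟨hn, h⟩)
  push Not at hnS'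
  have hnle : (n:ℝ) ≤ X^γ := le_trans (by exact_mod_cast hnM) hMle
  obtain ⟨x, hx, hx2⟩ : ∃ x ∈ P, ∑ y ∈ P ×ˢ Q, (if (n : ZMod m) * x * (y.1 * y.2 : ℕ) = a then (1:ℝ) else 0) ≠ 0 := by
    by_contra hc
    push Not at hc
    rw [cr, Finset.sum_eq_zero hc] at hcr
    exact lt_irrefl _ hcr
  obtain ⟨y, hy, hy2⟩ := Finset.exists_ne_zero_of_sum_ne_zero hx2
  have hya : (n : ZMod m) * x * (y.1 * y.2 : ℕ) = a := by
    by_contra hc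
    exact hy2 (if_neg hc)
  obtain ⟨hyP, hyQ⟩ := Finset.mem_product.1 hy
  refine ⟨n, x, y.1, y.2, hx, hyP, hyQ, by have := hnS'.1; omega, hnle, hcop, hya, ?_⟩
  have hlz : Real.log z = lam / 9.4 * Real.log X := Real.log_rpow hX0 _
  have hlz0 : 0 < Real.log z := Real.log_pos hz1
  have hlogn : Real.log n ≤ γ * Real.log X := by
    rw [← Real.log_rpow hX0]
    exact Real.log_le_log (by exact_mod_cast hn1) hnle
  have := omega_bd n hn1 z (8.93 * Real.log z) (γ * Real.log X) hz1 (by positivity)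
    (fun p hp hpn => hnS'.2 p hp (hw1 p hp hpn)) hw2 hlogn
  have e : γ * Real.log X / (8.93 * Real.log z) = γ / (0.95 * lam) := by
    rw [hlz]
    field_simp
    norm_num
  rwa [e] at this


open Filter in
theorem log_ev (δ c : ℝ) (hδ : 0 < δ) (hc : 0 < c) : ∀ᶠ x : ℝ in atTop, Real.log x ≤ c * x^δ := by
  have h := (isLittleO_log_rpow_atTop hδ).bound hc
  filter_upwards [h, eventually_ge_atTop (1:ℝ)] with x hx hx1
  rw [Real.norm_of_nonneg (Real.log_nonneg hx1), Real.norm_of_nonneg (by positivity)] at hx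
  exact hx

open Filter in
theorem pi_ev (δ : ℝ) (hδ : 0 < δ) : ∀ᶠ x : ℝ in atTop, 2 * x^(1-δ) ≤ Nat.primeCounting ⌊x⌋₊ := by
  filter_upwards [log_ev δ (1/8) hδ (by norm_num), log_ev 1 (1/100) one_pos (by norm_num), eventually_ge_atTop (100:ℝ)] with x h1 h2 hx
  have hx0 : 0 < x := by linarith
  have hlx : 0 < Real.log x := Real.log_pos (by linarith)
  refine le_trans ?_ (Chebyshev.pi_ge' (show 1 < x by linarith))
  rw [le_div_iff₀ hlx]
  rw [Real.rpow_one] at h2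
  have h3 : Real.log (x+2) ≤ 2 * Real.log x := by
    have : Real.log (x+2) ≤ Real.log (x^2) := Real.log_le_log (by linarith) (by nlinarith)
    rw [Real.log_pow] at this; exact_mod_cast this
  have h4 := Real.log_two_gt_d9
  have h5 : 2 * x^(1-δ) * Real.log x ≤ 2 * x^(1-δ) * (1/8 * x^δ) := by gcongr
  have h6 : x^(1-δ) * x^δ = x := by rw [← Real.rpow_add hx0]; simp
  have h7 : 2 * x^(1-δ) * (1/8 * x^δ) = x/4 := by linear_combination h6 / 4
  nlinarith

noncomputable def PS (m : ℕ) (α : ℝ) : Finset ℕ := (Nat.primesLE ⌊(m:ℝ)^α⌋₊).filter (fun p => ¬ p ∣ m)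

open Filter in
theorem tend_rp (c : ℝ) (hc : 0 < c) : Tendsto (fun m : ℕ => (m:ℝ)^c) atTop atTop :=
  (tendsto_rpow_atTop hc).comp tendsto_natCast_atTop_atTop

theorem PS_mem (m : ℕ) (α : ℝ) (x : ℕ) (hx : x ∈ PS m α) : x.Prime ∧ 1 ≤ x ∧ x ≤ ⌊(m:ℝ)^α⌋₊ ∧ Nat.Coprime x m := by
  obtain ⟨h1, h2⟩ := Finset.mem_filter.1 hx
  obtain ⟨h3, h4⟩ := Nat.mem_primesLE.1 h1
  exact ⟨h4, h4.one_le, h3, (Nat.Prime.coprime_iff_not_dvd h4).2 h2⟩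

open Filter in
theorem PS_card (α ε : ℝ) (hα : 1/2 ≤ α) (hα1 : α ≤ 1) (hε : 0 < ε) (hε1 : ε ≤ 1/4) :
    ∀ᶠ m : ℕ in atTop, (m:ℝ)^(α-ε) ≤ (PS m α).card := by
  obtain ⟨C, hC, hτ⟩ := ca_tau (1/8) (by norm_num)
  filter_upwards [(tend_rp α (by linarith)).eventually (pi_ev ε hε), (tend_rp (1/8) (by norm_num)).eventually_ge_atTop C,
    eventually_ge_atTop 1] with m h1 h2 hm
  have hm1 : (1:ℝ) ≤ m := by exact_mod_cast hm
  have hm0 : (0:ℝ) < m := by linarith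
  rw [← Real.rpow_mul hm0.le] at h1
  have h3 : (m:ℝ)^(α-ε) ≤ (m:ℝ)^(α*(1-ε)) := Real.rpow_le_rpow_of_exponent_le hm1 (by nlinarith)
  have h4 : (m.divisors.card:ℝ) ≤ (m:ℝ)^(α-ε) := by
    refine (hτ m hm).trans ?_
    calc C * (m:ℝ)^(1/8:ℝ) ≤ (m:ℝ)^(1/8:ℝ) * (m:ℝ)^(1/8:ℝ) := by gcongr
      _ = (m:ℝ)^(1/4:ℝ) := by rw [← Real.rpow_add hm0]; norm_num
      _ ≤ _ := Real.rpow_le_rpow_of_exponent_le hm1 (by linarith)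
  have h5 : (Nat.primesLE ⌊(m:ℝ)^α⌋₊).card ≤ (PS m α).card + m.divisors.card := by
    rw [← Finset.card_filter_add_card_filter_not (s := Nat.primesLE ⌊(m:ℝ)^α⌋₊) (fun p => ¬ p ∣ m)]
    refine Nat.add_le_add le_rfl (Finset.card_le_card ?_)
    intro p hp
    have := (Finset.mem_filter.1 hp).2
    rw [not_not] at this
    exact Nat.mem_divisors.2 ⟨this, by omega⟩
  have h6 : Nat.primeCounting ⌊(m:ℝ)^α⌋₊ = (Nat.primesLE ⌊(m:ℝ)^α⌋₊).card := by
    rw [Nat.primesLE_card_eq_primeCounting]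
  rw [h6] at h1
  have h7 : ((Nat.primesLE ⌊(m:ℝ)^α⌋₊).card : ℝ) ≤ (PS m α).card + m.divisors.card := by exact_mod_cast h5
  linarith

open Filter in
theorem cg_main (α γ ω lam : ℝ) (hα : 1/2 ≤ α) (hα1 : α ≤ 1) (hω : 0 ≤ ω) (hω1 : ω ≤ 1) (hγ1 : γ ≤ 1)
    (hlam : 0 < lam) (i1 : 2 < 2*α+ω+γ) (i2 : lam < α+γ-1) (i3 : lam < 2*γ+α+ω-2) (i4 : lam < γ-1/2) :
    ∃ ε : ℝ, 0 < ε ∧ ε ≤ 1/4 ∧ ∀ᶠ m : ℕ in atTop, ∀ a : ZMod m, IsUnit a → ∀ P Q : Finset ℕ,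
      (∀ x ∈ P, 1 ≤ x ∧ x ≤ ⌊(m:ℝ)^α⌋₊ ∧ Nat.Coprime x m) →
      (∀ x ∈ Q, 1 ≤ x ∧ x ≤ ⌊(m:ℝ)^ω⌋₊ ∧ Nat.Coprime x m) →
      (m:ℝ)^(α-ε) ≤ P.card → (m:ℝ)^(ω-ε) ≤ Q.card →
      ∃ n x y q : ℕ, x ∈ P ∧ y ∈ P ∧ q ∈ Q ∧ 1 < n ∧ (n:ℝ) ≤ (m:ℝ)^γ ∧ Nat.Coprime n m ∧
        (n:ZMod m) * x * (y * q : ℕ) = a ∧ (n.primeFactorsList.length : ℝ) < 1.775 + γ / (0.95 * lam) := by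
  obtain ⟨ε₁, hε₁, b0, b1, b2, b3, b4, b5⟩ : ∃ ε₁ : ℝ, 0 < ε₁ ∧ ε₁ ≤ 1/2 ∧ ε₁ ≤ lam/9.4 ∧ 2+4*ε₁ ≤ 2*α+ω+γ ∧
      lam+4*ε₁ ≤ α+γ-1 ∧ lam+4*ε₁ ≤ 2*γ+α+ω-2 ∧ 2*lam+4*ε₁ ≤ 2*γ-1 := by
    set s := min (min (min (1/2) (lam/9.4)) (min ((2*α+ω+γ-2)/4) ((α+γ-1-lam)/4))) (min ((2*γ+α+ω-2-lam)/4) ((γ-1/2-lam)/4)) with hs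
    have hl : 0 < lam/9.4 := by positivity
    refine ⟨s, ?_, ?_, ?_, ?_, ?_, ?_, ?_⟩
    · simp only [hs, lt_min_iff]
      refine ⟨⟨⟨by norm_num, hl⟩, ?_, ?_⟩, ?_, ?_⟩ <;> linarith
    · exact ((min_le_left _ _).trans (min_le_left _ _)).trans (min_le_left _ _)
    · exact ((min_le_left _ _).trans (min_le_left _ _)).trans (min_le_right _ _)
    · have : s ≤ (2*α+ω+γ-2)/4 := ((min_le_left _ _).trans (min_le_right _ _)).trans (min_le_left _ _)
      linarith
    · have : s ≤ (α+γ-1-lam)/4 := ((min_le_left _ _).trans (min_le_right _ _)).trans (min_le_right _ _)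
      linarith
    · have : s ≤ (2*γ+α+ω-2-lam)/4 := (min_le_right _ _).trans (min_le_left _ _)
      linarith
    · have : s ≤ (γ-1/2-lam)/4 := (min_le_right _ _).trans (min_le_right _ _)
      linarith
  have hε : 0 < ε₁/60 := by positivity
  refine ⟨ε₁/60, hε, by linarith, ?_⟩
  set ε := ε₁/60 with hεdef
  obtain ⟨C, hC, hτ⟩ := ca_tau (ε/10) (by positivity)
  have hl : 0 < lam/9.4 := by positivity
  filter_upwards [eventually_ge_atTop 4, (tend_rp ε hε).eventually_ge_atTop 200, (tend_rp (ε/2) (by positivity)).eventually_ge_atTop C,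
    tendsto_natCast_atTop_atTop.eventually (log_ev ε (1/4) hε (by norm_num)),
    (tend_rp _ hl).eventually richert, (tend_rp _ hl).eventually (V_low ε hε (by linarith))]
    with m hm h200 hCm hlog hri hV a ha P Q hP hQ hPc hQc
  have hm1 : (1:ℝ) ≤ m := by exact_mod_cast (by omega : 1 ≤ m)
  have hm0 : (0:ℝ) < m := by linarith
  have hm4 : (4:ℝ) ≤ m := by exact_mod_cast hm
  refine cg_core α γ ω lam ε ε₁ hα hα1 hω hω1 hγ1 hlam hε hε₁ (by rw [hεdef]; linarith) b0 b1 b2 b3 b4 b5 m (by omega) h200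
    ?_ (by linarith) ?_ (hV m) (hri m) a ha P Q hP hQ hPc hQc
  · have h1 := Nat.pow_pred_clog_lt_self (b := 2) (by norm_num) (show 1 < m by omega)
    have h2 : 1 ≤ Nat.clog 2 m := Nat.clog_pos (by norm_num) (by omega)
    have h3 : ((2:ℝ)^(Nat.clog 2 m - 1)) ≤ m := by
      have : 2^(Nat.clog 2 m - 1) ≤ m := by simpa using h1.le
      exact_mod_cast this
    have h4 := Real.log_le_log (by positivity) h3
    rw [Real.log_pow, Nat.cast_sub h2] at h4
    have h5 := Real.log_two_gt_d9
    have h6 : (1:ℝ) ≤ Nat.clog 2 m := by exact_mod_cast h2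
    push_cast at h4
    nlinarith
  · intro u hu hum
    refine Nat.le_floor ((hτ u hu).trans ?_)
    have h1 : (u:ℝ) ≤ (m:ℝ)^(5:ℝ) := by
      have h2 : (u:ℝ) ≤ 4 * (m:ℝ)^3 := by exact_mod_cast hum
      have h3 : (m:ℝ)^(5:ℝ) = (m:ℝ)^5 := by exact_mod_cast Real.rpow_natCast (m:ℝ) 5
      rw [h3]
      calc (u:ℝ) ≤ 4 * (m:ℝ)^3 := h2
        _ ≤ (m:ℝ)^2 * (m:ℝ)^3 := by gcongr; nlinarith
        _ = _ := by ring
    calc C * (u:ℝ)^(ε/10) ≤ (m:ℝ)^(ε/2) * ((m:ℝ)^(5:ℝ))^(ε/10) := by gcongr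
      _ = (m:ℝ)^ε := by
        rw [← Real.rpow_mul hm0.le, ← Real.rpow_add hm0]; ring_nf


def Concl (α β : ℝ) (l m : ℕ) : Prop := ∀ a : ℤ, Int.gcd a m = 1 →
      ∃ p₁ p₂ p₃ s : ℕ, p₁.Prime ∧ p₂.Prime ∧ p₃.Prime ∧
        (p₁ : ℝ) ≤ (m : ℝ) ^ α ∧ (p₂ : ℝ) ≤ (m : ℝ) ^ α ∧
        (p₃ : ℝ) ≤ (m : ℝ) ^ α ∧
        0 < s ∧ (s : ℝ) ≤ (m : ℝ) ^ β ∧ s.primeFactorsList.length ≤ l ∧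
        ((p₁ * p₂ * p₃ * s : ℕ) : ℤ) ≡ a [ZMOD (m : ℤ)]

theorem unit_of_gcd (m : ℕ) (a : ℤ) (h : Int.gcd a m = 1) : IsUnit (a : ZMod m) := by
  rw [ZMod.coe_int_isUnit_iff_isCoprime]
  exact (Int.isCoprime_iff_gcd_eq_one.2 h).symm

open Filter in
theorem case3 (α β lam : ℝ) (l : ℕ) (hα : 1/2 ≤ α) (hα1 : α ≤ 1) (hβ1 : β ≤ 1) (h : 1 < α/2 + β)
    (hlam : 0 < lam) (hl : lam < β - 1/2) (hl2 : 1.775 + β/(0.95*lam) ≤ l + 1) :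
    ∀ᶠ m : ℕ in atTop, Concl α β l m := by
  obtain ⟨ε, hε, hε1, hev⟩ := cg_main α β α lam hα hα1 (by linarith) hα1 hβ1 hlam (by linarith) (by linarith) (by linarith) hl
  filter_upwards [hev, PS_card α ε hα hα1 hε hε1, eventually_ge_atTop 1] with m h1 h2 hm a ha
  obtain ⟨n, x, y, q, hx, hy, hq, hn1, hnle, hcop, heq, hlen⟩ :=
    h1 a (unit_of_gcd m a ha) (PS m α) (PS m α) (fun x hx => (PS_mem m α x hx).2) (fun x hx => (PS_mem m α x hx).2) h2 h2
  have hle : ∀ x ∈ PS m α, (x:ℝ) ≤ (m:ℝ)^α := fun x hx => (Nat.le_floor_iff (by positivity)).1 (PS_mem m α x hx).2.2.1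
  refine ⟨x, y, q, n, (PS_mem m α x hx).1, (PS_mem m α y hy).1, (PS_mem m α q hq).1, hle x hx, hle y hy, hle q hq, by omega, hnle, ?_, ?_⟩
  · have : (n.primeFactorsList.length : ℝ) < l + 1 := lt_of_lt_of_le hlen hl2
    have : n.primeFactorsList.length < l + 1 := by exact_mod_cast this
    omega
  · rw [← ZMod.intCast_eq_intCast_iff, ← heq]
    push_cast; ring

theorem big_factor (n l : ℕ) (hn : 1 < n) (hl : n.primeFactorsList.length ≤ l + 1) :
    ∃ p s : ℕ, p.Prime ∧ n = p * s ∧ 0 < s ∧ s.primeFactorsList.length ≤ l ∧ s^(l+1) ≤ n^l := by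
  obtain ⟨p, hp, hmax⟩ := Finset.exists_max_image n.primeFactors id (Nat.nonempty_primeFactors.2 hn)
  have hpp := Nat.prime_of_mem_primeFactors hp
  obtain ⟨s, hs⟩ := Nat.dvd_of_mem_primeFactors hp
  have hs0 : s ≠ 0 := by rintro rfl; omega
  refine ⟨p, s, hpp, hs, Nat.pos_of_ne_zero hs0, ?_, ?_⟩
  · have h1 := (Nat.perm_primeFactorsList_mul hpp.ne_zero hs0).length_eq
    rw [← hs, Nat.primeFactorsList_prime hpp] at h1
    simp at h1
    omega
  · have h1 : n ≤ p^(l+1) := by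
      have h2 : n.primeFactorsList.prod ≤ p^n.primeFactorsList.length :=
        List.prod_le_pow_card _ _ (fun x hx => hmax x (List.mem_toFinset.2 hx))
      rw [Nat.prod_primeFactorsList (by omega)] at h2
      exact h2.trans (Nat.pow_le_pow_right hpp.one_le hl)
    have h3 : s^(l+1) * p^(l+1) = n^l * n := by rw [← mul_pow, mul_comm s p, ← hs, pow_succ]
    have h4 : s^(l+1) * p^(l+1) ≤ n^l * p^(l+1) := by rw [h3]; exact Nat.mul_le_mul_left _ h1
    exact Nat.le_of_mul_le_mul_right h4 (pow_pos hpp.pos _)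

open Filter in
theorem case2 (α β γ lam : ℝ) (l : ℕ) (hα : 1/2 ≤ α) (hα1 : α ≤ 1) (hγα : γ ≤ α) (hγβ : γ * l ≤ β * (l+1))
    (hlam : 0 < lam) (i1 : 2 < 2*α+γ) (i2 : lam < α+γ-1) (i3 : lam < 2*γ+α-2) (i4 : lam < γ-1/2)
    (hl2 : 1.775 + γ/(0.95*lam) ≤ l + 2) :
    ∀ᶠ m : ℕ in atTop, Concl α β l m := by
  obtain ⟨ε, hε, hε1, hev⟩ := cg_main α γ 0 lam hα hα1 le_rfl zero_le_one (by linarith) hlam (by linarith) (by linarith) (by linarith) i4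
  filter_upwards [hev, PS_card α ε hα hα1 hε hε1, eventually_ge_atTop 1] with m h1 h2 hm a ha
  have hm1 : (1:ℝ) ≤ m := by exact_mod_cast hm
  have hm0 : (0:ℝ) < m := by linarith
  obtain ⟨n, x, y, q, hx, hy, hq, hn1, hnle, hcop, heq, hlen⟩ :=
    h1 a (unit_of_gcd m a ha) (PS m α) {1} (fun x hx => (PS_mem m α x hx).2) (by simp) h2
      (by simpa using Real.rpow_le_one_of_one_le_of_nonpos hm1 (by linarith : -ε ≤ 0))
  have hle : ∀ x ∈ PS m α, (x:ℝ) ≤ (m:ℝ)^α := fun x hx => (Nat.le_floor_iff (by positivity)).1 (PS_mem m α x hx).2.2.1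
  have hlen' : n.primeFactorsList.length ≤ l + 1 := by
    have : (n.primeFactorsList.length : ℝ) < l + 2 := lt_of_lt_of_le hlen hl2
    have : n.primeFactorsList.length < l + 2 := by exact_mod_cast this
    omega
  obtain ⟨p, s, hp, hns, hs0, hsl, hsn⟩ := big_factor n l hn1 hlen'
  rw [Finset.mem_singleton] at hq
  subst hq
  refine ⟨x, y, p, s, (PS_mem m α x hx).1, (PS_mem m α y hy).1, hp, hle x hx, hle y hy, ?_, hs0, ?_, hsl, ?_⟩
  · have h3 : (p:ℝ) ≤ n := by
      have : p ≤ n := by rw [hns]; exact Nat.le_mul_of_pos_right p hs0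
      exact_mod_cast this
    exact (h3.trans hnle).trans (Real.rpow_le_rpow_of_exponent_le hm1 hγα)
  · have h3 : (s:ℝ)^(l+1) ≤ ((m:ℝ)^β)^(l+1) := by
      calc (s:ℝ)^(l+1) ≤ (n:ℝ)^l := by exact_mod_cast hsn
        _ ≤ ((m:ℝ)^γ)^l := by gcongr
        _ = (m:ℝ)^(γ*l) := by rw [Real.rpow_mul hm0.le, Real.rpow_natCast]
        _ ≤ (m:ℝ)^(β*(l+1)) := Real.rpow_le_rpow_of_exponent_le hm1 hγβ
        _ = ((m:ℝ)^β)^(l+1) := by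
          rw [Real.rpow_mul hm0.le, ← Real.rpow_natCast]; push_cast; rfl
    exact le_of_pow_le_pow_left₀ (by omega) (by positivity) h3
  · rw [← ZMod.intCast_eq_intCast_iff, ← heq, hns]
    push_cast; ring

theorem mono_fin {α β : ℝ} {l : ℕ} (h : ∀ᶠ m : ℕ in Filter.atTop, Concl α β l m) :
    ∀ ε : ℝ, 0 < ε → ∃ M : ℕ, ∀ m : ℕ, M ≤ m → ∀ a : ℤ, Int.gcd a m = 1 →
      ∃ p₁ p₂ p₃ s : ℕ, p₁.Prime ∧ p₂.Prime ∧ p₃.Prime ∧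
        (p₁ : ℝ) ≤ (m : ℝ) ^ (α + ε) ∧ (p₂ : ℝ) ≤ (m : ℝ) ^ (α + ε) ∧
        (p₃ : ℝ) ≤ (m : ℝ) ^ (α + ε) ∧
        0 < s ∧ (s : ℝ) ≤ (m : ℝ) ^ (β + ε) ∧ s.primeFactorsList.length ≤ l ∧
        ((p₁ * p₂ * p₃ * s : ℕ) : ℤ) ≡ a [ZMOD (m : ℤ)] := by
  intro ε hε
  obtain ⟨M, hM⟩ := Filter.eventually_atTop.1 h
  refine ⟨max M 1, fun m hm a ha => ?_⟩
  have hm1 : (1:ℝ) ≤ m := by exact_mod_cast (le_max_right M 1).trans hm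
  obtain ⟨p₁, p₂, p₃, s, h1, h2, h3, h4, h5, h6, h7, h8, h9, h10⟩ := hM m ((le_max_left M 1).trans hm) a ha
  have hle : ∀ c : ℝ, (m:ℝ)^c ≤ (m:ℝ)^(c+ε) := fun c => Real.rpow_le_rpow_of_exponent_le hm1 (by linarith)
  exact ⟨p₁, p₂, p₃, s, h1, h2, h3, h4.trans (hle α), h5.trans (hle α), h6.trans (hle α), h7, h8.trans (hle β), h9, h10⟩

theorem fin3 (α β : ℝ) (hα : 1/2 ≤ α) (hα1 : α ≤ 1) (hβ1 : β ≤ 1) (h1 : 1 < α/2 + β)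
    (h2 : β ≤ 2.925733 * (α/2 + β - 1)) : ∀ᶠ m : ℕ in Filter.atTop, Concl α β 3 m := by
  by_cases hb : 0.95 ≤ β
  · have hl : 0 < β - 1/2 - 0.0005 := by linarith
    refine case3 α β (β - 1/2 - 0.0005) 3 hα hα1 hβ1 h1 hl (by linarith) ?_
    have : β / (0.95 * (β - 1/2 - 0.0005)) ≤ 2.225 := by
      rw [div_le_iff₀ (by positivity)]; linarith
    push_cast; linarith
  · push Not at hb
    have ha : 0.7490 ≤ α := by linarith
    rcases le_total (α - 1/2) (3*α-2) with h | h
    · have hl : 0 < α - 1/2 - 0.001 := by linarith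
      refine case2 α β α (α - 1/2 - 0.001) 3 hα hα1 le_rfl (by push_cast; linarith) hl (by linarith) (by linarith) (by linarith) (by linarith) ?_
      have : α / (0.95 * (α - 1/2 - 0.001)) ≤ 3.225 := by
        rw [div_le_iff₀ (by positivity)]; linarith
      push_cast; linarith
    · have hl : 0 < 3*α-2 - 0.001 := by linarith
      refine case2 α β α (3*α-2 - 0.001) 3 hα hα1 le_rfl (by push_cast; linarith) hl (by linarith) (by linarith) (by linarith) (by linarith) ?_
      have : α / (0.95 * (3*α-2 - 0.001)) ≤ 3.225 := by
        rw [div_le_iff₀ (by positivity)]; linarith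
      push_cast; linarith

theorem fin4 (α β : ℝ) (l : ℕ) (hl4 : 4 ≤ l) (hα : 1/2 ≤ α) (hα1 : α ≤ 1) (hβ1 : β ≤ 1) (h1 : 1 < α/2 + β)
    (h2 : β ≤ (l - 0.1) * (α/2 + β - 1)) : ∀ᶠ m : ℕ in Filter.atTop, Concl α β l m := by
  have hx : (4:ℝ) ≤ l := by exact_mod_cast hl4
  have hβ0 : 1/2 < β := by linarith
  have hc0 : 0 < 0.95 * ((l:ℝ) - 0.775) := by linarith
  by_cases hb : β < 0.95 * (l - 0.775) * (β - 1/2)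
  · have hlam : 0 < β / (0.95 * (l - 0.775)) := by positivity
    refine case3 α β (β / (0.95 * (l - 0.775))) l hα hα1 hβ1 h1 hlam ?_ ?_
    · rw [div_lt_iff₀ hc0]; linarith
    · have : β / (0.95 * (β / (0.95 * ((l:ℝ) - 0.775)))) = l - 0.775 := by
        have : (l:ℝ) - 0.775 ≠ 0 := by linarith
        field_simp
      rw [this]; linarith
  · push Not at hb
    have hx0 : (0:ℝ) < l := by linarith
    set x : ℝ := (l:ℝ) with hxdef
    set u : ℝ := 1/x with hu
    have hux : u * x = 1 := by rw [hu]; field_simp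
    have hu0 : 0 < u := by positivity
    have hu4 : u ≤ 1/4 := by nlinarith
    have hcm : 0 < 0.95 * x - 1.73625 := by linarith
    have hb1 : β ≤ (0.95*x - 0.73625) / (2 * (0.95 * x - 1.73625)) := by
      rw [le_div_iff₀ (by positivity)]; nlinarith
    have hb2 : (0.95*x - 0.73625) / (2 * (0.95 * x - 1.73625)) ≤ ((x+1)*(x-0.1)) / (2*x*(x-1.1)) := by
      have : 0 < x - 1.1 := by linarith
      rw [div_le_div_iff₀ (by positivity) (by positivity)]
      nlinarith
    have hb3 : β * (2*x*(x-1.1)) ≤ (x+1)*(x-0.1) := by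
      have h3 : 0 < 2*x*(x-1.1) := mul_pos (by linarith) (by linarith)
      exact (le_div_iff₀ h3).1 (hb1.trans hb2)
    have ha : 1 - u ≤ α := by
      by_contra hc
      push Not at hc
      have h3 : x * α < x - 1 := by nlinarith
      have h4 : 0 < x - 0.1 := by linarith
      have h5 : (x-0.1) * (x*α) < (x-0.1)*(x-1) := mul_lt_mul_of_pos_left h3 h4
      have h6 : 2*x*β ≤ 2*x*((x-0.1)*(α/2+β-1)) := mul_le_mul_of_nonneg_left h2 (by linarith)
      nlinarith
    have hg : x/2 + 1 ≤ β * (x+1) := by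
      have h4 : 0 < x - 0.1 := by linarith
      have h3 : β ≤ (x-0.1)*(β-1/2) := h2.trans (mul_le_mul_of_nonneg_left (by linarith) h4.le)
      by_contra hc
      push Not at hc
      have h5 : 0 < x - 1.1 := by linarith
      have h6 : β * (x+1) * (x-1.1) < (x/2+1)*(x-1.1) := mul_lt_mul_of_pos_right hc h5
      have h7 : (x+1) * (0.5*(x-0.1)) ≤ (x+1) * (β*(x-1.1)) := mul_le_mul_of_nonneg_left (by linarith) (by linarith)
      nlinarith
    have hγ0 : 0 < 1/2 + u := by linarith
    have hd0 : 0 < 0.95 * (x + 0.225) := by linarith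
    have hlu : (1/2+u) / (0.95 * (x + 0.225)) < u := by
      rw [div_lt_iff₀ hd0]; nlinarith
    refine case2 α β (1/2+u) ((1/2+u) / (0.95 * (x + 0.225))) l hα hα1 (by linarith) ?_ (by positivity) (by linarith) (by linarith) (by linarith) (by linarith) ?_
    · have : (1/2+u)*x = x/2 + 1 := by linarith
      linarith
    · have : (1/2+u) / (0.95 * ((1/2+u) / (0.95 * (x + 0.225)))) = x + 0.225 := by
        have : x + 0.225 ≠ 0 := by linarith
        field_simp
      rw [this]; linarith

theorem stmt_2 (l : ℕ) (hl : 2 ≤ l) (α β : ℝ)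
    (hα : 1/2 ≤ α) (hβ : 0 ≤ β) (hα1 : α ≤ 1) (hβ1 : β ≤ 1)
    (h1 : α / 2 + β > 1)
    (h2 : β / (α / 2 + β - 1) ≤ greavesTheta l) :
    ∀ ε : ℝ, 0 < ε → ∃ M : ℕ, ∀ m : ℕ, M ≤ m → ∀ a : ℤ, Int.gcd a m = 1 →
      ∃ p₁ p₂ p₃ s : ℕ, p₁.Prime ∧ p₂.Prime ∧ p₃.Prime ∧
        (p₁ : ℝ) ≤ (m : ℝ) ^ (α + ε) ∧ (p₂ : ℝ) ≤ (m : ℝ) ^ (α + ε) ∧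
        (p₃ : ℝ) ≤ (m : ℝ) ^ (α + ε) ∧
        0 < s ∧ (s : ℝ) ≤ (m : ℝ) ^ (β + ε) ∧ s.primeFactorsList.length ≤ l ∧
        ((p₁ * p₂ * p₃ * s : ℕ) : ℤ) ≡ a [ZMOD (m : ℤ)] := by
  have hA : 0 < α / 2 + β - 1 := by linarith
  rw [div_le_iff₀ hA] at h2
  apply mono_fin
  rcases (by omega : l = 2 ∨ l = 3 ∨ 4 ≤ l) with rfl | rfl | h4
  · exfalso
    norm_num [greavesTheta, greavesDelta] at h2
    linarith
  · refine fin3 α β hα hα1 hβ1 h1 ?_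
    norm_num [greavesTheta, greavesDelta] at h2
    linarith
  · refine fin4 α β l h4 hα hα1 hβ1 h1 (h2.trans (mul_le_mul_of_nonneg_right ?_ hA.le))
    unfold greavesTheta greavesDelta
    rw [if_neg (by omega), if_neg (by omega)]
    split_ifs <;> linarith
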